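/- arXiv:1711.05991 — 7 statements merged into one kernel-verified Lean document; each statement's English description precedes it below -/
import Mathlib

section
/- (Kaloujnine) Let G be a group and (G_i)_{i≥1} a strongly central filtration on G. For each j ≥ 1 let 𝒜_j be the set of automorphisms σ of G such that σ(G_i) = G_i for all i ≥ 1 and σ(g)·g⁻¹ ∈ G_{i+j} for all i ≥ 1 and all g ∈ G_i. Then each 𝒜_j is a subgroup of Aut(G), 𝒜_{j+1} ⊆ 𝒜_j, and for all j, k ≥ 1, if σ ∈ 𝒜_j and τ ∈ 𝒜_k then the commutator σ ∘ τ ∘ σ⁻¹ ∘ τ⁻¹ lies in 𝒜_{j+k}; that is, (𝒜_j) is a strongly central filtration on 𝒜_1. -/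
/-- **Kaloujnine's theorem.** Given a strongly central filtration `(G_i)_{i ≥ 1}` on a group
`G`, the sets `𝒜_j` of automorphisms `σ` with `σ(G_i) = G_i` and `σ(g)·g⁻¹ ∈ G_{i+j}` for all
`i ≥ 1` and `g ∈ G_i` form a strongly central filtration on `𝒜_1`: each `𝒜_j` is a subgroup
of `Aut(G)`, `𝒜_{j+1} ⊆ 𝒜_j`, and commutators of elements of `𝒜_j` and `𝒜_k` lie in
`𝒜_{j+k}`. -/
theorem kaloujnine {G : Type*} [Group G] (Gf : ℕ → Subgroup G)
    (hG1 : Gf 1 = ⊤) (hdesc : ∀ i, 1 ≤ i → Gf (i + 1) ≤ Gf i)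
    (hsc : ∀ i j, 1 ≤ i → 1 ≤ j → ⁅Gf i, Gf j⁆ ≤ Gf (i + j)) :
    let A : ℕ → Set (MulAut G) := fun j =>
      {σ | (∀ i, 1 ≤ i → Subgroup.map σ.toMonoidHom (Gf i) = Gf i) ∧
        ∀ i, 1 ≤ i → ∀ g ∈ Gf i, σ g * g⁻¹ ∈ Gf (i + j)}
    (∀ j, 1 ≤ j →
        (1 : MulAut G) ∈ A j ∧
        (∀ σ τ : MulAut G, σ ∈ A j → τ ∈ A j → σ * τ ∈ A j) ∧
        (∀ σ : MulAut G, σ ∈ A j → σ⁻¹ ∈ A j)) ∧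
    (∀ j, 1 ≤ j → A (j + 1) ⊆ A j) ∧
    (∀ j k, 1 ≤ j → 1 ≤ k → ∀ σ ∈ A j, ∀ τ ∈ A k,
      σ * τ * σ⁻¹ * τ⁻¹ ∈ A (j + k)) := by
  intro A
  have anti : ∀ i m, 1 ≤ i → Gf (i + m) ≤ Gf i := by
    intro i m hi
    induction m with
    | zero => exact le_rfl
    | succ m ih => exact (hdesc (i + m) (by omega)).trans ih
  have memA : ∀ j (σ : MulAut G), σ ∈ A j ↔
      (∀ i, 1 ≤ i → ∀ g, σ g ∈ Gf i ↔ g ∈ Gf i) ∧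
        ∀ i, 1 ≤ i → ∀ g ∈ Gf i, σ g * g⁻¹ ∈ Gf (i + j) := by
    intro j σ
    refine and_congr (forall_congr' fun i => forall_congr' fun _ => ?_) Iff.rfl
    constructor
    · intro h g
      constructor
      · intro hg
        rw [← h] at hg
        obtain ⟨y, hy, e⟩ := hg
        have e2 : y = g := σ.injective e
        exact e2 ▸ hy
      · intro hg
        rw [← h]
        exact ⟨g, hg, rfl⟩
    · intro h
      ext y
      constructor
      · rintro ⟨z, hz, rfl⟩
        exact (h z).2 hz
      · intro hy
        refine ⟨σ.symm y, (h _).1 ?_, σ.apply_symm_apply y⟩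
        rwa [σ.apply_symm_apply y]
  have inv1 : ∀ (σ : MulAut G), (∀ i, 1 ≤ i → ∀ g, σ g ∈ Gf i ↔ g ∈ Gf i) →
      ∀ i, 1 ≤ i → ∀ g, σ⁻¹ g ∈ Gf i ↔ g ∈ Gf i := by
    intro σ h i hi g
    rw [← h i hi, MulAut.apply_inv_self]
  refine ⟨fun j hj => ⟨?_, ?_, ?_⟩, ?_, ?_⟩
  · rw [memA]
    refine ⟨fun i _ g => Iff.rfl, fun i _ g _ => ?_⟩
    simp [one_mem]
  · intro σ τ hσ hτ
    rw [memA] at *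
    refine ⟨fun i hi g => ?_, fun i hi g hg => ?_⟩
    · rw [MulAut.mul_apply, hσ.1 i hi, hτ.1 i hi]
    · have h := mul_mem (hσ.2 i hi (τ g) ((hτ.1 i hi g).2 hg)) (hτ.2 i hi g hg)
      rw [MulAut.mul_apply]
      convert h using 1
      group
  · intro σ hσ
    rw [memA] at *
    refine ⟨inv1 σ hσ.1, fun i hi g hg => ?_⟩
    have h := inv_mem (hσ.2 i hi (σ⁻¹ g) ((inv1 σ hσ.1 i hi g).2 hg))
    rw [MulAut.apply_inv_self] at h
    convert h using 1
    group
  · intro j hj σ hσ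
    rw [memA] at *
    exact ⟨hσ.1, fun i hi g hg => anti (i + j) 1 (by omega) (hσ.2 i hi g hg)⟩
  · intro j k hj hk σ hσ τ hτ
    rw [memA] at *
    refine ⟨fun i hi g => ?_, fun i hi g hg => ?_⟩
    · simp only [MulAut.mul_apply]
      rw [hσ.1 i hi, hτ.1 i hi, inv1 σ hσ.1 i hi, inv1 τ hτ.1 i hi]
    · obtain ⟨x, hx⟩ : ∃ x, x = σ⁻¹ (τ⁻¹ g) := ⟨_, rfl⟩
      have hxm : x ∈ Gf i := by
        rw [hx, inv1 σ hσ.1 i hi, inv1 τ hτ.1 i hi]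
        exact hg
      have hgx : g = τ (σ x) := by
        rw [hx, MulAut.apply_inv_self, MulAut.apply_inv_self]
      simp only [MulAut.mul_apply]
      rw [← hx, hgx]
      have ha := hσ.2 i hi x hxm
      have hb := hτ.2 i hi x hxm
      obtain ⟨a, hae⟩ : ∃ a, a = σ x * x⁻¹ := ⟨_, rfl⟩
      obtain ⟨b, hbe⟩ : ∃ b, b = τ x * x⁻¹ := ⟨_, rfl⟩
      rw [← hae] at ha
      rw [← hbe] at hb
      have h1 : σ x = a * x := by rw [hae]; group
      have h2 : τ x = b * x := by rw [hbe]; group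
      have hb' := hσ.2 (i + k) (by omega) b hb
      have ha' := hτ.2 (i + j) (by omega) a ha
      have hc := hsc (i + k) (i + j) (by omega) (by omega)
        (Subgroup.commutator_mem_commutator hb ha)
      rw [show i + k + (i + j) = (i + (j + k)) + i by omega] at hc
      have hc' := anti _ _ (by omega) hc
      rw [show i + k + j = i + (j + k) by omega] at hb'
      rw [show i + j + k = i + (j + k) by omega] at ha'
      have h := mul_mem (mul_mem hb' hc') (inv_mem ha')
      convert h using 1
      rw [h2, h1, map_mul, map_mul, h1, h2, commutatorElement_def]
      group
end

section
/- (Lazard) Let A be an associative unital ring and (A_i)_{i≥1} a descending chain of two-sided ideals A_1 ⊇ A_2 ⊇ ⋯ with A_i·A_j ⊆ A_{i+j} for all i, j ≥ 1. For i ≥ 1 let U_i be the set of units a of A with a − 1 ∈ A_i. Then: (1) each U_i is a subgroup of the group of units of A; (2) if a ∈ U_i and b ∈ U_j then the commutator a·b·a⁻¹·b⁻¹ lies in U_{i+j}; (3) moreover a·b·a⁻¹·b⁻¹ − 1 − ((a−1)(b−1) − (b−1)(a−1)) ∈ A_{i+j+1}, so that a ↦ a − 1 induces a morphism from the graded Lie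 ring of the filtration (U_i) to the associated graded ring of (A_i). -/
/-- **Lazard's theorem.** Let `A` be an associative unital ring, and `(A_i)_{i≥1}` a
descending chain of two-sided ideals with `A_i·A_j ⊆ A_{i+j}`.  Set
`U_i = {a ∈ Aˣ | a - 1 ∈ A_i}`.  Then (1) each `U_i` is a subgroup of `Aˣ`;
(2) `[U_i, U_j] ⊆ U_{i+j}`; and (3) `aba⁻¹b⁻¹ - 1 ≡ (a-1)(b-1) - (b-1)(a-1)`
modulo `A_{i+j+1}`, so that `a ↦ a - 1` induces a morphism of graded Lie rings. -/
theorem lazard {A : Type*} [Ring A] (I : ℕ → AddSubgroup A)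
    (hdesc : ∀ i, 1 ≤ i → I (i + 1) ≤ I i)
    (hleft : ∀ i, 1 ≤ i → ∀ r : A, ∀ a ∈ I i, r * a ∈ I i)
    (hright : ∀ i, 1 ≤ i → ∀ r : A, ∀ a ∈ I i, a * r ∈ I i)
    (hmul : ∀ i j, 1 ≤ i → 1 ≤ j → ∀ a ∈ I i, ∀ b ∈ I j, a * b ∈ I (i + j)) :
    let U : ℕ → Set Aˣ := fun i => {a | (a : A) - 1 ∈ I i}
    (∀ i, 1 ≤ i →
        (1 : Aˣ) ∈ U i ∧
        (∀ a b : Aˣ, a ∈ U i → b ∈ U i → a * b ∈ U i) ∧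
        (∀ a : Aˣ, a ∈ U i → a⁻¹ ∈ U i)) ∧
    (∀ i j, 1 ≤ i → 1 ≤ j → ∀ a ∈ U i, ∀ b ∈ U j, a * b * a⁻¹ * b⁻¹ ∈ U (i + j)) ∧
    (∀ i j, 1 ≤ i → 1 ≤ j → ∀ a ∈ U i, ∀ b ∈ U j,
      ((a * b * a⁻¹ * b⁻¹ : Aˣ) : A) - 1 -
        (((a : A) - 1) * ((b : A) - 1) - ((b : A) - 1) * ((a : A) - 1)) ∈ I (i + j + 1)) := by
  intro U
  have hle1 : ∀ i, 1 ≤ i → I i ≤ I 1 := by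
    intro i hi
    induction i, hi using Nat.le_induction with
    | base => exact le_refl _
    | succ n hn ih => exact (hdesc n hn).trans ih
  have hmulU : ∀ i, 1 ≤ i → ∀ a b : Aˣ, a ∈ U i → b ∈ U i → a * b ∈ U i := by
    intro i hi a b ha hb
    change ((a * b : Aˣ) : A) - 1 ∈ I i
    have h : ((a * b : Aˣ) : A) - 1 = a * ((b : A) - 1) + ((a : A) - 1) := by
      push_cast; noncomm_ring
    rw [h]
    exact (I i).add_mem (hleft i hi _ _ hb) ha
  have hinvU : ∀ i, 1 ≤ i → ∀ a : Aˣ, a ∈ U i → a⁻¹ ∈ U i := by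
    intro i hi a ha
    change ((a⁻¹ : Aˣ) : A) - 1 ∈ I i
    have h : ((a⁻¹ : Aˣ) : A) - 1 = -(((a⁻¹ : Aˣ) : A) * ((a : A) - 1)) := by
      rw [mul_sub, Units.inv_mul]; simp
    rw [h]
    exact (I i).neg_mem (hleft i hi _ _ ha)
  have hbr : ∀ i j, 1 ≤ i → 1 ≤ j → ∀ a ∈ U i, ∀ b ∈ U j,
      ((a : A) - 1) * ((b : A) - 1) - ((b : A) - 1) * ((a : A) - 1) ∈ I (i + j) := by
    intro i j hi hj a ha b hb
    refine (I (i + j)).sub_mem (hmul i j hi hj _ ha _ hb) ?_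
    rw [add_comm i j]
    exact hmul j i hj hi _ hb _ ha
  have hkey : ∀ a b : Aˣ, ((a * b * a⁻¹ * b⁻¹ : Aˣ) : A) - 1 =
      (((a : A) - 1) * ((b : A) - 1) - ((b : A) - 1) * ((a : A) - 1)) *
        ((a⁻¹ * b⁻¹ : Aˣ) : A) := by
    intro a b
    have h1 : ((a : A) - 1) * ((b : A) - 1) - ((b : A) - 1) * ((a : A) - 1)
        = ((a * b : Aˣ) : A) - ((b * a : Aˣ) : A) := by
      push_cast; noncomm_ring
    rw [h1, sub_mul, ← Units.val_mul, ← Units.val_mul]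
    have h2 : b * a * (a⁻¹ * b⁻¹) = 1 := by group
    rw [h2, ← mul_assoc, Units.val_one]
  refine ⟨fun i hi => ⟨?_, hmulU i hi, hinvU i hi⟩, ?_, ?_⟩
  · change ((1 : Aˣ) : A) - 1 ∈ I i
    simp
  · intro i j hi hj a ha b hb
    change ((a * b * a⁻¹ * b⁻¹ : Aˣ) : A) - 1 ∈ I (i + j)
    rw [hkey]
    exact hright _ (by omega) _ _ (hbr i j hi hj a ha b hb)
  · intro i j hi hj a ha b hb
    rw [hkey, ← mul_sub_one]
    refine hmul (i + j) 1 (by omega) le_rfl _ (hbr i j hi hj a ha b hb) _ ?_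
    exact hmulU 1 le_rfl _ _ (hinvU 1 le_rfl a (hle1 i hi ha)) (hinvU 1 le_rfl b (hle1 j hj hb))
end

section
/- Let R be a commutative ring, 𝔞 an ideal of R, and M an n×n matrix over R all of whose entries lie in 𝔞. Then det(1 + M) − 1 − tr(M) lies in the ideal 𝔞², the square of 𝔞. -/
/-- If all entries of the `n×n` matrix `M` lie in an ideal `𝔞` of a commutative ring `R`,
then `det(1 + M) - 1 - tr(M) ∈ 𝔞²`. -/
theorem det_one_add_sub_trace_mem_sq {R : Type*} [CommRing R] (a : Ideal R) (n : ℕ)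
    (M : Matrix (Fin n) (Fin n) R) (hM : ∀ i j, M i j ∈ a) :
    (1 + M).det - 1 - Matrix.trace M ∈ a ^ 2 := by
  induction n with
  | zero => simp [Matrix.trace]
  | succ n ih =>
    have h := ih (M.submatrix Fin.succ Fin.succ) (fun i j => hM _ _)
    have hs : (1 + M).submatrix Fin.succ (Fin.succAbove 0)
        = 1 + M.submatrix Fin.succ Fin.succ := by
      ext i j
      simp [Matrix.one_apply]
    have htr : M.trace = M 0 0 + (M.submatrix Fin.succ Fin.succ).trace := by
      simp [Matrix.trace, Fin.sum_univ_succ]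
    have htm : (M.submatrix Fin.succ Fin.succ).trace ∈ a :=
      Ideal.sum_mem _ (fun i _ => hM _ _)
    have hrest : ∑ j : Fin n, (-1) ^ (j.succ : ℕ) * (1 + M) 0 j.succ *
        ((1 + M).submatrix Fin.succ (Fin.succAbove j.succ)).det ∈ a ^ 2 := by
      refine Ideal.sum_mem _ (fun j _ => ?_)
      rw [pow_two a]
      refine Ideal.mul_mem_mul (Ideal.mul_mem_left _ _ ?_) ?_
      · have : (1 + M) 0 j.succ = M 0 j.succ := by
          simp [Matrix.one_apply, (Fin.succ_ne_zero j).symm]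
        rw [this]; exact hM _ _
      · rw [← Ideal.Quotient.eq_zero_iff_mem, RingHom.map_det]
        have : NeZero n := ⟨fun h0 => by subst h0; exact j.elim0⟩
        refine Matrix.det_eq_zero_of_column_eq_zero (0 : Fin n) (fun i => ?_)
        have : (j.succ.succAbove (0 : Fin n)) = 0 :=
          Fin.succAbove_ne_zero_zero (Fin.succ_ne_zero j)
        simp only [RingHom.mapMatrix_apply, Matrix.map_apply, Matrix.submatrix_apply, this,
          Matrix.add_apply, Matrix.one_apply_ne (Fin.succ_ne_zero i), zero_add]
        exact Ideal.Quotient.eq_zero_iff_mem.2 (hM _ _)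
    rw [Matrix.det_succ_row_zero, Fin.sum_univ_succ, hs, htr]
    generalize (1 + M.submatrix Fin.succ Fin.succ).det = d at *
    generalize (M.submatrix Fin.succ Fin.succ).trace = t at *
    have h2 : M 0 0 * t ∈ a ^ 2 := by
      rw [pow_two a]; exact Ideal.mul_mem_mul (hM _ _) htm
    have h3 := Ideal.mul_mem_left _ (1 + M 0 0) h
    have h4 := add_mem (add_mem h3 h2) hrest
    convert! h4 using 1
    simp only [Matrix.add_apply, Matrix.one_apply_eq, Fin.val_zero, pow_zero]
    ring
end

section
/- Let n ≥ 1 and let IA_n be the subgroup of Aut(F_n) consisting of the automorphisms σ such that σ(g)·g⁻¹ lies in the commutator subgroup ⁅F_n, F_n⁆ for all g ∈ F_n. Then the abelianization IA_n/⁅IA_n, IA_n⁆ is a free abelian group of rank n²(n−1)/2; equivalently, it is isomorphic as an abelian group to Hom(ℤⁿ, Λ²(ℤⁿ)). -/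
/-- The group `IA_n`: automorphisms of the free group `F_n` acting trivially on its
abelianization, i.e. `σ` with `σ(g)·g⁻¹ ∈ ⁅F_n, F_n⁆` for all `g`. -/
def IAGroup (n : ℕ) : Subgroup (MulAut (FreeGroup (Fin n))) where
  carrier := {σ | ∀ g : FreeGroup (Fin n), σ g * g⁻¹ ∈ commutator (FreeGroup (Fin n))}
  one_mem' := by
    intro g
    simpa using Subgroup.one_mem _
  mul_mem' := by
    intro a b ha hb g
    have h := Subgroup.mul_mem _ (ha (b g)) (hb g)
    simpa [mul_assoc] using h
  inv_mem' := by
    intro a ha g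
    have h := Subgroup.inv_mem _ (ha (a⁻¹ g))
    simpa [mul_inv_rev] using h


namespace IAab

section LCP
variable {β : Type*} [DecidableEq β]

/-- length of the longest common prefix -/
def lcp : List β → List β → ℕ
  | a :: as, b :: bs => if a = b then lcp as bs + 1 else 0
  | _, _ => 0

theorem lcp_comm (a b : List β) : lcp a b = lcp b a := by
  induction a generalizing b with
  | nil => cases b <;> simp [lcp]
  | cons x xs ih =>
    cases b with
    | nil => simp [lcp]
    | cons y ys =>
      simp only [lcp, ih ys, eq_comm]

theorem lcp_ultra (a b c : List β) : min (lcp a b) (lcp b c) ≤ lcp a c := by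
  induction a generalizing b c with
  | nil => cases b <;> simp [lcp]
  | cons x xs ih =>
    cases b with
    | nil => simp [lcp]
    | cons y ys =>
      cases c with
      | nil => simp [lcp]
      | cons z zs =>
        have := ih ys zs
        simp only [lcp]
        split_ifs <;> simp_all

theorem lcp_le_left (a b : List β) : lcp a b ≤ a.length := by
  induction a generalizing b with
  | nil => cases b <;> simp [lcp]
  | cons x xs ih =>
    cases b with
    | nil => simp [lcp]
    | cons y ys =>
      have := ih ys
      simp only [lcp]
      split_ifs <;> simp_all

theorem lcp_spec (a b : List β) : ∃ p s t, a = p ++ s ∧ b = p ++ t ∧ p.length = lcp a b ∧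
    ∀ x ∈ s.head?, ∀ y ∈ t.head?, x ≠ y := by
  induction a generalizing b with
  | nil => exact ⟨[], [], b, by cases b <;> simp [lcp]⟩
  | cons x xs ih =>
    cases b with
    | nil => exact ⟨[], x :: xs, [], by simp [lcp]⟩
    | cons y ys =>
      by_cases h : x = y
      · obtain ⟨p, s, t, h1, h2, h3, h4⟩ := ih ys
        exact ⟨x :: p, s, t, by simp [h1.symm], by simp [h, h2.symm], by simp [lcp, h, h3], h4⟩
      · exact ⟨[], x :: xs, y :: ys, by simp [lcp, h]⟩

end LCP

section Geo
open FreeGroup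
variable {α : Type*} [DecidableEq α]

/-- Gromov product in the Cayley tree -/
def gp (u v : FreeGroup α) : ℕ := lcp u.toWord v.toWord

theorem gp_comm (u v : FreeGroup α) : gp u v = gp v u := lcp_comm _ _
theorem gp_ultra (u v w : FreeGroup α) : min (gp u v) (gp v w) ≤ gp u w := lcp_ultra _ _ _
theorem gp_le_left (u v : FreeGroup α) : gp u v ≤ u.norm := lcp_le_left _ _
theorem gp_le_right (u v : FreeGroup α) : gp u v ≤ v.norm := by
  rw [gp_comm]; exact gp_le_left _ _

theorem isReduced_invRev {s : List (α × Bool)} (h : IsReduced s) : IsReduced (invRev s) := by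
  rw [isReduced_iff_reduce_eq] at h ⊢
  rw [reduce_invRev, h]

theorem isReduced_invRev_append {s t : List (α × Bool)} (hs : IsReduced s) (ht : IsReduced t)
    (h : ∀ x ∈ s.head?, ∀ y ∈ t.head?, x ≠ y) : IsReduced (invRev s ++ t) := by
  have hs' := isReduced_invRev hs
  unfold FreeGroup.IsReduced at *
  rw [List.isChain_append]
  refine ⟨hs', ht, ?_⟩
  intro x hx y hy hxy
  cases s with
  | nil => simp [invRev] at hx
  | cons a s =>
    simp [invRev] at hx
    subst hx
    have := h a (by simp) y hy
    obtain ⟨a1, a2⟩ := a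
    obtain ⟨y1, y2⟩ := y
    simp at hxy this ⊢
    have := this hxy
    revert this; cases a2 <;> cases y2 <;> simp

theorem norm_gp (u v : FreeGroup α) : (u⁻¹ * v).norm + 2 * gp u v = u.norm + v.norm := by
  obtain ⟨p, s, t, h1, h2, h3, h4⟩ := lcp_spec u.toWord v.toWord
  have hs : IsReduced s := (isReduced_toWord (x := u)).infix ⟨p, [], by simp [h1]⟩
  have ht : IsReduced t := (isReduced_toWord (x := v)).infix ⟨p, [], by simp [h2]⟩
  have hr := isReduced_invRev_append hs ht h4
  have hu : u = mk p * mk s := by rw [mul_mk, ← h1, mk_toWord]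
  have hv : v = mk p * mk t := by rw [mul_mk, ← h2, mk_toWord]
  have huv : u⁻¹ * v = mk (invRev s ++ t) := by
    rw [hu, hv, ← mul_mk, ← inv_mk]; group
  have e1 : (u⁻¹ * v).norm = s.length + t.length := by
    rw [huv, FreeGroup.norm, toWord_mk, hr.reduce_eq]; simp
  have e2 : u.norm = p.length + s.length := by rw [FreeGroup.norm, h1]; simp
  have e3 : v.norm = p.length + t.length := by rw [FreeGroup.norm, h2]; simp
  have e4 : gp u v = p.length := h3.symm
  omega

theorem norm_mul_gp (u v : FreeGroup α) : (u * v).norm + 2 * gp u⁻¹ v = u.norm + v.norm := by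
  have := norm_gp u⁻¹ v
  simpa using this

theorem gp_mul (u v : FreeGroup α) : gp u (u * v) + gp u⁻¹ v = u.norm := by
  have h1 := norm_gp u (u * v)
  have h2 := norm_mul_gp u v
  rw [inv_mul_cancel_left] at h1
  omega

/-- words with given prefix -/
theorem take_eq_of_gp (u v : FreeGroup α) (k : ℕ) (hk : k ≤ gp u v) :
    u.toWord.take k = v.toWord.take k := by
  obtain ⟨p, s, t, h1, h2, h3, h4⟩ := lcp_spec u.toWord v.toWord
  have : k ≤ p.length := by rw [h3]; exact hk
  rw [h1, h2, List.take_append_of_le_length this, List.take_append_of_le_length this]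

theorem gp_inv_self_lt (u : FreeGroup α) (hu : u ≠ 1) : 2 * gp u⁻¹ u < u.norm := by
  by_contra hcon
  push Not at hcon
  have hpos : 0 < u.norm := Nat.pos_of_ne_zero (by simpa using hu)
  have htake := take_eq_of_gp u⁻¹ u _ le_rfl
  have hle := gp_le_right u⁻¹ u
  set c := gp u⁻¹ u with hc
  rw [toWord_inv] at htake
  set w := u.toWord with hw
  have hlen : w.length = u.norm := rfl
  have key : ∀ t (ht : t < c), w[t]'(by omega) =
      ((w[w.length - 1 - t]'(by omega)).1, !(w[w.length - 1 - t]'(by omega)).2) := by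
    intro t ht
    have h0 : (List.take c w)[t]'(by simp; omega) = (List.take c (invRev w))[t]'(by simp; omega) := by
      simp only [htake]
    simpa [invRev] using h0
  rcases Nat.even_or_odd' u.norm with ⟨h, hh | hh⟩
  · have k1 := key (h - 1) (by omega)
    have hred : IsReduced w := isReduced_toWord
    unfold FreeGroup.IsReduced at hred
    have := List.isChain_iff_getElem.1 hred (h - 1) (by omega)
    have e : w.length - 1 - (h - 1) = h - 1 + 1 := by omega
    simp only [e] at k1
    rw [k1] at this
    simp at this
  · have k1 := key h (by omega)
    have e : w.length - 1 - h = h := by omega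
    simp only [e] at k1
    have := congrArg Prod.snd k1
    simp at this

end Geo
end IAab


namespace IAab
open FreeGroup hiding map_inv map_mul map_one
set_option linter.unusedSectionVars false

section Auts
variable {α : Type*} [DecidableEq α]

/-- free factor generated by the letters other than `i` -/
def Fp (i : α) : Subgroup (FreeGroup α) := Subgroup.closure (of '' {j | j ≠ i})

theorem of_mem_Fp {i j : α} (h : j ≠ i) : of j ∈ Fp i :=
  Subgroup.subset_closure ⟨j, h, rfl⟩

/-- `x_i ↦ u x_i v` -/
def bHom (i : α) (u v : FreeGroup α) : FreeGroup α →* FreeGroup α :=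
  FreeGroup.lift (fun l => if l = i then u * of l * v else of l)

theorem hom_eq_of_Fp {f : FreeGroup α →* FreeGroup α} {i : α} (hf : ∀ j, j ≠ i → f (of j) = of j)
    {w : FreeGroup α} (hw : w ∈ Fp i) : f w = w := by
  induction hw using Subgroup.closure_induction with
  | mem x hx => obtain ⟨j, hj, rfl⟩ := hx; exact hf j hj
  | one => simp
  | mul x y _ _ hx hy => simp [hx, hy]
  | inv x _ hx => simp [hx]

theorem bHom_self (i : α) (u v : FreeGroup α) : bHom i u v (of i) = u * of i * v := by
  simp [bHom]

theorem bHom_ne {i j : α} (h : j ≠ i) (u v : FreeGroup α) : bHom i u v (of j) = of j := by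
  simp [bHom, h]

theorem bHom_mem {i : α} {w : FreeGroup α} (hw : w ∈ Fp i) (u v : FreeGroup α) :
    bHom i u v w = w := hom_eq_of_Fp (fun _ hj => bHom_ne hj u v) hw

theorem bHom_comp {i : α} {u v u' v' : FreeGroup α} (hu : u' ∈ Fp i) (hv : v' ∈ Fp i) :
    (bHom i u v).comp (bHom i u' v') = bHom i (u' * u) (v * v') := by
  ext j
  by_cases h : j = i
  · subst h
    simp [bHom_self, bHom_mem hu, bHom_mem hv, mul_assoc]
  · simp [bHom_ne h]

theorem bHom_one (i : α) : bHom i (1 : FreeGroup α) 1 = MonoidHom.id _ := by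
  ext j
  by_cases h : j = i
  · subst h
    simp [bHom_self]
  · simp [bHom_ne h]

open Classical in
/-- the automorphism `x_i ↦ u x_i v` (for `u`, `v` not involving `x_i`) -/
noncomputable def B (i : α) (u v : FreeGroup α) : MulAut (FreeGroup α) :=
  if h : u ∈ Fp i ∧ v ∈ Fp i then
    MonoidHom.toMulEquiv (bHom i u v) (bHom i u⁻¹ v⁻¹)
      (by rw [bHom_comp h.1 h.2]; simp [bHom_one])
      (by rw [bHom_comp (inv_mem h.1) (inv_mem h.2)]; simp [bHom_one])
  else 1

variable {i j : α} {u v u' v' w : FreeGroup α}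

theorem B_apply (hu : u ∈ Fp i) (hv : v ∈ Fp i) (w : FreeGroup α) : B i u v w = bHom i u v w := by
  rw [B, dif_pos ⟨hu, hv⟩]; rfl

theorem B_self (hu : u ∈ Fp i) (hv : v ∈ Fp i) : B i u v (of i) = u * of i * v := by
  rw [B_apply hu hv, bHom_self]

theorem B_mem (hw : w ∈ Fp i) : B i u v w = w := by
  by_cases h : u ∈ Fp i ∧ v ∈ Fp i
  · rw [B_apply h.1 h.2, bHom_mem hw]
  · rw [B, dif_neg h]; rfl

theorem B_ne (h : j ≠ i) : B i u v (of j) = of j := B_mem (of_mem_Fp h)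

theorem aut_ext {f g : MulAut (FreeGroup α)} (h : ∀ i, f (of i) = g (of i)) : f = g := by
  apply MulEquiv.toMonoidHom_injective
  ext i
  exact h i

theorem B_mul (hu : u ∈ Fp i) (hv : v ∈ Fp i) (hu' : u' ∈ Fp i) (hv' : v' ∈ Fp i) :
    B i u v * B i u' v' = B i (u' * u) (v * v') := by
  apply aut_ext
  intro j
  by_cases h : j = i
  · subst h
    rw [MulAut.mul_apply, B_self hu' hv', B_self (mul_mem hu' hu) (mul_mem hv hv')]
    simp [B_self hu hv, B_mem hu', B_mem hv', mul_assoc]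
  · simp [B_ne h]

theorem B_one : B i (1 : FreeGroup α) 1 = 1 := by
  apply aut_ext
  intro j
  by_cases h : j = i
  · subst h
    rw [B_self (one_mem _) (one_mem _)]; simp
  · simp [B_ne h]

theorem B_inv (hu : u ∈ Fp i) (hv : v ∈ Fp i) : (B i u v)⁻¹ = B i u⁻¹ v⁻¹ := by
  rw [inv_eq_iff_mul_eq_one, B_mul hu hv (inv_mem hu) (inv_mem hv)]
  simp [B_one]

/-- signed letters -/
def lt (l : α × Bool) : FreeGroup α := mk [l]

theorem lt_true (i : α) : lt (i, true) = of i := rfl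
theorem lt_false (i : α) : lt (i, false) = (of i)⁻¹ := rfl
theorem lt_not (i : α) (b : Bool) : lt (i, !b) = (lt (i, b))⁻¹ := by
  cases b <;> simp [lt_true, lt_false]
theorem lt_mem_Fp {l : α × Bool} (h : l.1 ≠ i) : lt l ∈ Fp i := by
  obtain ⟨j, b⟩ := l
  cases b
  · exact inv_mem (of_mem_Fp h)
  · exact of_mem_Fp h
theorem lt_toWord (l : α × Bool) : (lt l).toWord = [l] := rfl
theorem lt_inj {l m : α × Bool} : lt l = lt m ↔ l = m := by
  rw [← toWord_inj, lt_toWord, lt_toWord]; simp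

/-- inversion of the letter `i` -/
def iotaHom (i : α) : FreeGroup α →* FreeGroup α :=
  FreeGroup.lift (fun l => if l = i then (of l)⁻¹ else of l)

theorem iotaHom_comp (i : α) : (iotaHom i).comp (iotaHom i) = MonoidHom.id _ := by
  ext j
  by_cases h : j = i <;> simp [iotaHom, h]

/-- inversion of the letter `i` -/
def iota (i : α) : MulAut (FreeGroup α) :=
  MonoidHom.toMulEquiv (iotaHom i) (iotaHom i) (iotaHom_comp i) (iotaHom_comp i)

theorem iota_self (i : α) : iota i (of i) = (of i)⁻¹ := by
  change iotaHom i (of i) = _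
  simp [iotaHom]
theorem iota_ne (h : j ≠ i) : iota i (of j) = of j := by
  change iotaHom i (of j) = _
  simp [iotaHom, h]
theorem iota_inv (i : α) : (iota i)⁻¹ = iota i := rfl

theorem iota_Fp (hw : w ∈ Fp i) : iota i w = w :=
  hom_eq_of_Fp (f := (iota i).toMonoidHom) (fun _ hj => iota_ne hj) hw

/-- signed permutations -/
def W (α : Type*) [DecidableEq α] [Finite α] : Subgroup (MulAut (FreeGroup α)) where
  carrier := {φ | ∀ i, ∃ l, φ (of i) = lt l}
  one_mem' := fun i => ⟨(i, true), rfl⟩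
  mul_mem' := by
    intro f g hf hg i
    obtain ⟨⟨j, b⟩, hj⟩ := hg i
    obtain ⟨⟨k, c⟩, hk⟩ := hf j
    rw [MulAut.mul_apply, hj]
    cases b
    · exact ⟨(k, !c), by rw [lt_not, lt_false, map_inv, hk]⟩
    · exact ⟨(k, c), by rw [lt_true, hk]⟩
  inv_mem' := by
    intro f hf
    choose p hp using hf
    have hinj : Function.Injective (fun i => (p i).1) := by
      intro i j hij
      simp only at hij
      by_cases h2 : (p i).2 = (p j).2
      · have : f (of i) = f (of j) := by rw [hp, hp, Prod.ext hij h2]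
        exact of_injective (f.injective this)
      · have h3 : p i = ((p j).1, !(p j).2) := Prod.ext hij (by revert h2; cases (p i).2 <;> cases (p j).2 <;> simp)
        have : f (of i) = f (of j)⁻¹ := by rw [map_inv, hp, hp, h3, lt_not]
        have h4 := f.injective this
        rw [← lt_true, ← lt_false, lt_inj] at h4
        simp at h4
    have hsurj := Finite.surjective_of_injective hinj
    intro j
    obtain ⟨i, hi⟩ := hsurj j
    simp only at hi
    refine ⟨(i, (p i).2), ?_⟩
    rw [MulAut.inv_apply, MulEquiv.symm_apply_eq]
    have h5 := hp i
    have h6 : p i = (j, (p i).2) := Prod.ext hi rfl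
    generalize (p i).2 = b at *
    rw [h6] at h5
    cases b
    · rw [lt_false, map_inv, h5, lt_false, inv_inv]
    · rw [lt_true, h5, lt_true]

theorem mem_W [Finite α] {f : MulAut (FreeGroup α)} : f ∈ W α ↔ ∀ i, ∃ l, f (of i) = lt l := Iff.rfl

theorem iota_mem_W [Finite α] (i : α) : iota i ∈ W α := by
  intro j
  by_cases h : j = i
  · subst h; exact ⟨(j, false), iota_self j⟩
  · exact ⟨(j, true), iota_ne h⟩

/-- the group generated by Nielsen transformations -/
def Nie (α : Type*) [DecidableEq α] [Finite α] : Subgroup (MulAut (FreeGroup α)) :=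
  Subgroup.closure (W α ∪ {f | ∃ i j, j ≠ i ∧ f = B i 1 (of j)})

theorem W_le_Nie [Finite α] : W α ≤ Nie α := fun _ h => Subgroup.subset_closure (Or.inl h)

theorem iota_B (hu : u ∈ Fp i) (hv : v ∈ Fp i) : iota i * B i u v * (iota i)⁻¹ = B i v⁻¹ u⁻¹ := by
  apply aut_ext
  intro j
  rw [iota_inv]
  by_cases h : j = i
  · subst h
    simp [iota_self, B_self hu hv, B_self (inv_mem hv) (inv_mem hu), iota_Fp hu, iota_Fp hv, mul_assoc]
  · simp [iota_ne h, B_ne h]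

theorem B_right_mem_Nie [Finite α] {l : α × Bool} (h : l.1 ≠ i) : B i 1 (lt l) ∈ Nie α := by
  obtain ⟨j, b⟩ := l
  have h1 : B i 1 (of j) ∈ Nie α := Subgroup.subset_closure (Or.inr ⟨i, j, h, rfl⟩)
  cases b
  · have := inv_mem h1
    rw [B_inv (one_mem _) (of_mem_Fp h), inv_one] at this
    exact this
  · exact h1

theorem B_left_mem_Nie [Finite α] {l : α × Bool} (h : l.1 ≠ i) : B i (lt l) 1 ∈ Nie α := by
  have h1 := B_right_mem_Nie (l := (l.1, !l.2)) h
  have h2 := W_le_Nie (iota_mem_W i)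
  have h3 := mul_mem (mul_mem h2 h1) (inv_mem h2)
  rw [iota_B (one_mem _) (lt_mem_Fp (l := (l.1, !l.2)) h), lt_not] at h3
  simpa using h3

end Auts
end IAab


namespace IAab
open FreeGroup hiding map_inv map_mul map_one
set_option linter.unusedSectionVars false

section Nielsen
variable {α : Type*} [DecidableEq α] [Fintype α]

/-- numerical code of a word -/
noncomputable def code (L : List (α × Bool)) : ℕ :=
  Nat.ofDigits (Fintype.card (α × Bool) + 2)
    ((L.map (fun a => (Fintype.equivFin (α × Bool) a : ℕ))).reverse)

theorem code_append (p r : List (α × Bool)) :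
    code (p ++ r) = code r + (Fintype.card (α × Bool) + 2) ^ r.length * code p := by
  simp [code, Nat.ofDigits_append]

theorem code_inj {p q : List (α × Bool)} (hl : p.length = q.length) (h : code p = code q) :
    p = q := by
  have h1 := Nat.ofDigits_inj_of_len_eq (by omega) (by simpa using hl) ?_ ?_ h
  · have h2 := List.reverse_injective h1
    refine List.map_injective_iff.2 ?_ h2
    intro a b hab
    exact (Fintype.equivFin (α × Bool)).injective (Fin.ext hab)
  all_goals
    intro l hl
    simp only [List.mem_reverse, List.mem_map] at hl
    obtain ⟨a, _, rfl⟩ := hl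
    have := (Fintype.equivFin (α × Bool) a).2
    omega

/-- code of the first half -/
noncomputable def hc (u : FreeGroup α) : ℕ := code (u.toWord.take (u.norm / 2))
/-- symmetrized code -/
noncomputable def nu (u : FreeGroup α) : ℕ := hc u + hc u⁻¹

theorem nu_inv (u : FreeGroup α) : nu u⁻¹ = nu u := by simp [nu, add_comm]

/-- measure of a tuple -/
noncomputable def meas (t : MulAut (FreeGroup α)) : ℕ ×ₗ ℕ :=
  toLex (∑ i, (t (of i)).norm, ∑ i, nu (t (of i)))

theorem meas_lt {t t' : MulAut (FreeGroup α)} {i : α} (h : ∀ j, j ≠ i → t' (of j) = t (of j))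
    (h2 : (t' (of i)).norm < (t (of i)).norm ∨
      ((t' (of i)).norm = (t (of i)).norm ∧ nu (t' (of i)) < nu (t (of i)))) : meas t' < meas t := by
  rw [meas, meas, Prod.Lex.toLex_lt_toLex]
  have hh : ∀ j, (t' (of j)).norm ≤ (t (of j)).norm := by
    intro j
    by_cases hj : j = i
    · subst hj; rcases h2 with h2 | h2
      · exact h2.le
      · exact h2.1.le
    · rw [h j hj]
  rcases h2 with h2 | h2
  · left
    exact Finset.sum_lt_sum (fun j _ => hh j) ⟨i, Finset.mem_univ _, h2⟩
  · right
    refine ⟨Finset.sum_congr rfl ?_, Finset.sum_lt_sum ?_ ⟨i, Finset.mem_univ _, h2.2⟩⟩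
    · intro j _
      by_cases hj : j = i
      · subst hj; exact h2.1
      · rw [h j hj]
    · intro j _
      by_cases hj : j = i
      · subst hj; exact h2.2.le
      · rw [h j hj]

theorem lt_not' (y : α × Bool) : lt (y.1, !y.2) = (lt y)⁻¹ := lt_not _ _

/-- no elementary move decreases the measure -/
def Minimal' (t : MulAut (FreeGroup α)) : Prop :=
  ∀ f ∈ Nie α, ¬ meas (t * f) < meas t

theorem min_pair {t : MulAut (FreeGroup α)} (ht : Minimal' t) {y z : α × Bool} (h : y.1 ≠ z.1) :
    ¬ (t (lt y) * t (lt z)).norm < (t (lt z)).norm ∧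
    ¬ ((t (lt y) * t (lt z)).norm = (t (lt z)).norm ∧ nu (t (lt y) * t (lt z)) < nu (t (lt z))) := by
  rw [← not_or]
  intro hcon
  obtain ⟨i, b⟩ := z
  cases b
  · refine ht _ (B_right_mem_Nie (l := (y.1, !y.2)) (i := i) h) (meas_lt (i := i) ?_ ?_)
    · intro j hj
      simp [B_ne hj]
    · have e : (t * B i 1 (lt (y.1, !y.2))) (of i) = (t (lt y) * t (lt (i, false)))⁻¹ := by
        rw [MulAut.mul_apply, B_self (one_mem _) (lt_mem_Fp (l := (y.1, !y.2)) h), lt_not]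
        simp [lt_false]
      rw [e, norm_inv_eq, nu_inv, lt_false, map_inv]
      rw [lt_false, map_inv, norm_inv_eq, nu_inv] at hcon
      exact hcon
  · refine ht _ (B_left_mem_Nie (l := y) (i := i) h) (meas_lt (i := i) ?_ ?_)
    · intro j hj
      simp [B_ne hj]
    · have e : (t * B i (lt y) 1) (of i) = (t (lt y) * t (lt (i, true))) := by
        rw [MulAut.mul_apply, B_self (lt_mem_Fp h) (one_mem _)]
        simp [lt_true]
      rw [e]
      exact hcon

theorem min_N1 {t : MulAut (FreeGroup α)} (ht : Minimal' t) {y z : α × Bool} (h : y.1 ≠ z.1) :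
    2 * gp (t (lt y))⁻¹ (t (lt z)) ≤ (t (lt y)).norm ∧
    2 * gp (t (lt y))⁻¹ (t (lt z)) ≤ (t (lt z)).norm := by
  have h1 := (min_pair ht h).1
  have h2 := (min_pair ht (y := (z.1, !z.2)) (z := (y.1, !y.2)) h.symm).1
  have e := norm_mul_gp (t (lt y)) (t (lt z))
  rw [lt_not', lt_not', ← map_mul, ← mul_inv_rev, map_inv, norm_inv_eq, map_inv, norm_inv_eq, map_mul] at h2
  constructor <;> omega

theorem toWord_of_norm {L : List (α × Bool)} (h : (mk L).norm = L.length) : (mk L).toWord = L := by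
  rw [toWord_mk]
  have h1 : (reduce L).length = L.length := h
  exact (reduce.red (L := L)).sublist.eq_of_length h1

theorem min_N2 {t : MulAut (FreeGroup α)} (ht : Minimal' t) {y z : α × Bool} (h : y.1 ≠ z.1)
    {k : ℕ} (hk : (t (lt y)).norm = 2 * k) (hg : gp (t (lt y))⁻¹ (t (lt z)) = k) :
    code ((t (lt y))⁻¹.toWord.take k) ≤ code ((t (lt y)).toWord.take k) := by
  by_contra hcon
  push Not at hcon
  have hN1 := (min_N1 ht h).2
  have hno := (min_pair ht h).2
  have hn := norm_mul_gp (t (lt y)) (t (lt z))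
  set Y := t (lt y)
  set Z := t (lt z)
  have hYZ : (Y * Z).norm = Z.norm := by omega
  refine hno ⟨hYZ, ?_⟩
  have hq := take_eq_of_gp Y⁻¹ Z k hg.ge
  set p := Y.toWord.take k with hp
  set q := Y⁻¹.toWord.take k with hq'
  set r := Z.toWord.drop k with hr
  have hYl : Y.toWord.length = 2 * k := hk
  have hYil : Y⁻¹.toWord.length = 2 * k := by rw [← hk, ← norm_inv_eq]; rfl
  have hplen : p.length = k := by simp [hp, -toWord_inv]; omega
  have hqlen : q.length = k := by rw [hq', List.length_take]; omega
  have hZ : Z.toWord = q ++ r := by rw [hq, hr, List.take_append_drop]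
  have hY : Y.toWord = p ++ invRev q := by
    rw [← List.take_append_drop k Y.toWord, ← hp]
    congr 1
    have h1 : invRev Y.toWord = q ++ Y⁻¹.toWord.drop k := by
      rw [← toWord_inv, hq', List.take_append_drop]
    have h2 : Y.toWord = invRev (Y⁻¹.toWord.drop k) ++ invRev q := by
      rw [← invRev_append, ← h1, invRev_invRev]
    rw [h2, List.drop_append_of_le_length (by simp [-toWord_inv]; omega)]
    rw [List.drop_eq_nil_of_le (by simp [-toWord_inv]; omega), List.nil_append]
  have hYZm : Y * Z = mk (p ++ r) := by
    rw [← mk_toWord (x := Y), ← mk_toWord (x := Z), hY, hZ]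
    simp only [← mul_mk, ← inv_mk]
    group
  have hZn : Z.norm = k + r.length := by
    change Z.toWord.length = _
    rw [hZ]; simp [hqlen]
  have hYZw : (Y * Z).toWord = p ++ r := by
    rw [hYZm]
    apply toWord_of_norm
    rw [← hYZm, hYZ, hZn]
    simp [hplen]
  have hlt : hc (Y * Z) < hc Z := by
    rw [hc, hc, hYZ, hYZw, hZ, List.take_append, List.take_append, hplen, hqlen, code_append,
      code_append, List.take_of_length_le (l := p) (by omega),
      List.take_of_length_le (l := q) (by omega)]
    have : 0 < (Fintype.card (α × Bool) + 2) ^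
      (List.take (Z.norm / 2 - k) r).length := by positivity
    have := Nat.mul_lt_mul_of_pos_left hcon this
    omega
  have heq : hc (Y * Z)⁻¹ = hc Z⁻¹ := by
    rw [hc, hc, norm_inv_eq, norm_inv_eq, hYZ, toWord_inv, toWord_inv, hYZw, hZ, invRev_append,
      invRev_append, List.take_append_of_le_length (by simp; omega),
      List.take_append_of_le_length (by simp; omega)]
  rw [nu, nu, heq]
  omega

theorem t_lt_ne {t : MulAut (FreeGroup α)} (y : α × Bool) : t (lt y) ≠ 1 := by
  intro h
  have h1 : lt y = 1 := by
    apply t.injective; rw [h, map_one]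
  have := congrArg toWord h1
  simp [lt_toWord] at this

theorem N1 {t : MulAut (FreeGroup α)} (ht : Minimal' t) {y z : α × Bool} (h : y.1 = z.1 → y.2 = z.2) :
    2 * gp (t (lt y))⁻¹ (t (lt z)) ≤ (t (lt y)).norm ∧
    2 * gp (t (lt y))⁻¹ (t (lt z)) ≤ (t (lt z)).norm := by
  by_cases h1 : y.1 = z.1
  · have : y = z := Prod.ext h1 (h h1)
    subst this
    have := gp_inv_self_lt (t (lt y)) (t_lt_ne y)
    omega
  · exact min_N1 ht h1

theorem N2 {t : MulAut (FreeGroup α)} (ht : Minimal' t) {x y z : α × Bool}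
    (h : x.1 = y.1 → x.2 = y.2) (h' : y.1 = z.1 → y.2 = z.2) :
    gp (t (lt x))⁻¹ (t (lt y)) + gp (t (lt y))⁻¹ (t (lt z)) < (t (lt y)).norm := by
  have a1 := (N1 ht h).2
  have a2 := (N1 ht h').1
  by_contra hcon
  push Not at hcon
  have hxy : x.1 ≠ y.1 := by
    intro h1
    have : x = y := Prod.ext h1 (h h1)
    subst this
    have := gp_inv_self_lt (t (lt x)) (t_lt_ne x)
    omega
  have hyz : y.1 ≠ z.1 := by
    intro h1
    have : y = z := Prod.ext h1 (h' h1)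
    subst this
    have := gp_inv_self_lt (t (lt y)) (t_lt_ne y)
    omega
  obtain ⟨k, hk⟩ : ∃ k, (t (lt y)).norm = 2 * k := ⟨gp (t (lt x))⁻¹ (t (lt y)), by omega⟩
  have c1 := min_N2 ht hyz hk (by omega)
  have c2 := min_N2 ht (y := (y.1, !y.2)) (z := (x.1, !x.2)) hxy.symm (k := k)
    (by rw [lt_not', map_inv, norm_inv_eq, hk])
    (by rw [lt_not', lt_not', map_inv, map_inv, inv_inv, gp_comm]; omega)
  rw [lt_not', map_inv, inv_inv] at c2
  have hYl : (t (lt y)).toWord.length = 2 * k := hk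
  have hYil : (t (lt y))⁻¹.toWord.length = 2 * k := by rw [← hk, ← norm_inv_eq]; rfl
  have e := code_inj (by rw [List.length_take, List.length_take]; omega) (le_antisymm c1 c2)
  have hgg : k ≤ gp (t (lt y))⁻¹ (t (lt y)) := by
    obtain ⟨p, s, r, h1, h2, h3, h4⟩ := lcp_spec (t (lt y))⁻¹.toWord (t (lt y)).toWord
    by_contra hlt
    push Not at hlt
    have hpl : p.length < k := by rw [h3]; exact hlt
    have hs : s.length + p.length = 2 * k := by rw [← hYil, h1]; simp; omega
    have hr : r.length + p.length = 2 * k := by rw [← hYl, h2]; simp; omega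
    rw [h1, h2, List.take_append, List.take_append] at e
    have e' := List.append_cancel_left e
    cases s with
    | nil => simp at hs; omega
    | cons a s =>
      cases r with
      | nil => simp at hr; omega
      | cons b r =>
        obtain ⟨m, hm⟩ : ∃ m, k - p.length = m + 1 := ⟨k - p.length - 1, by omega⟩
        rw [hm] at e'
        simp at e'
        exact h4 a (by simp) b (by simp) e'.1
  have := gp_inv_self_lt (t (lt y)) (t_lt_ne y)
  omega

theorem mk_cons (l : α × Bool) (L : List (α × Bool)) : mk (l :: L) = lt l * mk L := by
  rw [lt, mul_mk]; rfl

theorem gp_self (u : FreeGroup α) : gp u u = u.norm := by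
  have := norm_gp u u
  simp at this; omega

theorem chain_gp {t : MulAut (FreeGroup α)} (ht : Minimal' t) (L : List (α × Bool)) :
    ∀ m, IsReduced (m :: L) → ∀ l : α × Bool, (l.1 = m.1 → l.2 = m.2) →
      gp (t (lt l))⁻¹ (t (mk (m :: L))) = gp (t (lt l))⁻¹ (t (lt m)) := by
  induction L with
  | nil => intro m _ l _; rfl
  | cons m' L ih =>
    intro m hred l hl
    rw [FreeGroup.isReduced_cons_cons] at hred
    have h1 := ih m' hred.2 m hred.1
    have h2 := N2 ht hl hred.1
    have h3 := gp_mul (t (lt m)) (t (mk (m' :: L)))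
    rw [← map_mul, ← mk_cons] at h3
    have u1 := gp_ultra (t (lt l))⁻¹ (t (lt m)) (t (mk (m :: m' :: L)))
    have u2 := gp_ultra (t (lt l))⁻¹ (t (mk (m :: m' :: L))) (t (lt m))
    rw [gp_comm (t (mk (m :: m' :: L))) (t (lt m))] at u2
    omega

theorem norm_chain {t : MulAut (FreeGroup α)} (ht : Minimal' t) (L : List (α × Bool)) :
    ∀ m, IsReduced (m :: L) → (t (lt m)).norm ≤ (t (mk (m :: L))).norm ∧
      (L ≠ [] → (t (mk L)).norm ≤ (t (mk (m :: L))).norm) := by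
  induction L with
  | nil => intro m _; exact ⟨le_rfl, by simp⟩
  | cons m' L ih =>
    intro m hred
    rw [FreeGroup.isReduced_cons_cons] at hred
    have h1 := chain_gp ht L m' hred.2 m hred.1
    have h2 := norm_mul_gp (t (lt m)) (t (mk (m' :: L)))
    rw [← map_mul, ← mk_cons] at h2
    have h3 := N1 ht hred.1
    have h4 := (ih m' hred.2).1
    refine ⟨by omega, fun _ => by omega⟩

theorem minimal_mem_W {t : MulAut (FreeGroup α)} (ht : Minimal' t) : t ∈ W α := by
  rw [← inv_mem_iff]
  intro j
  have hx : t (mk (t⁻¹ (of j)).toWord) = of j := by rw [mk_toWord]; simp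
  have hred : IsReduced (t⁻¹ (of j)).toWord := isReduced_toWord
  have hn : (t (mk (t⁻¹ (of j)).toWord)).norm = 1 := by rw [hx, norm_of]
  rcases hL : (t⁻¹ (of j)).toWord with _ | ⟨l, _ | ⟨m, L⟩⟩
  · rw [toWord_eq_nil_iff] at hL
    have := hx; rw [hL] at this; simp at this
    rw [← one_eq_mk, map_one] at this
    exact absurd this.symm (of_ne_one j)
  · refine ⟨l, ?_⟩
    rw [← mk_toWord (x := t⁻¹ (of j)), hL]; rfl
  · exfalso
    rw [hL] at hred hn
    have hred' := hred
    rw [FreeGroup.isReduced_cons_cons] at hred'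
    have h1 := norm_chain ht (m :: L) l hred
    have h2 := norm_chain ht L m hred'.2
    have h3 := chain_gp ht L m hred'.2 l hred'.1
    have h4 := norm_mul_gp (t (lt l)) (t (mk (m :: L)))
    rw [← map_mul, ← mk_cons] at h4
    have h5 := N1 ht hred'.1
    have h6 : (t (lt m)).norm ≠ 0 := fun h => t_lt_ne (t := t) m (norm_eq_zero.1 h)
    have h7 : (t (lt l)).norm ≠ 0 := fun h => t_lt_ne (t := t) l (norm_eq_zero.1 h)
    have := h1.2 (by simp)
    omega

theorem nielsen (t : MulAut (FreeGroup α)) : t ∈ Nie α := by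
  induction hm : meas t using WellFoundedLT.induction generalizing t with
  | ind m ih =>
    subst hm
    by_cases ht : Minimal' t
    · exact W_le_Nie (minimal_mem_W ht)
    · unfold Minimal' at ht
      push Not at ht
      obtain ⟨f, hf, hlt⟩ := ht
      have := ih _ hlt (t * f) rfl
      exact (Subgroup.mul_mem_cancel_right _ hf).1 this

end Nielsen
end IAab


namespace IAab
open FreeGroup hiding map_inv map_mul map_one
set_option linter.unusedSectionVars false
set_option linter.unusedSimpArgs false
open scoped commutatorElement

section Vec
variable {α : Type*} [DecidableEq α] [Fintype α]

/-- exponent vector, as a homomorphism -/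
def vecHom (α : Type*) [DecidableEq α] : FreeGroup α →* Multiplicative (α → ℤ) :=
  FreeGroup.lift (fun i => Multiplicative.ofAdd (Pi.single i 1))

/-- exponent vector -/
def vec (w : FreeGroup α) : α → ℤ := (vecHom α w).toAdd

@[simp] theorem vec_of (i : α) : vec (of i) = Pi.single i 1 := by simp [vec, vecHom]
@[simp] theorem vec_one : vec (1 : FreeGroup α) = 0 := by simp [vec]
@[simp] theorem vec_mul (u v : FreeGroup α) : vec (u * v) = vec u + vec v := by simp [vec]
@[simp] theorem vec_inv (u : FreeGroup α) : vec u⁻¹ = - vec u := by simp [vec]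
@[simp] theorem vec_zpow (u : FreeGroup α) (n : ℤ) : vec (u ^ n) = n • vec u := by simp [vec]

theorem mem_commutator_iff (w : FreeGroup α) : w ∈ commutator (FreeGroup α) ↔ vec w = 0 := by
  constructor
  · intro h
    have : commutator (FreeGroup α) ≤ (vecHom α).ker := Abelianization.commutator_subset_ker _
    have h2 := this h
    rw [MonoidHom.mem_ker] at h2
    simp [vec, h2]
  · intro h
    have key : ∀ w : FreeGroup α,
        Abelianization.of w = ∏ i, (Abelianization.of (of i)) ^ (vec w i) := by
      intro w
      induction w using FreeGroup.induction_on with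
      | C1 => simp
      | of j =>
        rw [Finset.prod_eq_single j]
        · simp
        · intro b _ hb; simp [hb]
        · simp
      | inv_of j hj => simp [hj]
      | mul x y hx hy => simp [hx, hy, Finset.prod_mul_distrib, zpow_add]
    have h1 := key w
    rw [h] at h1
    simp only [Pi.zero_apply, zpow_zero, Finset.prod_const_one] at h1
    rw [← Abelianization.ker_of, MonoidHom.mem_ker, h1]

/-- linear action of automorphisms on `ℤ^n` -/
def act (g : MulAut (FreeGroup α)) (v : α → ℤ) : α → ℤ := ∑ i, v i • vec (g (of i))

theorem act_vec (g : MulAut (FreeGroup α)) (w : FreeGroup α) : vec (g w) = act g (vec w) := by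
  induction w using FreeGroup.induction_on with
  | C1 => simp [act]
  | of j => simp [act, Pi.single_apply, ite_smul]
  | inv_of j hj => simp [hj, act]
  | mul x y hx hy => simp [hx, hy, act, add_smul, Finset.sum_add_distrib]

theorem vec_surj (v : α → ℤ) : ∃ w : FreeGroup α, vec w = v := by
  classical
  refine ⟨((Finset.univ : Finset α).toList.map (fun i => of i ^ (v i))).prod, ?_⟩
  have : ∀ L : List α, vec ((L.map (fun i => of i ^ (v i))).prod) =
      (L.map (fun i => v i • (Pi.single i 1 : α → ℤ))).sum := by
    intro L
    induction L with
    | nil => simp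
    | cons a L ih => simp [ih]
  rw [this, Finset.sum_map_toList]
  ext j
  simp [Finset.sum_apply, Pi.single_apply]

theorem act_mul (g h : MulAut (FreeGroup α)) (v : α → ℤ) : act (g * h) v = act g (act h v) := by
  obtain ⟨w, rfl⟩ := vec_surj v
  rw [← act_vec, ← act_vec, ← act_vec]; rfl

theorem act_one (v : α → ℤ) : act (1 : MulAut (FreeGroup α)) v = v := by
  obtain ⟨w, rfl⟩ := vec_surj v
  rw [← act_vec]; rfl

theorem act_add (g : MulAut (FreeGroup α)) (v w : α → ℤ) : act g (v + w) = act g v + act g w := by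
  simp [act, add_smul, Finset.sum_add_distrib]

theorem act_smul (g : MulAut (FreeGroup α)) (n : ℤ) (w : α → ℤ) : act g (n • w) = n • act g w := by
  simp [act, mul_smul, Finset.smul_sum]

/-- retraction killing `i` -/
theorem Fp_comm {i : α} {w : FreeGroup α} (hw : w ∈ Fp i) (h : vec w = 0) :
    w ∈ ⁅Fp i, Fp i⁆ := by
  let ρ : FreeGroup α →* FreeGroup α := FreeGroup.lift (fun l => if l = i then 1 else of l)
  have h1 : ρ w = w := hom_eq_of_Fp (fun j hj => by simp [ρ, hj]) hw
  have h2 : ∀ x, ρ x ∈ Fp i := by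
    intro x
    induction x using FreeGroup.induction_on with
    | C1 => simp
    | of j =>
      by_cases hj : j = i
      · simp [ρ, hj]
      · simp [ρ, hj, of_mem_Fp]
    | inv_of j hj => simpa using hj
    | mul x y hx hy => rw [map_mul]; exact mul_mem hx hy
  rw [← mem_commutator_iff, commutator_def] at h
  have h3 : ρ w ∈ Subgroup.map ρ ⁅⊤, ⊤⁆ := Subgroup.mem_map_of_mem _ h
  rw [Subgroup.map_commutator, h1] at h3
  refine Subgroup.commutator_mono ?_ ?_ h3 <;>
  · rintro _ ⟨x, _, rfl⟩; exact h2 x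

end Vec

section K
variable {α : Type*} [DecidableEq α] [Fintype α]

/-- subgroup generated by Magnus' generators -/
def K0 (α : Type*) [DecidableEq α] : Subgroup (MulAut (FreeGroup α)) :=
  Subgroup.closure ({f | ∃ i j, j ≠ i ∧ f = B i (of j) (of j)⁻¹} ∪
    {f | ∃ i j k, j ≠ i ∧ k ≠ i ∧ f = B i 1 ⁅of j, of k⁆})

variable {i j : α} {u v w : FreeGroup α}

theorem C_mem (hu : u ∈ Fp i) : B i u u⁻¹ ∈ K0 α := by
  have h : u ∈ Fp i ∧ B i u u⁻¹ ∈ K0 α := by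
    induction hu using Subgroup.closure_induction with
    | mem x hx =>
      obtain ⟨j, hj, rfl⟩ := hx
      exact ⟨of_mem_Fp hj, Subgroup.subset_closure (Or.inl ⟨i, j, hj, rfl⟩)⟩
    | one => simp [B_one]
    | mul x y _ _ hx hy =>
      refine ⟨mul_mem hx.1 hy.1, ?_⟩
      have := mul_mem hy.2 hx.2
      rw [B_mul hy.1 (inv_mem hy.1) hx.1 (inv_mem hx.1), ← mul_inv_rev] at this
      exact this
    | inv x _ hx =>
      refine ⟨inv_mem hx.1, ?_⟩
      have := inv_mem hx.2
      rwa [B_inv hx.1 (inv_mem hx.1)] at this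
  exact h.2

/-- right multiplications lying in `K0` -/
def TS (i : α) : Subgroup (FreeGroup α) where
  carrier := {w | w ∈ Fp i ∧ B i 1 w ∈ K0 α}
  one_mem' := by simp [B_one]
  mul_mem' := by
    rintro a b ⟨ha, ha'⟩ ⟨hb, hb'⟩
    refine ⟨mul_mem ha hb, ?_⟩
    have := mul_mem ha' hb'
    rw [B_mul (one_mem _) ha (one_mem _) hb] at this
    simpa using this
  inv_mem' := by
    rintro a ⟨ha, ha'⟩
    refine ⟨inv_mem ha, ?_⟩
    have := inv_mem ha'
    rw [B_inv (one_mem _) ha] at this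
    simpa using this

theorem TS_conj (hu : u ∈ Fp i) (hw : w ∈ TS i) : u * w * u⁻¹ ∈ TS i := by
  refine ⟨mul_mem (mul_mem hu hw.1) (inv_mem hu), ?_⟩
  have h1 := C_mem (inv_mem hu)
  have h2 := mul_mem (mul_mem h1 hw.2) (inv_mem h1)
  rw [B_inv (inv_mem hu) (inv_mem (inv_mem hu)), B_mul (inv_mem hu) (inv_mem (inv_mem hu)) (one_mem _) hw.1,
    B_mul (by simpa using hu) (mul_mem (inv_mem (inv_mem hu)) hw.1)
      (by simpa using hu) (by simpa using hu)] at h2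
  simpa using h2

theorem TS_comm (hu : u ∈ Fp i) (hv : v ∈ Fp i) : ⁅u, v⁆ ∈ TS i := by
  have aux : ∀ v, v ∈ Fp i → (∀ j, j ≠ i → ⁅of j, v⁆ ∈ TS i) → ∀ u ∈ Fp i, ⁅u, v⁆ ∈ TS i := by
    intro v hv hj u hu
    induction hu using Subgroup.closure_induction with
    | mem x hx => obtain ⟨j, hj', rfl⟩ := hx; exact hj j hj'
    | one => simp
    | mul x y hx hy ihx ihy =>
      have : ⁅x * y, v⁆ = x * ⁅y, v⁆ * x⁻¹ * ⁅x, v⁆ := by simp only [commutatorElement_def]; group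
      rw [this]
      exact mul_mem (TS_conj hx ihy) ihx
    | inv x hx ihx =>
      have : ⁅x⁻¹, v⁆ = x⁻¹ * ⁅x, v⁆⁻¹ * x⁻¹⁻¹ := by simp only [commutatorElement_def]; group
      rw [this]
      exact TS_conj (inv_mem hx) (inv_mem ihx)
  refine aux v hv ?_ u hu
  intro j hj
  rw [← commutatorElement_inv]
  refine inv_mem (aux (of j) (of_mem_Fp hj) ?_ v hv)
  intro k hk
  refine ⟨?_, Subgroup.subset_closure (Or.inr ⟨i, k, j, hk, hj, rfl⟩)⟩
  rw [commutatorElement_def]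
  have h1 := of_mem_Fp hk
  have h2 := of_mem_Fp hj
  exact mul_mem (mul_mem (mul_mem h1 h2) (inv_mem h1)) (inv_mem h2)

theorem BK (hu : u ∈ Fp i) (hv : v ∈ Fp i) (h : vec u + vec v = 0) : B i u v ∈ K0 α := by
  have h1 : v * u ∈ TS i := by
    have h2 : v * u ∈ ⁅Fp i, Fp i⁆ := Fp_comm (mul_mem hv hu) (by rw [vec_mul, add_comm, h])
    have h3 : ⁅Fp i, Fp i⁆ ≤ TS i := by
      rw [Subgroup.commutator_le]
      exact fun x hx y hy => TS_comm hx hy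
    exact h3 h2
  have h4 := mul_mem h1.2 (C_mem hu)
  rw [B_mul (one_mem _) h1.1 hu (inv_mem hu)] at h4
  simpa using h4

theorem K0_induct {P : MulAut (FreeGroup α) → Prop}
    (h1 : ∀ i j, j ≠ i → P (B i (of j) (of j)⁻¹))
    (h2 : ∀ i j k, j ≠ i → k ≠ i → P (B i 1 ⁅of j, of k⁆)) (hone : P 1)
    (hmul : ∀ f g, P f → P g → P (f * g)) (hinv : ∀ f, P f → P f⁻¹) {f} (hf : f ∈ K0 α) : P f := by
  induction hf using Subgroup.closure_induction with
  | mem x hx =>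
    rcases hx with ⟨i, j, h, rfl⟩ | ⟨i, j, k, h, h', rfl⟩
    · exact h1 i j h
    · exact h2 i j k h h'
  | one => exact hone
  | mul x y _ _ hx hy => exact hmul x y hx hy
  | inv x _ hx => exact hinv x hx

theorem conj_of_gens (g : MulAut (FreeGroup α))
    (h1 : ∀ i j, j ≠ i → g * (B i (of j) (of j)⁻¹) * g⁻¹ ∈ K0 α)
    (h2 : ∀ i j k, j ≠ i → k ≠ i → g * (B i 1 ⁅of j, of k⁆) * g⁻¹ ∈ K0 α) :
    ∀ f ∈ K0 α, g * f * g⁻¹ ∈ K0 α := by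
  intro f hf
  refine K0_induct (P := fun f => g * f * g⁻¹ ∈ K0 α) h1 h2 (by simp) ?_ ?_ hf
  · intro x y hx hy
    have := mul_mem hx hy
    simpa [mul_assoc] using this
  · intro x hx
    have := inv_mem hx
    simpa [mul_assoc] using this

theorem comm_mem_Fp {k : α} (hj : j ≠ i) (hk : k ≠ i) : ⁅(of j : FreeGroup α), of k⁆ ∈ Fp i := by
  rw [commutatorElement_def]
  have h1 := of_mem_Fp hj
  have h2 := of_mem_Fp hk
  exact mul_mem (mul_mem (mul_mem h1 h2) (inv_mem h1)) (inv_mem h2)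

@[simp] theorem vec_comm (u v : FreeGroup α) : vec ⁅u, v⁆ = 0 := by
  rw [commutatorElement_def]; simp

/-- conjugation by something fixing `x_i` and preserving `Fp i` -/
theorem conj_fix {g : MulAut (FreeGroup α)} (hg : g (of i) = of i) (hF : ∀ w ∈ Fp i, g w ∈ Fp i)
    (hu : u ∈ Fp i) (hv : v ∈ Fp i) : g * B i u v * g⁻¹ = B i (g u) (g v) := by
  rw [mul_inv_eq_iff_eq_mul]
  apply aut_ext
  intro j
  by_cases h : j = i
  · subst h
    simp [B_self hu hv, B_self (hF u hu) (hF v hv), hg]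
  · simp [B_ne h, B_mem (hF _ (of_mem_Fp h))]

theorem act_fix_zero {g : MulAut (FreeGroup α)} (h : vec u + vec v = 0) :
    vec (g u) + vec (g v) = 0 := by
  rw [act_vec, act_vec, ← act_add, h]; simp [act]

theorem map_Fp {g : MulAut (FreeGroup α)} {i' : α} (h : ∀ j, j ≠ i → g (of j) ∈ Fp i') :
    ∀ w ∈ Fp i, g w ∈ Fp i' := by
  intro w hw
  induction hw using Subgroup.closure_induction with
  | mem x hx => obtain ⟨j, hj, rfl⟩ := hx; exact h j hj
  | one => simp
  | mul x y _ _ hx hy => rw [map_mul]; exact mul_mem hx hy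
  | inv x _ hx => rw [map_inv]; exact inv_mem hx

theorem W_Fp {g : MulAut (FreeGroup α)} (hg : g ∈ W α) {b : Bool} {i' : α} (h : g (of i) = lt (i', b)) :
    ∀ w ∈ Fp i, g w ∈ Fp i' := by
  apply map_Fp
  intro j hj
  obtain ⟨l, hl⟩ := hg j
  rw [hl]
  apply lt_mem_Fp
  rintro rfl
  by_cases hb : l.2 = b
  · subst hb
    exact hj (of_injective (g.injective (hl.trans h.symm)))
  · have : g (of j) = g (of i)⁻¹ := by
      rw [map_inv, h, hl, ← lt_not]
      congr 1
      exact Prod.ext rfl (by revert hb; cases l.2 <;> cases b <;> simp)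
    have h4 := g.injective this
    rw [← lt_true, ← lt_false, lt_inj] at h4
    simp at h4

theorem conj_W_true {g : MulAut (FreeGroup α)} (hg : g ∈ W α) {i' : α} (h : g (of i) = of i')
    (hu : u ∈ Fp i) (hv : v ∈ Fp i) : g * B i u v * g⁻¹ = B i' (g u) (g v) := by
  have hF := W_Fp hg (b := true) h
  rw [mul_inv_eq_iff_eq_mul]
  apply aut_ext
  intro j
  by_cases hj : j = i
  · subst hj
    simp [B_self hu hv, B_self (hF u hu) (hF v hv), h]
  · simp [B_ne hj, B_mem (hF _ (of_mem_Fp hj))]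

theorem conj_W_false {g : MulAut (FreeGroup α)} (hg : g ∈ W α) {i' : α} (h : g (of i) = (of i')⁻¹)
    (hu : u ∈ Fp i) (hv : v ∈ Fp i) : g * B i u v * g⁻¹ = B i' (g v)⁻¹ (g u)⁻¹ := by
  have hF := W_Fp hg (b := false) h
  rw [mul_inv_eq_iff_eq_mul]
  apply aut_ext
  intro j
  by_cases hj : j = i
  · subst hj
    simp [B_self hu hv, B_self (inv_mem (hF v hv)) (inv_mem (hF u hu)), h, mul_assoc]
  · simp [B_ne hj, B_mem (hF _ (of_mem_Fp hj))]

theorem conj_W_mem {g : MulAut (FreeGroup α)} (hg : g ∈ W α)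
    (hu : u ∈ Fp i) (hv : v ∈ Fp i) (h : vec u + vec v = 0) : g * B i u v * g⁻¹ ∈ K0 α := by
  obtain ⟨⟨i', b⟩, hl⟩ := hg i
  have hF := W_Fp hg hl
  cases b
  · rw [conj_W_false hg hl hu hv]
    apply BK (inv_mem (hF v hv)) (inv_mem (hF u hu))
    have := act_fix_zero (g := g) h
    rw [vec_inv, vec_inv]
    rw [← neg_add, add_comm, this, neg_zero] 
  · rw [conj_W_true hg hl hu hv]
    exact BK (hF u hu) (hF v hv) (act_fix_zero h)

theorem conj_W {g : MulAut (FreeGroup α)} (hg : g ∈ W α) : ∀ f ∈ K0 α, g * f * g⁻¹ ∈ K0 α := by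
  apply conj_of_gens
  · intro i j hj
    exact conj_W_mem hg (of_mem_Fp hj) (inv_mem (of_mem_Fp hj)) (by simp)
  · intro i j k hj hk
    exact conj_W_mem hg (one_mem _) (comm_mem_Fp hj hk) (by simp)

/-- conjugation by a transvection on the same letter -/
theorem conj_same {a : α} {x : FreeGroup α} (hx : x ∈ Fp a) (hu : u ∈ Fp a) (hv : v ∈ Fp a)
    (h : vec u + vec v = 0) : B a 1 x * B a u v * (B a 1 x)⁻¹ ∈ K0 α := by
  rw [B_inv (one_mem _) hx, B_mul (one_mem _) hx hu hv,
    B_mul (by simpa using hu) (mul_mem hx hv) (by simp) (inv_mem hx)]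
  refine BK (by simpa using hu) (mul_mem (mul_mem hx hv) (inv_mem hx)) ?_
  rw [← h]; simp

/-- conjugation when `u`, `v` avoid `a` and `b` -/
theorem conj_b {a b : α} (hab : b ≠ a) (hu : u ∈ Fp b) (hv : v ∈ Fp b) (hu' : u ∈ Fp a)
    (hv' : v ∈ Fp a) :
    B a 1 (of b) * B b u v * (B a 1 (of b))⁻¹ = B a 1 (of b * v⁻¹ * (of b)⁻¹ * u⁻¹) * B b u v := by
  have hb : of b ∈ Fp a := of_mem_Fp hab
  have hx : of b * v⁻¹ * (of b)⁻¹ * u⁻¹ ∈ Fp a :=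
    mul_mem (mul_mem (mul_mem hb (inv_mem hv')) (inv_mem hb)) (inv_mem hu')
  rw [mul_inv_eq_iff_eq_mul]
  apply aut_ext
  intro j
  by_cases h : j = a
  · subst h
    simp only [MulAut.mul_apply, B_self (one_mem _) hb, B_self (one_mem _) hx, B_ne hab.symm, B_self hu hv,
      B_mem hu', B_mem hv', B_ne hab, map_mul, map_one]
    group
  · by_cases h' : j = b
    · subst h'
      simp [B_ne hab, B_self hu hv, B_mem hu', B_mem hv']
    · simp [B_ne h, B_ne h']

theorem conj_Cba {a b : α} (hab : b ≠ a) :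
    B a 1 (of b) * B b (of a) (of a)⁻¹ * (B a 1 (of b))⁻¹ =
      B b (of a) (of a)⁻¹ * B a (of b) (of b)⁻¹ := by
  have hb : of b ∈ Fp a := of_mem_Fp hab
  have ha : of a ∈ Fp b := of_mem_Fp hab.symm
  rw [mul_inv_eq_iff_eq_mul]
  apply aut_ext
  intro j
  by_cases h : j = a
  · subst h
    simp [B_self (one_mem _) hb, B_self hb (inv_mem hb), B_ne hab.symm, B_self ha (inv_mem ha),
      B_ne hab, mul_assoc]
  · by_cases h' : j = b
    · subst h'
      simp [B_ne hab, B_self (one_mem _) hb, B_self hb (inv_mem hb), B_ne hab.symm, B_self ha (inv_mem ha),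
       mul_assoc]
    · simp [B_ne h, B_ne h']

theorem braid_W {a b : α} (hab : b ≠ a) :
    (B b (of a) (of a)⁻¹)⁻¹ * (B a 1 (of b) * B b 1 (of a)⁻¹ * B a 1 (of b)) ∈ W α := by
  have hb : of b ∈ Fp a := of_mem_Fp hab
  have ha : of a ∈ Fp b := of_mem_Fp hab.symm
  have ha1 := inv_mem ha
  have ha2 := inv_mem ha1
  rw [B_inv ha (inv_mem ha)]
  intro j
  by_cases h : j = a
  · subst h
    refine ⟨(b, true), ?_⟩
    simp [lt_true, B_self (one_mem _) hb, B_self (one_mem _) ha1, B_ne hab.symm, B_self ha1 ha,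
      B_ne hab, mul_assoc]
  · by_cases h' : j = b
    · subst h'
      refine ⟨(a, false), ?_⟩
      simp [lt_false, B_self (one_mem _) hb, B_self (one_mem _) ha1, B_ne hab.symm, B_self ha1 ha,
        B_ne hab, mul_assoc]
    · exact ⟨(j, true), by simp [B_ne h, B_ne h', lt_true]⟩

/-- the hard case -/
theorem conj_Tb {a b k : α} (hab : b ≠ a) (hk : k ≠ a) (hkb : k ≠ b) :
    B a 1 (of b) * B b 1 ⁅of a, of k⁆ * (B a 1 (of b))⁻¹ ∈ K0 α := by
  have hb : of b ∈ Fp a := of_mem_Fp hab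
  have ha : of a ∈ Fp b := of_mem_Fp hab.symm
  have hka : of k ∈ Fp a := of_mem_Fp hk
  have hkb' : of k ∈ Fp b := of_mem_Fp hkb
  have hc : ⁅of a, of k⁆ ∈ Fp b := comm_mem_Fp hab.symm hkb
  set R := B a 1 (of b) with hR
  set R' := B b 1 (of a) with hR'
  set T := B b 1 ⁅of a, of k⁆ with hT
  set x := B a (of k) (of k)⁻¹ with hx
  set C := B b (of a) (of a)⁻¹ with hC
  have hxK : x ∈ K0 α := C_mem hka
  have hCK : C ∈ K0 α := C_mem ha
  have e1 : R' * x * R'⁻¹ = T * x := by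
    rw [hR', hx, conj_b hab.symm hka (inv_mem hka) hkb' (inv_mem hkb'), hT]
    simp [commutatorElement_def]
  have hR'inv : R'⁻¹ = B b 1 (of a)⁻¹ := by rw [hR', B_inv (one_mem _) ha, inv_one]
  have hw : C⁻¹ * (R * R'⁻¹ * R) ∈ W α := by rw [hR'inv]; exact braid_W hab
  have e2 : R * R'⁻¹ = C * (C⁻¹ * (R * R'⁻¹ * R)) * R⁻¹ := by group
  have e3 : R⁻¹ * x * R ∈ K0 α := by
    have := conj_same (inv_mem hb) hka (inv_mem hka) (by simp)
    have hRinv : R⁻¹ = B a 1 (of b)⁻¹ := by rw [hR, B_inv (one_mem _) hb, inv_one]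
    rw [← hRinv, inv_inv] at this
    exact this
  have e4 : (R * R'⁻¹) * x * (R * R'⁻¹)⁻¹ ∈ K0 α := by
    have h1 := conj_W hw _ e3
    have h2 := mul_mem (mul_mem hCK h1) (inv_mem hCK)
    convert h2 using 1
    group
  have e5 : R * x * R⁻¹ ∈ K0 α := conj_same hb hka (inv_mem hka) (by simp)
  have e6 : R * C * R⁻¹ ∈ K0 α := by
    rw [hR, hC, conj_Cba hab]
    exact mul_mem (C_mem ha) (C_mem hb)
  have e7 : C * T * C⁻¹ = R'⁻¹ * T * R' := by
    rw [hR'inv, hC, hT, hR', B_inv ha (inv_mem ha), B_mul ha (inv_mem ha) (one_mem _) hc,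
      B_mul (by simpa using ha) (mul_mem (inv_mem ha) hc) (inv_mem ha) (by simpa using ha),
      B_mul (one_mem _) (inv_mem ha) (one_mem _) hc,
      B_mul (by simp) (mul_mem (inv_mem ha) hc) (one_mem _) ha]
    simp
  have e8 : R * (R'⁻¹ * T * R') * R⁻¹ = (R * x * R⁻¹) * ((R * R'⁻¹) * x * (R * R'⁻¹)⁻¹)⁻¹ := by
    have : T = R' * x * R'⁻¹ * x⁻¹ := by rw [e1]; group
    rw [this]; group
  have e9 : R * T * R⁻¹ = (R * C * R⁻¹)⁻¹ * (R * (C * T * C⁻¹) * R⁻¹) * (R * C * R⁻¹) := by group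
  rw [e9, e7, e8]
  exact mul_mem (mul_mem (inv_mem e6) (mul_mem e5 (inv_mem e4))) e6

theorem conj_R {a b : α} (hab : b ≠ a) : ∀ f ∈ K0 α,
    B a 1 (of b) * f * (B a 1 (of b))⁻¹ ∈ K0 α := by
  have hb : of b ∈ Fp a := of_mem_Fp hab
  have ha : of a ∈ Fp b := of_mem_Fp hab.symm
  have hfix : ∀ i, i ≠ a → i ≠ b → ∀ u v, u ∈ Fp i → v ∈ Fp i → vec u + vec v = 0 →
      B a 1 (of b) * B i u v * (B a 1 (of b))⁻¹ ∈ K0 α := by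
    intro i hia hib u v hu hv h
    have hF : ∀ w ∈ Fp i, B a 1 (of b) w ∈ Fp i := by
      apply map_Fp
      intro j hj
      by_cases h : j = a
      · subst h
        rw [B_self (one_mem _) hb]
        exact mul_mem (mul_mem (one_mem _) (of_mem_Fp hj)) (of_mem_Fp hib.symm)
      · rw [B_ne h]; exact of_mem_Fp hj
    rw [conj_fix (B_ne hia) hF hu hv]
    exact BK (hF u hu) (hF v hv) (act_fix_zero h)
  apply conj_of_gens
  · intro i j hj
    by_cases hia : i = a
    · subst hia
      exact conj_same hb (of_mem_Fp hj) (inv_mem (of_mem_Fp hj)) (by simp)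
    · by_cases hib : i = b
      · subst hib
        by_cases hja : j = a
        · subst hja
          rw [conj_Cba hab]
          exact mul_mem (C_mem ha) (C_mem hb)
        · have h1 := of_mem_Fp hj
          have h2 := of_mem_Fp hja
          rw [conj_b hab h1 (inv_mem h1) h2 (inv_mem h2)]
          refine mul_mem (BK (one_mem _) ?_ ?_) (C_mem h1)
          · exact mul_mem (mul_mem (mul_mem hb (inv_mem (inv_mem h2))) (inv_mem hb)) (inv_mem h2)
          · simp
      · exact hfix i hia hib _ _ (of_mem_Fp hj) (inv_mem (of_mem_Fp hj)) (by simp)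
  · intro i j k hj hk
    by_cases hia : i = a
    · subst hia
      exact conj_same hb (one_mem _) (comm_mem_Fp hj hk) (by simp)
    · by_cases hib : i = b
      · subst hib
        by_cases hja : j = a
        · subst hja
          by_cases hkj : k = j
          · subst hkj
            simp [B_one]
          · exact conj_Tb hab hkj hk
        · by_cases hka : k = a
          · subst hka
            have h1 := inv_mem (conj_Tb hab hja hj)
            have h2 : B i 1 ⁅of j, of k⁆ = (B i 1 ⁅of k, of j⁆)⁻¹ := by
              rw [B_inv (one_mem _) (comm_mem_Fp hk hj), commutatorElement_inv, inv_one]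
            rw [h2]
            convert h1 using 1
            group
          · have h1 := comm_mem_Fp hj hk
            have h2 := comm_mem_Fp hja hka
            rw [conj_b hab (one_mem _) h1 (one_mem _) h2]
            refine mul_mem (BK (one_mem _) ?_ (by simp)) (BK (one_mem _) h1 (by simp))
            exact mul_mem (mul_mem (mul_mem hb (inv_mem h2)) (inv_mem hb)) (by simp)
      · exact hfix i hia hib _ _ (one_mem _) (comm_mem_Fp hj hk) (by simp)

instance K0_normal : (K0 α).Normal := by
  have key : ∀ g : MulAut (FreeGroup α), (∀ f ∈ K0 α, g * f * g⁻¹ ∈ K0 α) ∧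
      (∀ f ∈ K0 α, g⁻¹ * f * g ∈ K0 α) := by
    intro g
    have hg := nielsen g
    induction hg using Subgroup.closure_induction with
    | mem x hx =>
      rcases hx with hx | ⟨a, b, hab, rfl⟩
      · exact ⟨conj_W hx, by simpa using conj_W (inv_mem hx)⟩
      · refine ⟨conj_R hab, fun f hf => ?_⟩
        have h1 := iota_mem_W b
        have h2 : (B a 1 (of b))⁻¹ = iota b * B a 1 (of b) * (iota b)⁻¹ := by
          rw [conj_W_true h1 (iota_ne hab.symm) (one_mem _) (of_mem_Fp hab), iota_self, map_one,
            B_inv (one_mem _) (of_mem_Fp hab), inv_one]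
        have h3 : B a 1 (of b) = iota b * (B a 1 (of b))⁻¹ * (iota b)⁻¹ := by
          have := congrArg (·⁻¹) h2
          simpa [mul_assoc] using this
        have h4 := conj_W (inv_mem h1) f hf
        have h5 := conj_R hab _ h4
        have h6 := conj_W h1 _ h5
        rw [h2, show iota b * B a 1 (of b) * (iota b)⁻¹ * f * B a 1 (of b) =
          iota b * B a 1 (of b) * (iota b)⁻¹ * f * (iota b * (B a 1 (of b))⁻¹ * (iota b)⁻¹) from by
            rw [← h3]]
        convert h6 using 1
        group
    | one => simp
    | mul x y _ _ hx hy =>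
      refine ⟨fun f hf => ?_, fun f hf => ?_⟩
      · have := hx.1 _ (hy.1 f hf)
        simpa [mul_assoc] using this
      · have := hy.2 _ (hx.2 f hf)
        simpa [mul_assoc] using this
    | inv x _ hx => exact ⟨by simpa using hx.2, by simpa using hx.1⟩
  exact ⟨fun f hf g => (key g).1 f hf⟩

end K
end IAab


namespace IAab
set_option linter.unusedSectionVars false
set_option linter.unusedSimpArgs false

/-- abstract data for peak reduction -/
structure Peak (β X G : Type*) [Fintype β] [DecidableEq β] [Group G] [MulAction G X] where
  E : β → β → ℤ → G
  W : Subgroup G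
  p : X → β → ℤ
  hp : ∀ i j ε x, i ≠ j → p (E i j ε • x) = Function.update (p x) j (p x j + ε * p x i)
  hcomm : ∀ i j k l ε δ, i ≠ j → k ≠ l → j ≠ k → i ≠ l →
    E i j ε * E k l δ = E k l δ * E i j ε
  hst : ∀ i j l ε δ, i ≠ j → j ≠ l → i ≠ l →
    E j l δ * E i j ε = E i j ε * E j l δ * E i l (ε * δ)
  hinv : ∀ i j ε, i ≠ j → E i j (-ε) = (E i j ε)⁻¹
  hbr : ∀ i j ε, i ≠ j → (ε = 1 ∨ ε = -1) → E i j ε * E j i (-ε) * E i j ε ∈ W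
  hW : ∀ w ∈ W, ∀ i j ε, i ≠ j → (ε = 1 ∨ ε = -1) →
    ∃ i' j' ε', i' ≠ j' ∧ (ε' = 1 ∨ ε' = -1) ∧ w * E i j ε = E i' j' ε' * w
  hWn : ∀ w ∈ W, ∀ x, ∑ b, (p (w • x) b).natAbs = ∑ b, (p x b).natAbs

namespace Peak
variable {β X G : Type*} [Fintype β] [DecidableEq β] [Group G] [MulAction G X] (P : Peak β X G)

/-- L1 norm -/
def nrm (x : X) : ℕ := ∑ b, (P.p x b).natAbs

/-- transvection step -/
def TStep (x y : X) : Prop := ∃ i j ε, i ≠ j ∧ (ε = 1 ∨ ε = -1) ∧ y = P.E i j ε • x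

/-- a step -/
def Step (x y : X) : Prop := P.TStep x y ∨ ∃ w ∈ P.W, y = w • x

/-- connected below level `M` -/
def Conn (M : ℕ) : X → X → Prop :=
  Relation.ReflTransGen (fun x y => P.nrm x ≤ M ∧ P.nrm y ≤ M ∧ P.Step x y)

variable {P} {M : ℕ} {x y z : X} {i j k l : β} {ε δ : ℤ}

theorem TStep.symm (h : P.TStep x y) : P.TStep y x := by
  obtain ⟨i, j, ε, h, hε, rfl⟩ := h
  refine ⟨i, j, -ε, h, by omega, ?_⟩
  rw [P.hinv i j ε h, inv_smul_smul]

theorem Step.symm (h : P.Step x y) : P.Step y x := by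
  rcases h with h | ⟨w, hw, rfl⟩
  · exact Or.inl h.symm
  · exact Or.inr ⟨w⁻¹, inv_mem hw, by simp⟩

theorem Conn.symm (h : P.Conn M x y) : P.Conn M y x := by
  unfold Conn at *
  rw [← Relation.reflTransGen_swap]
  refine Relation.ReflTransGen.mono ?_ _ _ h
  intro a b hab
  exact ⟨hab.2.1, hab.1, hab.2.2.symm⟩

theorem Conn.trans (h : P.Conn M x y) (h' : P.Conn M y z) : P.Conn M x z :=
  Relation.ReflTransGen.trans h h'

theorem Conn.refl (x : X) : P.Conn M x x := Relation.ReflTransGen.refl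

theorem conn_E (h : i ≠ j) (hε : ε = 1 ∨ ε = -1) (hx : P.nrm x ≤ M) (hy : P.nrm (P.E i j ε • x) ≤ M) :
    P.Conn M x (P.E i j ε • x) :=
  Relation.ReflTransGen.single ⟨hx, hy, Or.inl ⟨i, j, ε, h, hε, rfl⟩⟩

theorem nrm_W {w : G} (hw : w ∈ P.W) : P.nrm (w • x) = P.nrm x := P.hWn w hw x

theorem conn_W {w : G} (hw : w ∈ P.W) (hx : P.nrm x ≤ M) : P.Conn M x (w • x) :=
  Relation.ReflTransGen.single ⟨hx, by rwa [nrm_W hw], Or.inr ⟨w, hw, rfl⟩⟩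

theorem nrm_E (h : i ≠ j) : P.nrm (P.E i j ε • x) + (P.p x j).natAbs =
    P.nrm x + (P.p x j + ε * P.p x i).natAbs := by
  unfold nrm
  rw [P.hp _ _ _ _ h, ← Finset.add_sum_erase _ _ (Finset.mem_univ j),
    ← Finset.add_sum_erase _ (fun b => (P.p x b).natAbs) (Finset.mem_univ j)]
  have : ∑ b ∈ Finset.univ.erase j,
      (Function.update (P.p x) j (P.p x j + ε * P.p x i) b).natAbs =
      ∑ b ∈ Finset.univ.erase j, (P.p x b).natAbs := by
    apply Finset.sum_congr rfl
    intro b hb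
    rw [Function.update_of_ne (Finset.ne_of_mem_erase hb)]
  rw [this]; simp; omega

theorem p_E_self (h : i ≠ j) : P.p (P.E i j ε • x) j = P.p x j + ε * P.p x i := by
  rw [P.hp _ _ _ _ h]; simp

theorem p_E_ne (h : i ≠ j) (hk : k ≠ j) : P.p (P.E i j ε • x) k = P.p x k := by
  rw [P.hp _ _ _ _ h]; simp [hk]

/-- both `E i j` and `E j i` reduce -/
theorem swap_eq (h : i ≠ j) (hε : ε = 1 ∨ ε = -1) :
    ∃ w ∈ P.W, P.E i j ε • x = P.E j i ε • w • P.E j i ε • x := by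
  refine ⟨_, P.hbr j i (-ε) h.symm (by omega), ?_⟩
  simp only [smul_smul]
  congr 1
  rw [P.hinv j i ε h.symm, neg_neg]
  group

theorem conn_swap (h : i ≠ j) (hε : ε = 1 ∨ ε = -1) (h1 : P.nrm (P.E i j ε • x) ≤ M)
    (h2 : P.nrm (P.E j i ε • x) ≤ M) : P.Conn M (P.E i j ε • x) (P.E j i ε • x) := by
  obtain ⟨w, hw, e⟩ := swap_eq (P := P) (x := x) h hε
  refine Conn.symm (Conn.trans (conn_W hw h2) ?_)
  rw [e] at h1 ⊢
  exact conn_E h.symm hε (by rwa [nrm_W hw]) h1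

/-- proper reductions -/
def Prp (P : Peak β X G) (x : X) (i j : β) (ε : ℤ) : Prop :=
  i ≠ j ∧ (ε = 1 ∨ ε = -1) ∧ P.p x i ≠ 0 ∧
    (P.p x j + ε * P.p x i).natAbs + (P.p x i).natAbs = (P.p x j).natAbs

theorem Prp.nrm (h : P.Prp x i j ε) : P.nrm (P.E i j ε • x) + (P.p x i).natAbs = P.nrm x := by
  have := nrm_E (P := P) (x := x) (ε := ε) h.1
  have := h.2.2.2
  omega

theorem exists_prp (h : i ≠ j) (hε : ε = 1 ∨ ε = -1) (hx : P.nrm x = M + 1)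
    (h1 : P.nrm (P.E i j ε • x) ≤ M) :
    ∃ i' j' ε', P.Prp x i' j' ε' ∧ P.Conn M (P.E i j ε • x) (P.E i' j' ε' • x) := by
  have hn := nrm_E (P := P) (x := x) (ε := ε) h
  have hn' := nrm_E (P := P) (x := x) (ε := ε) h.symm
  by_cases hp : (P.p x i).natAbs ≤ (P.p x j).natAbs
  · refine ⟨i, j, ε, ⟨h, hε, ?_, ?_⟩, Conn.refl _⟩ <;> rcases hε with rfl | rfl <;> omega
  · refine ⟨j, i, ε, ⟨h.symm, hε, ?_, ?_⟩, conn_swap h hε h1 ?_⟩ <;>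
      rcases hε with rfl | rfl <;> omega

theorem ar1 {a b c ε δ : ℤ} (hε : ε = 1 ∨ ε = -1) (hδ : δ = 1 ∨ δ = -1)
    (h1 : (b + ε * a).natAbs + a.natAbs = b.natAbs) (h2 : (c + δ * b).natAbs + b.natAbs = c.natAbs) :
    (c + δ * (b + ε * a)).natAbs + b.natAbs = c.natAbs + a.natAbs := by
  rcases hε with rfl | rfl <;> rcases hδ with rfl | rfl <;> omega

theorem ar2 {a b c ε δ : ℤ} (hε : ε = 1 ∨ ε = -1) (hδ : δ = 1 ∨ δ = -1) (ha : a ≠ 0) (hb : b ≠ 0)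
    (h1 : (c + ε * a).natAbs + a.natAbs = c.natAbs) (h2 : (c + δ * b).natAbs + b.natAbs = c.natAbs)
    (h3 : c.natAbs ≤ (c + ε * a + δ * b).natAbs) : b + -(ε * δ) * a = 0 := by
  rcases hε with rfl | rfl <;> rcases hδ with rfl | rfl <;> simp <;> omega

theorem prp_case1b (he : P.Prp x i j ε) (hf : P.Prp x j l δ) (hil : i ≠ l) (hx : P.nrm x = M + 1) :
    P.Conn M (P.E i j ε • x) (P.E j l δ • x) := by
  have n1 := he.nrm
  have n2 := hf.nrm
  obtain ⟨hij, hε, hi, e1⟩ := he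
  obtain ⟨hjl, hδ, hj, e2⟩ := hf
  have rel : P.E j l δ • P.E i j ε • x = P.E i l (ε * δ) • P.E i j ε • P.E j l δ • x := by
    simp only [smul_smul]
    congr 1
    rw [P.hst i j l ε δ hij hjl hil, ← mul_assoc, P.hcomm i l i j _ _ hil hij hil.symm hij, mul_assoc, mul_assoc,
      P.hcomm i l j l _ _ hil hjl hjl.symm hil]
  have hεδ : ε * δ = 1 ∨ ε * δ = -1 := by
    rcases hε with rfl | rfl <;> rcases hδ with rfl | rfl <;> simp
  have a1 := nrm_E (P := P) (x := P.E i j ε • x) (ε := δ) hjl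
  rw [p_E_self hij, p_E_ne hij hjl.symm] at a1
  have a2 := nrm_E (P := P) (x := P.E j l δ • x) (ε := ε) hij
  rw [p_E_ne hjl hil, p_E_ne hjl hjl] at a2
  have ar := ar1 hε hδ e1 e2
  have i0 := Int.natAbs_pos.2 hi
  have j0 := Int.natAbs_pos.2 hj
  have b1 : P.nrm (P.E j l δ • P.E i j ε • x) ≤ M := by linarith
  have b2 : P.nrm (P.E i j ε • P.E j l δ • x) ≤ M := by linarith
  refine (conn_E hjl hδ (by linarith) b1).trans (Conn.symm ?_)
  refine (conn_E hij hε (by linarith) b2).trans ?_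
  rw [rel] at b1 ⊢
  exact conn_E hil hεδ b2 b1

theorem prp_conn (he : P.Prp x i j ε) (hf : P.Prp x k l δ) (hx : P.nrm x = M + 1) :
    P.Conn M (P.E i j ε • x) (P.E k l δ • x) := by
  have n1 := he.nrm
  have n2 := hf.nrm
  by_cases hjk : j = k
  · subst hjk
    by_cases hil : i = l
    · subst hil
      have : ε = δ := by
        obtain ⟨hij, hε, hi, e1⟩ := he
        obtain ⟨hjl, hδ, hj, e2⟩ := hf
        rcases hε with rfl | rfl <;> rcases hδ with rfl | rfl <;> omega
      subst this
      have := he.2.2.1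
      have := hf.2.2.1
      exact conn_swap he.1 he.2.1 (by omega) (by omega)
    · exact prp_case1b he hf hil hx
  by_cases hil : i = l
  · subst hil
    exact (prp_case1b hf he (Ne.symm hjk) hx).symm
  obtain ⟨hij, hε, hi, e1⟩ := he
  obtain ⟨hkl, hδ, hk, e2⟩ := hf
  have rel : P.E k l δ • P.E i j ε • x = P.E i j ε • P.E k l δ • x := by
    rw [smul_smul, smul_smul, P.hcomm i j k l _ _ hij hkl hjk hil]
  have i0 := Int.natAbs_pos.2 hi
  have k0 := Int.natAbs_pos.2 hk
  by_cases hjl : j = l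
  · subst hjl
    by_cases hik : i = k
    · subst hik
      have : ε = δ := by
        rcases hε with rfl | rfl <;> rcases hδ with rfl | rfl <;> omega
      subst this
      exact Conn.refl _
    · have a1 := nrm_E (P := P) (x := P.E i j ε • x) (ε := δ) hkl
      rw [p_E_self hij, p_E_ne hij hkl] at a1
      by_cases hb : P.nrm (P.E k j δ • P.E i j ε • x) ≤ M
      · refine (conn_E hkl hδ (by linarith) hb).trans (Conn.symm ?_)
        rw [rel] at hb ⊢
        exact conn_E hij hε (by linarith) hb
      · have hη : -(ε * δ) = 1 ∨ -(ε * δ) = -1 := by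
          rcases hε with rfl | rfl <;> rcases hδ with rfl | rfl <;> simp
        have rel2 : P.E i k (-(ε * δ)) • P.E k j δ • x =
            P.E k j δ • P.E i k (-(ε * δ)) • P.E i j ε • x := by
          simp only [smul_smul]
          congr 1
          rw [← mul_assoc, P.hst i k j _ _ hik hkl hij, mul_assoc (_ * _)]
          have : P.E i j (-(ε * δ) * δ) * P.E i j ε = 1 := by
            have : -(ε * δ) * δ = - ε := by
              rcases hε with rfl | rfl <;> rcases hδ with rfl | rfl <;> simp
            rw [this, P.hinv i j ε hij, inv_mul_cancel]
          rw [this, mul_one]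
        have c1 := nrm_E (P := P) (x := P.E i j ε • x) (ε := -(ε * δ)) hik
        rw [p_E_ne hij hij, p_E_ne hij hkl] at c1
        have c2 := nrm_E (P := P) (x := P.E k j δ • x) (ε := -(ε * δ)) hik
        rw [p_E_ne hkl hij, p_E_ne hkl hkl] at c2
        have ar := ar2 hε hδ hi hk e1 e2 (by linarith)
        rw [ar, Int.natAbs_zero] at c1 c2
        have b1 : P.nrm (P.E i k (-(ε * δ)) • P.E i j ε • x) ≤ M := by linarith
        have b2 : P.nrm (P.E i k (-(ε * δ)) • P.E k j δ • x) ≤ M := by linarith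
        refine (conn_E hik hη (by linarith) b1).trans (Conn.symm ?_)
        refine (conn_E hik hη (by linarith) b2).trans (Conn.symm ?_)
        rw [rel2] at b2 ⊢
        exact conn_E hkl hδ b1 b2
  · have a1 := nrm_E (P := P) (x := P.E i j ε • x) (ε := δ) hkl
    rw [p_E_ne hij (Ne.symm hjl), p_E_ne hij (Ne.symm hjk)] at a1
    have hb : P.nrm (P.E k l δ • P.E i j ε • x) ≤ M := by linarith
    refine (conn_E hkl hδ (by linarith) hb).trans (Conn.symm ?_)
    rw [rel] at hb ⊢
    exact conn_E hij hε (by linarith) hb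

theorem red_conn (hij : i ≠ j) (hε : ε = 1 ∨ ε = -1) (hkl : k ≠ l) (hδ : δ = 1 ∨ δ = -1)
    (hx : P.nrm x = M + 1) (h1 : P.nrm (P.E i j ε • x) ≤ M) (h2 : P.nrm (P.E k l δ • x) ≤ M) :
    P.Conn M (P.E i j ε • x) (P.E k l δ • x) := by
  obtain ⟨i', j', ε', a, b⟩ := exists_prp hij hε hx h1
  obtain ⟨k', l', δ', a', b'⟩ := exists_prp hkl hδ hx h2
  exact (b.trans (prp_conn a a' hx)).trans b'.symm

theorem neutral_conn (hij : i ≠ j) (hε : ε = 1 ∨ ε = -1) (hkl : k ≠ l) (hδ : δ = 1 ∨ δ = -1)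
    (hx : P.nrm x = M + 1) (h1 : P.nrm (P.E i j ε • x) ≤ M) (h2 : P.nrm (P.E k l δ • x) = M + 1) :
    ∃ y, P.TStep (P.E k l δ • x) y ∧ P.nrm y ≤ M ∧ P.Conn M (P.E i j ε • x) y := by
  have n1 := nrm_E (P := P) (x := x) (ε := ε) hij
  have n2 := nrm_E (P := P) (x := x) (ε := δ) hkl
  by_cases hk : P.p x k = 0
  · have hki : k ≠ i := by
      rintro rfl
      rw [hk] at n1; simp at n1; omega
    have hkj : k ≠ j := by
      rintro rfl
      rw [hk] at n1; simp at n1; omega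
    have inv0 : ∀ {y : X} {a : β} {η : ℤ}, k ≠ a → P.p y k = 0 → P.nrm (P.E k a η • y) = P.nrm y := by
      intro y a η hka hy
      have := nrm_E (P := P) (x := y) (ε := η) hka
      rw [hy] at this; simpa using this
    have hke : P.p (P.E i j ε • x) k = 0 := by rw [p_E_ne hij hkj, hk]
    have e1 := inv0 (η := δ) hkl hke
    by_cases hil : i = l
    · subst hil
      have rel : P.E i j ε • P.E k i δ • x = P.E k j (δ * ε) • P.E k i δ • P.E i j ε • x := by
        simp only [smul_smul]
        congr 1
        rw [P.hst k i j δ ε hkl hij hkj, ← mul_assoc, P.hcomm k j k i _ _ hkj hkl hkj.symm hkl, mul_assoc,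
          mul_assoc, P.hcomm k j i j _ _ hkj hij hij.symm hkj]
      have hεδ : δ * ε = 1 ∨ δ * ε = -1 := by
        rcases hε with rfl | rfl <;> rcases hδ with rfl | rfl <;> simp
      have e2 := inv0 (a := j) (η := δ * ε) hkj (y := P.E k i δ • P.E i j ε • x)
        (by rw [p_E_ne hkl hki, hke])
      refine ⟨_, ⟨i, j, ε, hij, hε, rfl⟩, ?_, ?_⟩
      · rw [rel]; omega
      · rw [rel]
        exact (conn_E hkl hδ h1 (by omega)).trans (conn_E hkj hεδ (by omega) (by omega))
    · have rel : P.E k l δ • P.E i j ε • x = P.E i j ε • P.E k l δ • x := by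
        rw [smul_smul, smul_smul, P.hcomm i j k l _ _ hij hkl hkj.symm hil]
      refine ⟨_, ⟨i, j, ε, hij, hε, rfl⟩, ?_, ?_⟩
      · rw [← rel]; omega
      · rw [← rel]; exact conn_E hkl hδ h1 (by omega)
  · have n3 := nrm_E (P := P) (x := x) (ε := δ) hkl.symm
    have h3 : P.nrm (P.E l k δ • x) ≤ M := by
      rcases hδ with rfl | rfl <;> omega
    obtain ⟨w, hw, e⟩ := swap_eq (P := P) (x := x) hkl hδ
    refine ⟨w • P.E l k δ • x, TStep.symm ⟨l, k, δ, hkl.symm, hδ, e⟩, by rwa [nrm_W hw], ?_⟩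
    exact (red_conn hij hε hkl.symm hδ hx h1 h3).trans (conn_W hw h3)

theorem peak (x : X) (hx : P.nrm x ≤ M) (h : P.Conn (M + 1) x y) :
    (P.nrm y ≤ M → P.Conn M x y) ∧
    (P.nrm y = M + 1 → ∃ z, P.TStep y z ∧ P.nrm z ≤ M ∧ P.Conn M x z) := by
  induction h with
  | refl => exact ⟨fun _ => Conn.refl _, fun h => by omega⟩
  | @tail a b _ hab ih =>
    obtain ⟨ha, hb, hs⟩ := hab
    by_cases ha' : P.nrm a ≤ M
    · have ih1 := ih.1 ha'
      refine ⟨fun hb' => ih1.tail ⟨ha', hb', hs⟩, fun hb' => ?_⟩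
      rcases hs with hs | ⟨w, hw, rfl⟩
      · exact ⟨a, hs.symm, ha', ih1⟩
      · rw [nrm_W hw] at hb'; omega
    · have ha2 : P.nrm a = M + 1 := by omega
      obtain ⟨z, ⟨i, j, ε, hij, hε, rfl⟩, hz, hc⟩ := ih.2 ha2
      rcases hs with ⟨k, l, δ, hkl, hδ, rfl⟩ | ⟨w, hw, rfl⟩
      · refine ⟨fun hb' => hc.trans (red_conn hij hε hkl hδ ha2 hz hb'), fun hb' => ?_⟩
        obtain ⟨y, h1, h2, h3⟩ := neutral_conn hij hε hkl hδ ha2 hz hb'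
        exact ⟨y, h1, h2, hc.trans h3⟩
      · rw [nrm_W hw]
        refine ⟨fun h => by omega, fun _ => ?_⟩
        obtain ⟨i', j', ε', h1, h2, h3⟩ := P.hW w hw i j ε hij hε
        have h4 : P.E i' j' ε' • w • a = w • P.E i j ε • a := by
          rw [smul_smul, smul_smul, h3]
        refine ⟨_, ⟨i', j', ε', h1, h2, rfl⟩, ?_, ?_⟩
        · rw [h4, nrm_W hw]; exact hz
        · rw [h4]; exact hc.trans (conn_W hw hz)

theorem peak_all (hx : P.nrm x ≤ 1) (hy : P.nrm y ≤ 1) (h : P.Conn (M + 1) x y) : P.Conn 1 x y := by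
  induction M with
  | zero => exact h
  | succ M ih => exact ih ((peak x (by omega) h).1 (by omega))

theorem conn_mono {M'} (hM : M ≤ M') (h : P.Conn M x y) : P.Conn M' x y :=
  Relation.ReflTransGen.mono
    (fun _ _ hab => And.intro (hab.1.trans hM) (And.intro (hab.2.1.trans hM) hab.2.2)) _ _ h

theorem steps_conn (h : Relation.ReflTransGen P.Step x y) : ∃ M, P.Conn M x y := by
  induction h with
  | refl => exact ⟨0, Conn.refl _⟩
  | @tail a b _ hab ih =>
    obtain ⟨M, hM⟩ := ih
    refine ⟨max M (max (P.nrm a) (P.nrm b)),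
      Relation.ReflTransGen.tail (conn_mono (le_max_left _ _) hM) ⟨?_, ?_, hab⟩⟩ <;> simp

/-- main conclusion -/
theorem main {x0 : X} (hx0 : P.nrm x0 ≤ 1)
    (hbase : ∀ w ∈ P.W, ∀ i j ε, i ≠ j → (ε = 1 ∨ ε = -1) → P.p (w • x0) i = 0 →
      ∃ w' ∈ P.W, P.E i j ε • w • x0 = w' • x0)
    (h : Relation.ReflTransGen P.Step x0 y) (hy : P.nrm y ≤ 1) : ∃ w ∈ P.W, y = w • x0 := by
  obtain ⟨M, hM⟩ := steps_conn h
  have h1 := peak_all hx0 hy (conn_mono (Nat.le_succ M) hM)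
  clear hM h hy
  induction h1 with
  | refl => exact ⟨1, one_mem _, by simp⟩
  | @tail a b _ hab ih =>
    obtain ⟨w, hw, rfl⟩ := ih
    obtain ⟨ha, hb, hs⟩ := hab
    rcases hs with ⟨i, j, ε, hij, hε, rfl⟩ | ⟨w', hw', rfl⟩
    · by_cases h0 : P.p (w • x0) i = 0
      · obtain ⟨w', hw', e⟩ := hbase w hw i j ε hij hε h0
        exact ⟨w', hw', e⟩
      · exfalso
        have n1 := nrm_E (P := P) (x := w • x0) (ε := ε) hij
        have n2 : (P.p (w • x0) i).natAbs + (P.p (w • x0) j).natAbs ≤ P.nrm (w • x0) := by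
          unfold nrm
          rw [← Finset.sum_pair (f := fun b => (P.p (w • x0) b).natAbs) hij]
          exact Finset.sum_le_sum_of_subset (Finset.subset_univ _)
        have n3 : P.nrm (P.E i j ε • w • x0) ≥ (P.p (P.E i j ε • w • x0) i).natAbs + (P.p (P.E i j ε • w • x0) j).natAbs := by
          unfold nrm
          rw [← Finset.sum_pair (f := fun b => (P.p (P.E i j ε • w • x0) b).natAbs) hij]
          exact Finset.sum_le_sum_of_subset (Finset.subset_univ _)
        rw [p_E_self hij, p_E_ne hij hij] at n3
        rcases hε with rfl | rfl <;> omega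
    · exact ⟨w' * w, mul_mem hw' hw, by rw [mul_smul]⟩

end Peak
end IAab


namespace IAab
open FreeGroup hiding map_inv map_mul map_one
set_option linter.unusedSectionVars false
set_option linter.unusedSimpArgs false
open scoped commutatorElement

section Q
variable {α : Type*} [DecidableEq α] [Fintype α]

/-- the quotient by Magnus' subgroup -/
abbrev Q (α : Type*) [DecidableEq α] [Fintype α] : Type _ := MulAut (FreeGroup α) ⧸ K0 α

/-- projection -/
def mq (g : MulAut (FreeGroup α)) : Q α := QuotientGroup.mk g

theorem mq_mul (g h : MulAut (FreeGroup α)) : mq (g * h) = mq g * mq h := rfl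
theorem mq_inv (g : MulAut (FreeGroup α)) : mq g⁻¹ = (mq g)⁻¹ := rfl
theorem mq_one : mq (1 : MulAut (FreeGroup α)) = 1 := rfl
theorem mq_eq {g h : MulAut (FreeGroup α)} : mq g = mq h ↔ g⁻¹ * h ∈ K0 α := QuotientGroup.eq
theorem mq_eq_one {g : MulAut (FreeGroup α)} : mq g = 1 ↔ g ∈ K0 α := QuotientGroup.eq_one_iff g

variable {i j k l : α} {u v u' v' : FreeGroup α} {m m' : ℤ}

theorem mqB (hu : u ∈ Fp i) (hv : v ∈ Fp i) (hu' : u' ∈ Fp i) (hv' : v' ∈ Fp i)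
    (h : vec u + vec v = vec u' + vec v') : mq (B i u v) = mq (B i u' v') := by
  rw [mq_eq, B_inv hu hv, B_mul (inv_mem hu) (inv_mem hv) hu' hv']
  refine BK (mul_mem hu' (inv_mem hu)) (mul_mem (inv_mem hv) hv') ?_
  rw [vec_mul, vec_mul, vec_inv, vec_inv]
  have : vec u' + -vec u + (-vec v + vec v') = (vec u' + vec v') - (vec u + vec v) := by abel
  rw [this, h, sub_self]

/-- transvections in the quotient -/
noncomputable def EE (i j : α) (m : ℤ) : Q α := mq (B i 1 (of j ^ m))

theorem pw (h : i ≠ j) (m : ℤ) : (of j : FreeGroup α) ^ m ∈ Fp i := zpow_mem (of_mem_Fp h.symm) m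

theorem EE_add (h : i ≠ j) : EE i j m * EE i j m' = EE i j (m + m') := by
  rw [EE, EE, ← mq_mul, B_mul (one_mem _) (pw h m) (one_mem _) (pw h m'), EE, zpow_add, mul_one]

theorem EE_zero : EE i j 0 = 1 := by simp [EE, B_one, mq_one]

theorem EE_neg (h : i ≠ j) : EE i j (-m) = (EE i j m)⁻¹ := by
  rw [eq_inv_iff_mul_eq_one, EE_add h, neg_add_cancel, EE_zero]

theorem EE_comm (hij : i ≠ j) (hkl : k ≠ l) (hjk : j ≠ k) (hil : i ≠ l) :
    EE i j m * EE k l m' = EE k l m' * EE i j m := by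
  by_cases hik : i = k
  · subst hik
    rw [EE, EE, ← mq_mul, ← mq_mul, B_mul (one_mem _) (pw hij m) (one_mem _) (pw hil m'),
      B_mul (one_mem _) (pw hil m') (one_mem _) (pw hij m)]
    refine mqB (by simp) (mul_mem (pw hij m) (pw hil m')) (by simp)
      (mul_mem (pw hil m') (pw hij m)) ?_
    simp [add_comm]
  · rw [EE, EE, ← mq_mul, ← mq_mul]
    congr 1
    apply aut_ext
    intro a
    have h1 : (of j : FreeGroup α) ^ m ∈ Fp k := pw hjk.symm m
    have h2 : (of l : FreeGroup α) ^ m' ∈ Fp i := pw hil m'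
    by_cases hai : a = i
    · subst hai
      rw [MulAut.mul_apply, MulAut.mul_apply, B_ne hik, B_self (one_mem _) (pw hij m), map_mul,
        map_mul, map_one, B_ne hik, B_mem h1]
    · by_cases hak : a = k
      · subst hak
        rw [MulAut.mul_apply, MulAut.mul_apply, B_ne hai, B_self (one_mem _) (pw hkl m'), map_mul,
          map_mul, map_one, B_ne hai, B_mem h2]
      · rw [MulAut.mul_apply, MulAut.mul_apply, B_ne hai, B_ne hak, B_ne hai]

theorem EE_st (hij : i ≠ j) (hjl : j ≠ l) (hil : i ≠ l) :
    EE j l m' * EE i j m = EE i j m * EE j l m' * EE i l (m * m') := by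
  rw [mul_assoc, EE_comm hjl hil hil.symm hjl, ← mul_assoc, ← mul_inv_eq_iff_eq_mul]
  have hF : ∀ w ∈ Fp i, B j 1 (of l ^ m') w ∈ Fp i := by
    apply map_Fp
    intro a ha
    by_cases haj : a = j
    · subst haj
      rw [B_self (one_mem _) (pw hjl m')]
      exact mul_mem (mul_mem (one_mem _) (of_mem_Fp ha)) (pw hil m')
    · rw [B_ne haj]; exact of_mem_Fp ha
  simp only [EE, ← mq_mul, ← mq_inv]
  rw [conj_fix (B_ne hij) hF (one_mem _) (pw hij m),
    B_mul (one_mem _) (pw hij m) (one_mem _) (pw hil _)]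
  refine mqB (hF _ (one_mem _)) (hF _ (pw hij m)) (by simp) (mul_mem (pw hij m) (pw hil _)) ?_
  rw [map_zpow, B_self (one_mem _) (pw hjl m')]
  simp [smul_smul, mul_assoc]

/-- sign -/
def sg (b : Bool) : ℤ := if b then 1 else -1

theorem lt_eq (l : α) (b : Bool) : lt (l, b) = of l ^ sg b := by
  cases b <;> simp [lt_true, lt_false, sg]

theorem sg_or (b : Bool) : sg b = 1 ∨ sg b = -1 := by cases b <;> simp [sg]

theorem W_ne {g : MulAut (FreeGroup α)} (hg : g ∈ W α) {b c : Bool} {i' j' : α}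
    (h : g (of i) = lt (i', b)) (h' : g (of j) = lt (j', c)) (hij : i ≠ j) : i' ≠ j' := by
  rintro rfl
  have h1 := W_Fp hg h _ (of_mem_Fp hij.symm)
  rw [h'] at h1
  have h2 : ∀ w ∈ Fp i', vec w i' = 0 := by
    intro w hw
    induction hw using Subgroup.closure_induction with
    | mem x hx => obtain ⟨j, hj, rfl⟩ := hx; simp [Ne.symm hj]
    | one => simp
    | mul x y _ _ hx hy => simp [hx, hy]
    | inv x _ hx => simp [hx]
  have h3 := h2 _ h1
  rw [lt_eq] at h3
  rcases sg_or c with h | h <;> simp [h] at h3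

theorem EE_W {g : MulAut (FreeGroup α)} (hg : g ∈ W α) {b c : Bool} {i' j' : α}
    (h : g (of i) = lt (i', b)) (h' : g (of j) = lt (j', c)) (hij : i ≠ j) :
    mq g * EE i j m = EE i' j' (sg b * sg c * m) * mq g := by
  have hF := W_Fp hg h
  have hn := W_ne hg h h' hij
  rw [← mul_inv_eq_iff_eq_mul, EE, EE, ← mq_mul, ← mq_inv, ← mq_mul]
  cases b
  · rw [conj_W_false hg h (one_mem _) (pw hij m)]
    refine mqB (inv_mem (hF _ (pw hij m))) (inv_mem (hF _ (one_mem _))) (one_mem _) (pw hn _) ?_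
    rw [map_zpow, h', lt_eq]
    cases c <;> simp [smul_smul, sg, mul_comm]
  · rw [conj_W_true hg h (one_mem _) (pw hij m)]
    refine mqB (hF _ (one_mem _)) (hF _ (pw hij m)) (one_mem _) (pw hn _) ?_
    rw [map_zpow, h', lt_eq]
    cases c <;> simp [smul_smul, sg, mul_comm]

theorem act_single (g : MulAut (FreeGroup α)) (i : α) : act g (Pi.single i 1) = vec (g (of i)) := by
  rw [act_vec, vec_of]

theorem act_B (h : i ≠ j) (v : α → ℤ) :
    act (B i 1 (of j ^ m)) v = Function.update v j (v j + m * v i) := by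
  obtain ⟨w, rfl⟩ := vec_surj v
  rw [← act_vec]
  induction w using FreeGroup.induction_on with
  | C1 => simp
  | of a =>
    by_cases ha : a = i
    · subst ha
      rw [B_self (one_mem _) (pw h m)]
      ext b
      by_cases hb : b = j
      · subst hb; simp
      · simp [hb, Function.update_apply]
    · rw [B_ne ha]
      simp [ha, Ne.symm ha]
  | inv_of a ha =>
    rw [map_inv, vec_inv, ha]
    ext b
    by_cases hb : b = j
    · subst hb; simp; ring
    · simp [hb, Function.update_apply]
  | mul x y hx hy =>
    rw [map_mul, vec_mul, hx, hy]
    ext b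
    by_cases hb : b = j
    · subst hb; simp; ring
    · simp [hb, Function.update_apply]

theorem act_W {g : MulAut (FreeGroup α)} (hg : g ∈ W α) {b : Bool} {i' : α}
    (h : g (of i) = lt (i', b)) (v : α → ℤ) : act g v i' = sg b * v i := by
  rw [act, Finset.sum_apply, Finset.sum_eq_single i]
  · rw [h, lt_eq]; simp [mul_comm]
  · intro j _ hj
    obtain ⟨⟨j', c⟩, hl⟩ := hg j
    have := W_ne hg h hl hj.symm
    rw [hl, lt_eq]; simp [this.symm, this]
  · simp

theorem act_K0 {g : MulAut (FreeGroup α)} (hg : g ∈ K0 α) (v : α → ℤ) : act g v = v := by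
  have key : ∀ i (u w : FreeGroup α), u ∈ Fp i → w ∈ Fp i → vec u + vec w = 0 → ∀ v, act (B i u w) v = v := by
    intro i u w hu hw h v
    rw [act]
    have : ∀ j, vec (B i u w (of j)) = Pi.single j 1 := by
      intro j
      by_cases hj : j = i
      · subst hj
        rw [B_self hu hw]
        simp only [vec_mul, vec_of]
        rw [add_right_comm, h, zero_add]
      · rw [B_ne hj, vec_of]
    simp only [this]
    ext j
    simp [Finset.sum_apply, Pi.single_apply]
  refine K0_induct (P := fun g => ∀ v, act g v = v) ?_ ?_ act_one ?_ ?_ hg v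
  · intro i j h; exact key i _ _ (of_mem_Fp h) (inv_mem (of_mem_Fp h)) (by simp)
  · intro i j k h h'; exact key i _ _ (one_mem _) (comm_mem_Fp h h') (by simp)
  · intro f g hf hg v; rw [act_mul, hg, hf]
  · intro f hf v
    conv_lhs => rw [← hf v]
    rw [← act_mul, inv_mul_cancel, act_one]

/-- signed permutations supported on `S` -/
def WS (S : Finset α) : Subgroup (MulAut (FreeGroup α)) where
  carrier := {w | w ∈ W α ∧ ∀ l, l ∉ S → w (of l) = of l}
  one_mem' := ⟨one_mem _, fun l _ => rfl⟩
  mul_mem' := by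
    rintro a b ⟨ha, ha'⟩ ⟨hb, hb'⟩
    exact ⟨mul_mem ha hb, fun l hl => by rw [MulAut.mul_apply, hb' l hl, ha' l hl]⟩
  inv_mem' := by
    rintro a ⟨ha, ha'⟩
    refine ⟨inv_mem ha, fun l hl => ?_⟩
    conv_lhs => rw [← ha' l hl]
    simp

theorem WS_mem_S {S : Finset α} {w : MulAut (FreeGroup α)} (hw : w ∈ WS S) {b : Bool} {i' : α}
    (hi : i ∈ S) (h : w (of i) = lt (i', b)) : i' ∈ S := by
  by_contra hn
  have h1 := hw.2 i' hn
  exact W_ne hw.1 h (h1.trans (lt_true i').symm) (by rintro rfl; exact hn hi) rfl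

/-- the group generated by everything supported on `S` -/
def Gam (S : Finset α) : Subgroup (MulAut (FreeGroup α)) :=
  Subgroup.closure ((K0 α : Set _) ∪ {f | ∃ i j, i ∈ S ∧ j ∈ S ∧ i ≠ j ∧ f = B i 1 (of j)} ∪ WS S)

theorem K0_le_Gam (S : Finset α) : K0 α ≤ Gam S := fun _ h =>
  Subgroup.subset_closure (Or.inl (Or.inl h))

theorem WS_le_Gam (S : Finset α) : WS S ≤ Gam S := fun _ h =>
  Subgroup.subset_closure (Or.inr h)

theorem WS_natAbs {S : Finset α} {w : MulAut (FreeGroup α)} (hw : w ∈ WS S) (v : α → ℤ) :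
    ∑ b : S, (act w v b).natAbs = ∑ b : S, (v b).natAbs := by
  choose L hL using hw.1
  have hinj : Function.Injective (fun i => (L i).1) := by
    intro i j hij
    by_contra hne
    exact W_ne hw.1 (hL i) (hL j) hne hij
  let σ := Equiv.ofBijective _ (Finite.injective_iff_bijective.1 hinj)
  rw [Finset.sum_coe_sort S (fun b => (act w v b).natAbs),
    Finset.sum_coe_sort S (fun b => (v b).natAbs)]
  symm
  apply Finset.sum_equiv σ
  · intro i
    constructor
    · intro hi; exact WS_mem_S hw hi (hL i)
    · intro hi
      by_contra hn
      have h1 := hw.2 i hn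
      have h2 := (hL i).symm.trans (h1.trans (lt_true i).symm)
      rw [lt_inj] at h2
      apply hn
      have h3 : σ i = i := by simp [σ, h2]
      rwa [h3] at hi
  · intro i _
    have : act w v (σ i) = sg (L i).2 * v i := act_W hw.1 (hL i) v
    rw [this]
    rcases sg_or (L i).2 with h | h <;> simp [h]

end Q
end IAab


namespace IAab
open FreeGroup hiding map_inv map_mul map_one
set_option linter.unusedSectionVars false
set_option linter.unusedSimpArgs false
open scoped commutatorElement

section Stab
variable {α : Type*} [DecidableEq α] [Fintype α]

/-- candidate stabiliser of `e_k` -/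
def HH (S : Finset α) (k : α) : Subgroup (MulAut (FreeGroup α)) :=
  Subgroup.closure ((Gam S : Set _) ∪ {f | ∃ i, i ∈ S ∧ f = B i 1 (of k)})

variable {S : Finset α} {k : α}

theorem Gam_le_HH : Gam S ≤ HH S k := fun _ h => Subgroup.subset_closure (Or.inl h)
theorem K0_le_HH : K0 α ≤ HH S k := (K0_le_Gam S).trans Gam_le_HH

theorem Bpow {i j : α} (h : i ≠ j) (m : ℤ) :
    B i 1 (of j ^ m) = (B i 1 (of j) : MulAut (FreeGroup α)) ^ m := by
  have hpos : ∀ n : ℕ, B i 1 (of j ^ (n : ℤ)) = (B i 1 (of j) : MulAut (FreeGroup α)) ^ n := by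
    intro n
    induction n with
    | zero => simp [B_one]
    | succ n ih =>
      rw [pow_succ, ← ih, B_mul (one_mem _) (pw h _) (one_mem _) (of_mem_Fp h.symm)]
      push_cast
      rw [zpow_add_one, mul_one]
  obtain ⟨n, rfl | rfl⟩ := Int.eq_nat_or_neg m
  · rw [hpos, zpow_natCast]
  · rw [zpow_neg (B i 1 (of j)), zpow_natCast, ← hpos, B_inv (one_mem _) (pw h _), zpow_neg, inv_one]

/-- elements that fix `x_k` -/
theorem Gam_coord (hk : k ∉ S) {g : MulAut (FreeGroup α)} (hg : g ∈ Gam S) :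
    (∀ v, act g v k = v k) ∧ act g (Pi.single k 1) = Pi.single k 1 := by
  have hneg : ∀ g : MulAut (FreeGroup α), 
    (∀ v, act g v k = v k) ∧ act g (Pi.single k 1) = Pi.single k 1 → 
    (∀ v, act g⁻¹ v k = v k) ∧ act g⁻¹ (Pi.single k 1) = Pi.single k 1 := by
    rintro g ⟨h1, h2⟩
    constructor
    · intro v
      rw [← h1 (act g⁻¹ v), ← act_mul, mul_inv_cancel, act_one]
    · conv_lhs => rw [← h2]
      rw [← act_mul, inv_mul_cancel, act_one]
  induction hg using Subgroup.closure_induction with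
  | mem x hx =>
    rcases hx with (hx | ⟨i, j, hi, hj, hij, rfl⟩) | hx
    · exact ⟨fun v => by rw [act_K0 hx], act_K0 hx _⟩
    · have hjk : k ≠ j := by rintro rfl; exact hk hj
      have hik : i ≠ k := by rintro rfl; exact hk hi
      have := act_B (m := 1) hij
      rw [zpow_one] at this
      constructor
      · intro v
        rw [this]; simp [hjk]
      · rw [this]; simp [hjk, hjk.symm, hik]
    · have h1 := hx.2 k hk
      constructor
      · intro v
        rw [act_W hx.1 (h1.trans (lt_true k).symm)]; simp [sg]
      · rw [act_single, h1, vec_of]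
  | one => exact ⟨fun v => by rw [act_one], act_one _⟩
  | mul x y _ _ hx hy =>
    exact ⟨fun v => by rw [act_mul, hx.1, hy.1], by rw [act_mul, hy.2, hx.2]⟩
  | inv x _ hx => exact hneg x hx

theorem HH_fix (hk : k ∉ S) {g : MulAut (FreeGroup α)} (hg : g ∈ HH S k) :
    act g (Pi.single k 1) = Pi.single k 1 := by
  induction hg using Subgroup.closure_induction with
  | mem x hx =>
    rcases hx with hx | ⟨i, hi, rfl⟩
    · exact (Gam_coord hk hx).2
    · have hik : i ≠ k := by rintro rfl; exact hk hi
      have := act_B (m := 1) hik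
      rw [zpow_one] at this
      rw [this]; simp [hik]
  | one => exact act_one _
  | mul x y _ _ hx hy => rw [act_mul, hy, hx]
  | inv x _ hx =>
    conv_lhs => rw [← hx]
    rw [← act_mul, inv_mul_cancel, act_one]

/-- image in the quotient -/
def HQ (S : Finset α) (k : α) : Subgroup (Q α) := (HH S k).map (QuotientGroup.mk' (K0 α))

theorem mem_HQ {g : MulAut (FreeGroup α)} : mq g ∈ HQ S k ↔ g ∈ HH S k := by
  constructor
  · rintro ⟨h, hh, e⟩
    have : mq h = mq g := e
    rw [mq_eq] at this
    have := mul_mem hh (K0_le_HH this)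
    simpa using this
  · intro h; exact ⟨g, h, rfl⟩

/-- coset space -/
abbrev XX (S : Finset α) (k : α) : Type _ := Q α ⧸ HQ S k

/-- projection to cosets -/
def qx (S : Finset α) (k : α) (g : MulAut (FreeGroup α)) : XX S k := QuotientGroup.mk (mq g)

theorem qx_eq {g h : MulAut (FreeGroup α)} : qx S k g = qx S k h ↔ g⁻¹ * h ∈ HH S k := by
  rw [← mem_HQ, mq_mul, mq_inv]; exact QuotientGroup.eq

theorem qx_smul (g h : MulAut (FreeGroup α)) : mq g • qx S k h = qx S k (g * h) := rfl

theorem qx_surj (x : XX S k) : ∃ g, qx S k g = x := by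
  induction x using QuotientGroup.induction_on with
  | _ x =>
    induction x using QuotientGroup.induction_on with
    | _ g => exact ⟨g, rfl⟩

/-- first column -/
noncomputable def col (x : XX S k) : α → ℤ := act (qx_surj x).choose (Pi.single k 1)

theorem col_qx (hk : k ∉ S) (g : MulAut (FreeGroup α)) : col (qx S k g) = act g (Pi.single k 1) := by
  have h := (qx_surj (qx S k g)).choose_spec
  unfold col
  set h' := (qx_surj (qx S k g)).choose
  rw [qx_eq] at h
  have h2 := HH_fix hk h
  conv_lhs => rw [← h2]
  rw [← act_mul, mul_inv_cancel_left]

theorem EE_WS {T : Finset α} {w : MulAut (FreeGroup α)} (hw : w ∈ WS T) {i j : α} (hi : i ∈ T) (hj : j ∈ T)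
    (hij : i ≠ j) {ε : ℤ} (hε : ε = 1 ∨ ε = -1) : ∃ i' j' ε' c, i' ∈ T ∧ j' ∈ T ∧ i' ≠ j' ∧
      (ε' = 1 ∨ ε' = -1) ∧ w (of i) = lt (i', c) ∧ mq w * EE i j ε = EE i' j' ε' * mq w := by
  obtain ⟨⟨i', b⟩, hb⟩ := hw.1 i
  obtain ⟨⟨j', c⟩, hc⟩ := hw.1 j
  refine ⟨i', j', _, b, WS_mem_S hw hi hb, WS_mem_S hw hj hc, W_ne hw.1 hb hc hij, ?_, hb,
    EE_W hw.1 hb hc hij⟩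
  rcases sg_or b with h | h <;> rcases sg_or c with h' | h' <;> rcases hε with h'' | h'' <;>
    simp [h, h', h'']

theorem EE_br {T : Finset α} {i j : α} (hi : i ∈ T) (hj : j ∈ T) (hij : i ≠ j) {ε : ℤ}
    (hε : ε = 1 ∨ ε = -1) : ∃ w ∈ WS T, mq w = EE i j ε * EE j i (-ε) * EE i j ε := by
  have key : ∃ w ∈ WS T, mq w = EE i j 1 * EE j i (-1) * EE i j 1 := by
    refine ⟨_, ⟨braid_W hij.symm, ?_⟩, ?_⟩
    · intro l hl
      have hli : l ≠ i := by rintro rfl; exact hl hi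
      have hlj : l ≠ j := by rintro rfl; exact hl hj
      rw [B_inv (of_mem_Fp hij) (inv_mem (of_mem_Fp hij))]
      simp [B_ne hli, B_ne hlj]
    · rw [mq_mul, mq_inv, mq_eq_one.2 (C_mem (of_mem_Fp hij)), inv_one, one_mul]
      simp [EE, mq_mul]
  rcases hε with rfl | rfl
  · exact key
  · obtain ⟨w, hw, e⟩ := key
    refine ⟨w⁻¹, inv_mem hw, ?_⟩
    rw [mq_inv, e, neg_neg, EE_neg hij, EE_neg hij.symm]
    group

/-- the peak reduction data -/
noncomputable def pk (hk : k ∉ S) : Peak ↥(insert k S) (XX S k) (Q α) where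
  E i j m := EE (i : α) j m
  W := (WS (insert k S)).map (QuotientGroup.mk' (K0 α))
  p x b := col x b
  hp := by
    intro i j ε x hij
    have hij' : (i : α) ≠ j := fun h => hij (Subtype.ext h)
    obtain ⟨g, rfl⟩ := qx_surj x
    ext b
    rw [EE, qx_smul, col_qx hk, col_qx hk, act_mul, act_B hij']
    by_cases hb : b = j
    · subst hb; simp
    · have hb' : (b : α) ≠ j := fun h => hb (Subtype.ext h)
      simp [hb, hb']
  hcomm := by
    intro i j k l ε δ h1 h2 h3 h4
    exact EE_comm (Subtype.coe_injective.ne h1) (Subtype.coe_injective.ne h2)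
      (Subtype.coe_injective.ne h3) (Subtype.coe_injective.ne h4)
  hst := by
    intro i j l ε δ h1 h2 h3
    exact EE_st (Subtype.coe_injective.ne h1) (Subtype.coe_injective.ne h2)
      (Subtype.coe_injective.ne h3)
  hinv := by
    intro i j ε h
    exact EE_neg (Subtype.coe_injective.ne h)
  hbr := by
    intro i j ε h hε
    obtain ⟨w, hw, e⟩ := EE_br i.2 j.2 (Subtype.coe_injective.ne h) hε
    exact ⟨w, hw, e⟩
  hW := by
    rintro _ ⟨w, hw, rfl⟩ i j ε hij hε
    obtain ⟨i', j', ε', c, h1, h2, h3, h4, h5, h6⟩ :=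
      EE_WS hw i.2 j.2 (Subtype.coe_injective.ne hij) hε
    exact ⟨⟨i', h1⟩, ⟨j', h2⟩, ε', fun h => h3 (congrArg Subtype.val h), h4, h6⟩
  hWn := by
    rintro _ ⟨w, hw, rfl⟩ x
    obtain ⟨g, rfl⟩ := qx_surj x
    have : (QuotientGroup.mk' (K0 α)) w • qx S k g = qx S k (w * g) := rfl
    rw [this, col_qx hk, col_qx hk, act_mul]
    exact WS_natAbs hw _

theorem EE_mem_HQ {i j : α} (hi : i ∈ S) (hj : j ∈ insert k S) (hij : i ≠ j) (m : ℤ) :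
    EE i j m ∈ HQ S k := by
  rw [EE, mem_HQ, Bpow hij]
  apply zpow_mem
  rw [Finset.mem_insert] at hj
  rcases hj with rfl | hj
  · exact Subgroup.subset_closure (Or.inr ⟨i, hi, rfl⟩)
  · exact Gam_le_HH (Subgroup.subset_closure (Or.inl (Or.inr ⟨i, j, hi, hj, hij, rfl⟩)))

theorem steps_symm {β X G : Type*} [Fintype β] [DecidableEq β] [Group G] [MulAction G X]
    {P : Peak β X G} {x y : X} (h : Relation.ReflTransGen P.Step x y) :
    Relation.ReflTransGen P.Step y x := by
  rw [← Relation.reflTransGen_swap]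
  refine Relation.ReflTransGen.mono ?_ _ _ h
  intro a b hab
  exact hab.symm

theorem Gam_steps (hk : k ∉ S) {g : MulAut (FreeGroup α)} (hg : g ∈ Gam (insert k S)) :
    ∀ x, Relation.ReflTransGen (pk hk).Step x (mq g • x) := by
  induction hg using Subgroup.closure_induction with
  | mem g hg =>
    intro x
    rcases hg with (hg | ⟨i, j, hi, hj, hij, rfl⟩) | hg
    · rw [mq_eq_one.2 hg, one_smul]
    · refine Relation.ReflTransGen.single (Or.inl ⟨⟨i, hi⟩, ⟨j, hj⟩, 1, ?_, Or.inl rfl, ?_⟩)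
      · exact fun h => hij (congrArg Subtype.val h)
      · simp [pk, EE]
    · exact Relation.ReflTransGen.single (Or.inr ⟨mq g, ⟨g, hg, rfl⟩, rfl⟩)
  | one => intro x; rw [mq_one, one_smul]
  | mul g h _ _ ihg ihh =>
    intro x
    rw [mq_mul, mul_smul]
    exact (ihh x).trans (ihg _)
  | inv g _ ihg =>
    intro x
    have := ihg (mq g⁻¹ • x)
    rw [mq_inv, smul_inv_smul] at this
    rw [mq_inv]
    exact steps_symm this

theorem stab (hk : k ∉ S) {g : MulAut (FreeGroup α)} (hg : g ∈ Gam (insert k S))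
    (hfix : act g (Pi.single k 1) = Pi.single k 1) : g ∈ HH S k := by
  have hsum : ∀ h : MulAut (FreeGroup α), act h (Pi.single k 1) = Pi.single k 1 →
      (pk hk).nrm (qx S k h) ≤ 1 := by
    intro h hh
    have : ∀ b : ↥(insert k S), ((pk hk).p (qx S k h) b).natAbs =
        if b = ⟨k, Finset.mem_insert_self k S⟩ then 1 else 0 := by
      intro b
      change (col (qx S k h) b).natAbs = _
      rw [col_qx hk, hh, Pi.single_apply]
      by_cases hb : (b : α) = k
      · have : b = ⟨k, Finset.mem_insert_self k S⟩ := Subtype.ext hb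
        simp [this]
      · have : b ≠ ⟨k, Finset.mem_insert_self k S⟩ := fun h => hb (congrArg Subtype.val h)
        simp [this, hb]
    unfold Peak.nrm
    simp [this]
  have hst := Gam_steps hk hg (qx S k 1)
  rw [qx_smul, mul_one] at hst
  have hbase : ∀ w ∈ (pk hk).W, ∀ i j ε, i ≠ j → (ε = 1 ∨ ε = -1) → (pk hk).p (w • qx S k 1) i = 0 →
      ∃ w' ∈ (pk hk).W, (pk hk).E i j ε • w • qx S k 1 = w' • qx S k 1 := by
    rintro _ ⟨w, hw, rfl⟩ i j ε hij hε h0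
    refine ⟨_, ⟨w, hw, rfl⟩, ?_⟩
    change EE (i : α) j ε • qx S k (w * 1) = qx S k (w * 1)
    have h0' : col (qx S k (w * 1)) i = 0 := h0
    rw [mul_one] at h0' ⊢
    rw [col_qx hk] at h0'
    obtain ⟨i', j', ε', c, h1, h2, h3, h4, h5, h6⟩ :=
      EE_WS (inv_mem hw) i.2 j.2 (Subtype.coe_injective.ne hij) hε
    have hik : i' ≠ k := by
      rintro rfl
      have h7 : w (of i') = lt (↑i, c) := by
        have : w (w⁻¹ (of ↑i)) = of ↑i := by simp
        rw [h5] at this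
        cases c
        · rw [lt_false, map_inv] at this
          rw [lt_false, ← this, inv_inv]
        · exact this
      rw [act_W hw.1 h7] at h0'
      rcases sg_or c with h | h <;> simp [h] at h0'
    have h8 : EE i' j' ε' ∈ HQ S k :=
      EE_mem_HQ ((Finset.mem_insert.1 h1).resolve_left hik) h2 h3 _
    have h9 : EE (i : α) j ε * mq w = mq w * EE i' j' ε' := by
      rw [mq_inv] at h6
      have := congrArg (fun t => mq w * t * mq w) h6
      simpa [mul_assoc] using this
    change ((EE (i : α) j ε * mq w : Q α) : XX S k) = ((mq w : Q α) : XX S k)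
    rw [h9, eq_comm, QuotientGroup.eq]
    simpa using h8
  obtain ⟨_, ⟨w, hw, rfl⟩, e⟩ := Peak.main (P := pk hk) (hsum 1 (act_one _)) hbase hst (hsum g hfix)
  have e' : qx S k g = qx S k (w * 1) := e
  rw [mul_one, eq_comm, qx_eq] at e'
  have h1 := HH_fix hk e'
  have h2 : act w (Pi.single k 1) = Pi.single k 1 := by
    conv_lhs => rw [← h1]
    rw [← act_mul, mul_inv_cancel_left, hfix]
  obtain ⟨⟨k', b⟩, hb⟩ := hw.1 k
  have h3 := act_W hw.1 hb (Pi.single k 1)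
  rw [h2] at h3
  have hkk : k' = k := by
    by_contra hne
    rcases sg_or b with h | h <;> simp [hne, h] at h3
  subst hkk
  have hbt : b = true := by
    cases b
    · simp [sg] at h3
    · rfl
  subst hbt
  have hwS : w ∈ WS S := by
    refine ⟨hw.1, fun l hl => ?_⟩
    by_cases hlk : l = k'
    · subst hlk; exact hb
    · exact hw.2 l (by simp [hl, hlk])
  have := mul_mem (Gam_le_HH (k := k') (WS_le_Gam S hwS)) e'
  simpa using this

end Stab
end IAab


namespace IAab
open FreeGroup hiding map_inv map_mul map_one
set_option linter.unusedSectionVars false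
set_option linter.unusedSimpArgs false
open scoped commutatorElement

section Fin
variable {α : Type*} [DecidableEq α] [Fintype α]

/-- `x_i ↦ x_i x_k^{m_i}` -/
def tmHom (k : α) (m : α → ℤ) : FreeGroup α →* FreeGroup α :=
  FreeGroup.lift (fun i => if i = k then of k else of i * of k ^ m i)

theorem tmHom_self (k : α) (m : α → ℤ) : tmHom k m (of k) = of k := by simp [tmHom]
theorem tmHom_ne {i k : α} (h : i ≠ k) (m : α → ℤ) : tmHom k m (of i) = of i * of k ^ m i := by
  simp [tmHom, h]

theorem tmHom_comp (k : α) (m m' : α → ℤ) : (tmHom k m).comp (tmHom k m') = tmHom k (m + m') := by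
  ext i
  by_cases h : i = k
  · subst h; simp [tmHom_self]
  · rw [MonoidHom.comp_apply, tmHom_ne h, tmHom_ne h, map_mul, map_zpow, tmHom_self, tmHom_ne h,
      Pi.add_apply, zpow_add, mul_assoc]

theorem tmHom_zero (k : α) : tmHom k (0 : α → ℤ) = MonoidHom.id _ := by
  ext i
  by_cases h : i = k
  · subst h; simp [tmHom_self]
  · simp [tmHom_ne h]

/-- `x_i ↦ x_i x_k^{m_i}` as automorphism -/
def TM (k : α) (m : α → ℤ) : MulAut (FreeGroup α) :=
  MonoidHom.toMulEquiv (tmHom k m) (tmHom k (-m))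
    (by rw [tmHom_comp, neg_add_cancel, tmHom_zero]) (by rw [tmHom_comp, add_neg_cancel, tmHom_zero])

theorem TM_self (k : α) (m : α → ℤ) : TM k m (of k) = of k := tmHom_self k m
theorem TM_ne {i k : α} (h : i ≠ k) (m : α → ℤ) : TM k m (of i) = of i * of k ^ m i := tmHom_ne h m

theorem TM_add (k : α) (m m' : α → ℤ) : TM k (m + m') = TM k m * TM k m' := by
  apply aut_ext
  intro i
  exact (DFunLike.congr_fun (tmHom_comp k m m') (of i)).symm

theorem TM_zero (k : α) {m : α → ℤ} (h : ∀ i, i ≠ k → m i = 0) : TM k m = 1 := by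
  apply aut_ext
  intro i
  by_cases hi : i = k
  · subst hi; rw [TM_self]; rfl
  · rw [TM_ne hi, h i hi]; simp

theorem TM_neg (k : α) (m : α → ℤ) : TM k (-m) = (TM k m)⁻¹ := by
  rw [eq_inv_iff_mul_eq_one, ← TM_add, neg_add_cancel, TM_zero k (m := 0) (fun _ _ => rfl)]

theorem TM_single {i k : α} (h : i ≠ k) (m : ℤ) : TM k (Pi.single i m) = B i 1 (of k ^ m) := by
  apply aut_ext
  intro j
  by_cases hj : j = k
  · subst hj; rw [TM_self, B_ne h.symm]
  · rw [TM_ne hj]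
    by_cases hi : j = i
    · subst hi; rw [B_self (one_mem _) (pw hj m)]; simp
    · rw [B_ne hi]; simp [hi]

variable {S : Finset α} {k : α}

/-- transvection subgroup modulo `K0` -/
def AQ (k : α) : Subgroup (Q α) where
  carrier := {x | ∃ m, mq (TM k m) = x}
  one_mem' := ⟨0, by rw [TM_zero k (m := 0) (fun _ _ => rfl), mq_one]⟩
  mul_mem' := by
    rintro _ _ ⟨m, rfl⟩ ⟨m', rfl⟩
    exact ⟨m + m', by rw [TM_add, mq_mul]⟩
  inv_mem' := by
    rintro _ ⟨m, rfl⟩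
    exact ⟨-m, by rw [TM_neg, mq_inv]⟩

theorem EE_mem_AQ {i k : α} (h : i ≠ k) (m : ℤ) : EE i k m ∈ AQ k :=
  ⟨Pi.single i m, by rw [TM_single h, EE]⟩

theorem conj_AQ_of (g : Q α) (h : ∀ i, i ≠ k → ∀ m, g * EE i k m * g⁻¹ ∈ AQ k) :
    ∀ x ∈ AQ k, g * x * g⁻¹ ∈ AQ k := by
  rintro _ ⟨m, rfl⟩
  let A : AddSubgroup (α → ℤ) :=
    { carrier := {m | g * mq (TM k m) * g⁻¹ ∈ AQ k}
      zero_mem' := by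
        change g * mq (TM k 0) * g⁻¹ ∈ AQ k
        rw [TM_zero k (m := 0) (fun _ _ => rfl), mq_one]; simp
      add_mem' := by
        intro a b ha hb
        have : (g * mq (TM k a) * g⁻¹) * (g * mq (TM k b) * g⁻¹) ∈ AQ k := (AQ k).mul_mem ha hb
        change g * mq (TM k (a + b)) * g⁻¹ ∈ AQ k
        rw [TM_add, mq_mul]
        simpa [mul_assoc] using this
      neg_mem' := by
        intro a ha
        have : (g * mq (TM k a) * g⁻¹)⁻¹ ∈ AQ k := (AQ k).inv_mem ha
        change g * mq (TM k (-a)) * g⁻¹ ∈ AQ k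
        rw [TM_neg, mq_inv]
        simpa [mul_assoc] using this }
  have hm : m ∈ A := by
    rw [← Finset.univ_sum_single m]
    apply sum_mem
    intro i _
    change g * mq (TM k (Pi.single i (m i))) * g⁻¹ ∈ AQ k
    by_cases hi : i = k
    · subst hi
      rw [TM_zero i (fun j hj => by simp [hj]), mq_one]; simp
    · rw [TM_single hi]; exact h i hi _
  exact hm

theorem conj_AQ (hk : k ∉ S) {g : MulAut (FreeGroup α)} (hg : g ∈ Gam S) :
    (∀ x ∈ AQ k, mq g * x * (mq g)⁻¹ ∈ AQ k) ∧ (∀ x ∈ AQ k, (mq g)⁻¹ * x * mq g ∈ AQ k) := by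
  have hWc : ∀ g ∈ WS S, ∀ x ∈ AQ k, mq g * x * (mq g)⁻¹ ∈ AQ k := by
    intro g hg
    apply conj_AQ_of
    intro i hi m
    obtain ⟨⟨i', b⟩, hb⟩ := hg.1 i
    have hkk := (hg.2 k hk).trans (lt_true k).symm
    rw [EE_W hg.1 hb hkk hi, mul_inv_cancel_right]
    exact EE_mem_AQ (W_ne hg.1 hb hkk hi) _
  have hE : ∀ i j, i ∈ S → j ∈ S → i ≠ j → ∀ m, ∀ x ∈ AQ k, (EE i j m)⁻¹ * x * EE i j m ∈ AQ k := by
    intro i j hi hj hij m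
    have hik : i ≠ k := by rintro rfl; exact hk hi
    have hjk : j ≠ k := by rintro rfl; exact hk hj
    have := conj_AQ_of (k := k) (EE i j m)⁻¹ ?_
    · simpa using this
    · intro a ha m'
      rw [inv_inv]
      by_cases haj : a = j
      · subst haj
        rw [mul_assoc, EE_st hij ha hik, mul_assoc, inv_mul_cancel_left]
        exact mul_mem (EE_mem_AQ ha _) (EE_mem_AQ hik _)
      · rw [mul_assoc, ← EE_comm hij ha (Ne.symm haj) hik, inv_mul_cancel_left]
        exact EE_mem_AQ ha _
  induction hg using Subgroup.closure_induction with
  | mem g hg =>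
    rcases hg with (hg | ⟨i, j, hi, hj, hij, rfl⟩) | hg
    · rw [mq_eq_one.2 hg]; simp
    · have h1 := hE i j hi hj hij 1
      have h2 := hE i j hi hj hij (-1)
      rw [EE_neg hij, inv_inv] at h2
      have : mq (B i 1 (of j)) = EE i j 1 := by simp [EE]
      rw [this]
      exact ⟨h2, h1⟩
    · refine ⟨hWc g hg, ?_⟩
      have := hWc g⁻¹ (inv_mem hg)
      simpa [mq_inv] using this
  | one => simp [mq_one]
  | mul x y _ _ hx hy =>
    refine ⟨fun f hf => ?_, fun f hf => ?_⟩
    · have := hx.1 _ (hy.1 f hf)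
      simpa [mul_assoc, mq_mul] using this
    · have := hy.2 _ (hx.2 f hf)
      simpa [mul_assoc, mq_mul] using this
  | inv x _ hx => exact ⟨by simpa [mq_inv] using hx.2, by simpa [mq_inv] using hx.1⟩

theorem HH_decomp (hk : k ∉ S) {g : MulAut (FreeGroup α)} (hg : g ∈ HH S k) :
    ∃ γ ∈ Gam S, (mq γ)⁻¹ * mq g ∈ AQ k := by
  have step : ∀ a ∈ AQ k, ∀ (x y : MulAut (FreeGroup α)), mq x = a →
      (∃ γ ∈ Gam S, (mq γ)⁻¹ * mq y ∈ AQ k) → ∃ γ ∈ Gam S, (mq γ)⁻¹ * mq (x * y) ∈ AQ k := by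
    rintro a ha x y rfl ⟨γ, hγ, h⟩
    refine ⟨γ, hγ, ?_⟩
    have := mul_mem ((conj_AQ hk hγ).2 _ ha) h
    rw [mq_mul]
    simpa [mul_assoc] using this
  have step2 : ∀ x ∈ Gam S, ∀ (y : MulAut (FreeGroup α)), 
      (∃ γ ∈ Gam S, (mq γ)⁻¹ * mq y ∈ AQ k) → ∃ γ ∈ Gam S, (mq γ)⁻¹ * mq (x * y) ∈ AQ k := by
    rintro x hx y ⟨γ, hγ, h⟩
    refine ⟨x * γ, mul_mem hx hγ, ?_⟩
    rw [mq_mul, mq_mul]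
    simpa [mul_assoc] using h
  have hB : ∀ i, i ∈ S → mq (B i 1 (of k)) ∈ AQ k := by
    intro i hi
    have hik : i ≠ k := by rintro rfl; exact hk hi
    have := EE_mem_AQ hik 1
    rwa [EE, zpow_one] at this
  induction hg using Subgroup.closure_induction_left with
  | one => exact ⟨1, one_mem _, by simp [one_mem]⟩
  | mul_left x hx y _ ih =>
    rcases hx with hx | ⟨i, hi, rfl⟩
    · exact step2 x hx y ih
    · exact step _ (hB i hi) _ y rfl ih
  | inv_mul_cancel x hx y _ ih =>
    rcases hx with hx | ⟨i, hi, rfl⟩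
    · exact step2 _ (inv_mem hx) y ih
    · exact step _ (inv_mem (hB i hi)) _ y (mq_inv _) ih

theorem Gam_trivial (S : Finset α) : ∀ g ∈ Gam S, (∀ v, act g v = v) → g ∈ K0 α := by
  induction S using Finset.induction_on with
  | empty =>
    intro g hg _
    have : Gam (∅ : Finset α) ≤ K0 α := by
      unfold Gam
      rw [Subgroup.closure_le]
      rintro x ((hx | ⟨i, j, hi, _⟩) | hx)
      · exact hx
      · simp at hi
      · have : x = 1 := aut_ext (fun i => hx.2 i (by simp))
        rw [this]; exact one_mem _
    exact this hg
  | insert k S hk ih =>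
    intro g hg htriv
    obtain ⟨γ, hγ, m, hm⟩ := HH_decomp hk (stab hk hg (htriv _))
    have h1 : mq g = mq (γ * TM k m) := by rw [mq_mul, hm, mul_inv_cancel_left]
    have h2 : ∀ v, act (γ * TM k m) v = v := by
      intro v
      rw [mq_eq] at h1
      have h3 := act_K0 h1 v
      have h4 : γ * TM k m = g * (g⁻¹ * (γ * TM k m)) := by group
      rw [h4, act_mul, h3, htriv]
    have h5 : TM k m = 1 := by
      apply TM_zero
      intro i hi
      have h6 := congrFun (h2 (Pi.single i 1)) k
      rw [act_mul, (Gam_coord hk hγ).1, act_single, TM_ne hi] at h6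
      simpa [hi, hi.symm, Ne.symm hi] using h6
    rw [h5, mul_one] at h1 h2
    rw [← mq_eq_one, h1, mq_eq_one]
    exact ih γ hγ h2

theorem mem_K0_iff (g : MulAut (FreeGroup α)) : g ∈ K0 α ↔ ∀ v, act g v = v := by
  refine ⟨fun h v => act_K0 h v, Gam_trivial Finset.univ g ?_⟩
  have h := nielsen g
  refine Subgroup.closure_mono ?_ h
  rintro x (hx | ⟨i, j, hij, rfl⟩)
  · exact Or.inr ⟨hx, fun l hl => absurd (Finset.mem_univ l) hl⟩
  · exact Or.inl (Or.inr ⟨i, j, Finset.mem_univ _, Finset.mem_univ _, Ne.symm hij, rfl⟩)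

/-- Magnus' theorem -/
theorem magnus (g : MulAut (FreeGroup α)) :
    g ∈ K0 α ↔ ∀ w, g w * w⁻¹ ∈ commutator (FreeGroup α) := by
  rw [mem_K0_iff]
  constructor
  · intro h w
    rw [mem_commutator_iff, vec_mul, act_vec, h, vec_inv, add_neg_cancel]
  · intro h v
    obtain ⟨w, rfl⟩ := vec_surj v
    have := h w
    rw [mem_commutator_iff, vec_mul, vec_inv, act_vec] at this
    rwa [← sub_eq_zero, sub_eq_add_neg]

end Fin
end IAab


namespace IAab
open FreeGroup hiding map_inv map_mul map_one
set_option linter.unusedSectionVars false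
set_option linter.unusedSimpArgs false
open scoped commutatorElement

/-- Heisenberg group -/
@[ext] structure Hs where
  a : ℤ
  b : ℤ
  c : ℤ

namespace Hs
instance : Mul Hs := ⟨fun x y => ⟨x.a + y.a, x.b + y.b, x.c + y.c + x.a * y.b⟩⟩
instance : One Hs := ⟨⟨0, 0, 0⟩⟩
instance : Inv Hs := ⟨fun x => ⟨-x.a, -x.b, -x.c + x.a * x.b⟩⟩
@[simp] theorem mul_a (x y : Hs) : (x * y).a = x.a + y.a := rfl
@[simp] theorem mul_b (x y : Hs) : (x * y).b = x.b + y.b := rfl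
@[simp] theorem mul_c (x y : Hs) : (x * y).c = x.c + y.c + x.a * y.b := rfl
@[simp] theorem one_a : (1 : Hs).a = 0 := rfl
@[simp] theorem one_b : (1 : Hs).b = 0 := rfl
@[simp] theorem one_c : (1 : Hs).c = 0 := rfl
@[simp] theorem inv_a (x : Hs) : (x⁻¹).a = -x.a := rfl
@[simp] theorem inv_b (x : Hs) : (x⁻¹).b = -x.b := rfl
@[simp] theorem inv_c (x : Hs) : (x⁻¹).c = -x.c + x.a * x.b := rfl
instance : Group Hs := Group.ofLeftAxioms
  (by intro x y z; ext <;> simp <;> ring)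
  (by intro x; ext <;> simp)
  (by intro x; ext <;> simp)
end Hs

section Ab
variable {α : Type*} [DecidableEq α] [Fintype α]

/-- Heisenberg representation -/
def hs (j k : α) : FreeGroup α →* Hs :=
  FreeGroup.lift (fun i => ⟨if i = j then 1 else 0, if i = k then 1 else 0, 0⟩)

/-- Magnus coefficient -/
def cc (j k : α) (w : FreeGroup α) : ℤ := (hs j k w).c

theorem hs_ab (j k : α) (w : FreeGroup α) : (hs j k w).a = vec w j ∧ (hs j k w).b = vec w k := by
  induction w using FreeGroup.induction_on with
  | C1 => simp
  | of i => simp [hs, Pi.single_apply, eq_comm]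
  | inv_of i hi => rw [map_inv]; simp [hi]
  | mul x y hx hy => rw [map_mul]; simp [hx, hy]

theorem cc_mul (j k : α) (u v : FreeGroup α) : cc j k (u * v) = cc j k u + cc j k v + vec u j * vec v k := by
  simp [cc, (hs_ab j k u).1, (hs_ab j k v).2]

@[simp] theorem cc_one (j k : α) : cc j k (1 : FreeGroup α) = 0 := by simp [cc]
@[simp] theorem cc_of (j k i : α) : cc j k (of i : FreeGroup α) = 0 := by simp [cc, hs]
theorem cc_inv (j k : α) (u : FreeGroup α) : cc j k u⁻¹ = - cc j k u + vec u j * vec u k := by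
  simp [cc, (hs_ab j k u).1, (hs_ab j k u).2]

theorem cc_comm (j k p q : α) : cc j k ⁅(of p : FreeGroup α), of q⁆ =
    (if p = j then 1 else 0) * (if q = k then 1 else 0) -
      (if q = j then 1 else 0) * (if p = k then 1 else 0) := by
  simp only [commutatorElement_def, cc_mul, cc_inv, cc_of, vec_mul, vec_inv, vec_of, Pi.add_apply,
    Pi.neg_apply, Pi.single_apply, eq_comm]
  ring

theorem vec_K0 {g : MulAut (FreeGroup α)} (hg : g ∈ K0 α) (w : FreeGroup α) : vec (g w) = vec w := by
  rw [act_vec, act_K0 hg]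

theorem cc_K0 {g : MulAut (FreeGroup α)} (hg : g ∈ K0 α) (j k : α) {w : FreeGroup α} (hw : vec w = 0) :
    cc j k (g w) = cc j k w := by
  let d : FreeGroup α →* Multiplicative ℤ :=
    { toFun := fun w => Multiplicative.ofAdd (cc j k (g w) - cc j k w)
      map_one' := by simp
      map_mul' := by
        intro x y
        rw [← ofAdd_add, map_mul, cc_mul, cc_mul, vec_K0 hg, vec_K0 hg]
        congr 1; ring }
  have h1 : w ∈ commutator (FreeGroup α) := (mem_commutator_iff w).2 hw
  have h2 := Abelianization.commutator_subset_ker d h1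
  rw [MonoidHom.mem_ker] at h2
  have h3 : cc j k (g w) - cc j k w = 0 := h2
  omega

/-- Johnson homomorphism coordinate -/
def tau (g : MulAut (FreeGroup α)) (i j k : α) : ℤ := cc j k (g (of i) * (of i)⁻¹)

theorem tau_mul {g h : MulAut (FreeGroup α)} (hg : g ∈ K0 α) (hh : h ∈ K0 α) (i j k : α) :
    tau (g * h) i j k = tau g i j k + tau h i j k := by
  have h0 : vec (h (of i) * (of i)⁻¹) = 0 := by simp [vec_K0 hh]
  have h1 : (g * h) (of i) * (of i)⁻¹ = g (h (of i) * (of i)⁻¹) * (g (of i) * (of i)⁻¹) := by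
    simp
  rw [tau, h1, cc_mul, cc_K0 hg j k h0, vec_K0 hg, h0, tau, tau]
  simp [add_comm]

theorem tau_inv {g : MulAut (FreeGroup α)} (hg : g ∈ K0 α) (i j k : α) :
    tau g⁻¹ i j k = - tau g i j k := by
  have := tau_mul (inv_mem hg) hg i j k
  rw [inv_mul_cancel] at this
  have h1 : tau (1 : MulAut (FreeGroup α)) i j k = 0 := by simp [tau]
  omega

theorem tau_C {p q : α} (h : p ≠ q) (i j k : α) : tau (B q (of p) (of p)⁻¹) i j k =
    if i = q then cc j k ⁅(of p : FreeGroup α), of q⁆ else 0 := by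
  rw [tau]
  split_ifs with hi
  · subst hi; rw [B_self (of_mem_Fp h) (inv_mem (of_mem_Fp h)), commutatorElement_def]
  · rw [B_ne hi]; simp

theorem tau_T {a p q : α} (h : p ≠ a) (h' : q ≠ a) (i j k : α) : tau (B a 1 ⁅of p, of q⁆) i j k =
    if i = a then cc j k ⁅(of p : FreeGroup α), of q⁆ else 0 := by
  rw [tau]
  split_ifs with hi
  · subst hi; rw [B_self (one_mem _) (comm_mem_Fp h h')]
    rw [cc_mul, cc_mul, cc_mul]
    simp [cc_inv]
  · rw [B_ne hi]; simp

end Ab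

section Abn
variable {n : ℕ}

/-- index set -/
abbrev Idx (n : ℕ) : Type := Fin n × {t : Fin n × Fin n // t.1 < t.2}

/-- generators -/
noncomputable def gen (i p q : Fin n) : MulAut (FreeGroup (Fin n)) :=
  if p = i then (B i (of q) (of q)⁻¹)⁻¹ else if q = i then B i (of p) (of p)⁻¹ else B i 1 ⁅of p, of q⁆

theorem gen_mem {i p q : Fin n} (h : p ≠ q) : gen i p q ∈ K0 (Fin n) := by
  unfold gen
  split_ifs with h1 h2
  · subst h1; exact inv_mem (C_mem (of_mem_Fp h.symm))
  · subst h2; exact C_mem (of_mem_Fp h)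
  · exact BK (one_mem _) (comm_mem_Fp h1 h2) (by simp)

theorem tau_gen {a p q : Fin n} (h : p ≠ q) (i j k : Fin n) : tau (gen a p q) i j k =
    if i = a then cc j k ⁅(of p : FreeGroup (Fin n)), of q⁆ else 0 := by
  unfold gen
  split_ifs with h1 h2 h3 h4 h5
  · subst h1; subst h2
    rw [tau_inv (C_mem (of_mem_Fp h.symm)), tau_C h.symm, if_pos rfl, cc_comm, cc_comm]; ring
  · subst h1
    rw [tau_inv (C_mem (of_mem_Fp h.symm)), tau_C h.symm, if_neg h2]; simp
  · subst h3; rw [tau_C h, if_pos h4]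
  · subst h3; rw [tau_C h, if_neg h4]
  · rw [tau_T h1 h3, if_pos h5]
  · rw [tau_T h1 h3, if_neg h5]

/-- Johnson homomorphism -/
def Tau (n : ℕ) : K0 (Fin n) →* Multiplicative (Idx n → ℤ) where
  toFun g := Multiplicative.ofAdd (fun b => tau g.1 b.1 b.2.1.1 b.2.1.2)
  map_one' := by
    have : (fun b : Idx n => tau (1 : MulAut (FreeGroup (Fin n))) b.1 b.2.1.1 b.2.1.2) = 0 := by
      ext b; simp [tau]
    exact congrArg Multiplicative.ofAdd this
  map_mul' := by
    intro g h
    rw [← ofAdd_add]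
    congr 1
    ext b
    exact tau_mul g.2 h.2 _ _ _

/-- generator classes -/
noncomputable def gc (b : Idx n) : Additive (Abelianization (K0 (Fin n))) :=
  Additive.ofMul (Abelianization.of ⟨gen b.1 b.2.1.1 b.2.1.2, gen_mem b.2.2.ne⟩)

/-- induced map -/
def TauA (n : ℕ) : Additive (Abelianization (K0 (Fin n))) →+ (Idx n → ℤ) :=
  MonoidHom.toAdditiveLeft (Abelianization.lift (Tau n))

theorem TauA_gc (b : Idx n) : TauA n (gc b) = Pi.single b 1 := by
  have h0 : TauA n (gc b) = fun b' => tau (gen b.1 b.2.1.1 b.2.1.2) b'.1 b'.2.1.1 b'.2.1.2 := rfl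
  rw [h0]
  obtain ⟨i, ⟨⟨p, q⟩, hpq⟩⟩ := b
  ext ⟨i', ⟨⟨p', q'⟩, hpq'⟩⟩
  dsimp only at hpq hpq' ⊢
  rw [tau_gen hpq.ne, cc_comm, Pi.single_apply]
  simp only [Prod.mk.injEq, Subtype.mk.injEq]
  have h1 : ¬ (q = p' ∧ p = q') := by rintro ⟨rfl, rfl⟩; exact absurd hpq hpq'.asymm
  by_cases a : i' = i <;> by_cases b : p = p' <;> by_cases c : q = q' <;>
    by_cases d : q = p' <;> by_cases e : p = q' <;> simp_all [eq_comm]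

/-- inverse map -/
noncomputable def Psi (n : ℕ) : (Idx n → ℤ) →+ Additive (Abelianization (K0 (Fin n))) where
  toFun f := ∑ b, f b • gc b
  map_zero' := by simp
  map_add' := by intro f g; simp [add_smul, Finset.sum_add_distrib]

theorem TauA_Psi (f : Idx n → ℤ) : TauA n (Psi n f) = f := by
  change TauA n (∑ b, f b • gc b) = f
  rw [map_sum]
  simp only [map_zsmul, TauA_gc]
  ext b
  simp [Finset.sum_apply, Pi.single_apply]

theorem gc_mem (b : Idx n) : gc b ∈ (Psi n).range := by
  refine ⟨Pi.single b 1, ?_⟩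
  change ∑ b', (Pi.single b 1 : Idx n → ℤ) b' • gc b' = _
  simp [Pi.single_apply]

theorem Psi_surj (x : Additive (Abelianization (K0 (Fin n)))) : x ∈ (Psi n).range := by
  have key : ∀ g ∈ K0 (Fin n), ∃ h : g ∈ K0 (Fin n), (Additive.ofMul (Abelianization.of
      (⟨g, h⟩ : K0 (Fin n)))) ∈ (Psi n).range := by
    intro g hg
    have hgen : ∀ i p q : Fin n, p < q → ∃ h : gen i p q ∈ K0 (Fin n), (Additive.ofMul (Abelianization.of
      (⟨gen i p q, h⟩ : K0 (Fin n)))) ∈ (Psi n).range :=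
      fun i p q h => ⟨gen_mem h.ne, gc_mem ⟨i, ⟨(p, q), h⟩⟩⟩
    have hinv : ∀ f, (∃ h : f ∈ K0 (Fin n), (Additive.ofMul (Abelianization.of
      (⟨f, h⟩ : K0 (Fin n)))) ∈ (Psi n).range) → (∃ h : f⁻¹ ∈ K0 (Fin n), (Additive.ofMul (Abelianization.of
      (⟨f⁻¹, h⟩ : K0 (Fin n)))) ∈ (Psi n).range) := by
      rintro f ⟨h, hf⟩
      exact ⟨inv_mem h, neg_mem hf⟩
    have hone : ∃ h : (1 : MulAut (FreeGroup (Fin n))) ∈ K0 (Fin n), (Additive.ofMul (Abelianization.of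
      (⟨1, h⟩ : K0 (Fin n)))) ∈ (Psi n).range := ⟨one_mem _, zero_mem _⟩
    refine K0_induct (P := fun g => ∃ h : g ∈ K0 (Fin n), (Additive.ofMul (Abelianization.of
      (⟨g, h⟩ : K0 (Fin n)))) ∈ (Psi n).range) ?_ ?_ hone ?_ hinv hg
    · intro i j hij
      rcases lt_or_gt_of_ne hij with h | h
      · have := hgen i j i h
        rwa [gen, if_neg hij, if_pos rfl] at this
      · have := hinv _ (hgen i i j h)
        rwa [gen, if_pos rfl, inv_inv] at this
    · intro i j k hj hk
      rcases lt_trichotomy j k with h | h | h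
      · have := hgen i j k h
        rwa [gen, if_neg hj, if_neg hk] at this
      · subst h
        rw [commutatorElement_self, B_one]; exact hone
      · have := hinv _ (hgen i k j h)
        rwa [gen, if_neg hk, if_neg hj, B_inv (one_mem _) (comm_mem_Fp hk hj), inv_one,
          commutatorElement_inv] at this
    · rintro f g ⟨hf, hf'⟩ ⟨hg, hg'⟩
      exact ⟨mul_mem hf hg, add_mem hf' hg'⟩
  obtain ⟨⟨g, hg⟩, rfl⟩ := (QuotientGroup.mk_surjective : Function.Surjective (Abelianization.of (G := K0 (Fin n)))) x
  exact (key g hg).2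

theorem K0_ab (n : ℕ) : Nonempty (Additive (Abelianization (K0 (Fin n))) ≃+ (Idx n → ℤ)) := by
  refine ⟨AddEquiv.ofBijective (TauA n) ⟨?_, fun f => ⟨Psi n f, TauA_Psi f⟩⟩⟩
  intro x y hxy
  obtain ⟨f, rfl⟩ := Psi_surj x
  obtain ⟨g, rfl⟩ := Psi_surj y
  rw [TauA_Psi, TauA_Psi] at hxy
  rw [hxy]

theorem card_pairs (n : ℕ) : Fintype.card {t : Fin n × Fin n // t.1 < t.2} = n.choose 2 := by
  rw [Fintype.card_subtype, Finset.card_filter, Fintype.sum_prod_type_right]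
  have h : ∀ y : Fin n, ∑ x : Fin n, (if x < y then 1 else 0) = (y : ℕ) := by
    intro y
    rw [← Finset.card_filter]
    have : Finset.univ.filter (fun x : Fin n => x < y) = Finset.Iio y := by ext; simp
    rw [this, Fin.card_Iio]
  simp only [h]
  rw [Fin.sum_univ_eq_sum_range (fun i => i) n, Finset.sum_range_id, Nat.choose_two_right]

theorem free_hom (n : ℕ) : Nonempty ((Idx n → ℤ) ≃+ ((Fin n → ℤ) →+ (⋀[ℤ]^2 (Fin n → ℤ)))) := by
  have e1 : Nonempty ((Idx n → ℤ) ≃ₗ[ℤ] ((Fin n → ℤ) →ₗ[ℤ] (⋀[ℤ]^2 (Fin n → ℤ)))) := by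
    refine ⟨LinearEquiv.ofFinrankEq _ _ ?_⟩
    rw [Module.finrank_linearMap, exteriorPower.finrank_eq]
    simp [card_pairs]
  exact ⟨e1.some.toAddEquiv.trans (addMonoidHomLequivInt ℤ).symm.toAddEquiv⟩

end Abn
end IAab


/-- The abelianization of `IA_n` is isomorphic, as an abelian group, to
`Hom(ℤⁿ, Λ²(ℤⁿ))` (hence free abelian of rank `n²(n-1)/2`). -/
theorem IA_abelianization (n : ℕ) (hn : 1 ≤ n) :
    Nonempty (Additive (Abelianization (IAGroup n)) ≃+
      ((Fin n → ℤ) →+ (⋀[ℤ]^2 (Fin n → ℤ)))) := by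
  have h : IAGroup n = IAab.K0 (Fin n) := by
    ext g
    exact (IAab.magnus g).symm
  rw [h]
  exact ⟨(IAab.K0_ab n).some.trans (IAab.free_hom n).some⟩
end

section
/- Let φ : K →* Aut(G) define an action of a group K on a group G, and let H = G ⋊_φ K be the corresponding semidirect product. Let (G_i)_{i≥1} and (K_i)_{i≥1} be families of subgroups of G and K with G_1 = G and K_1 = K, and assume each G_i is stable under φ(k) for every k ∈ K_i, so that H_i := {(g, k) ∈ H : g ∈ G_i, k ∈ K_i} is a subgroup of H. Then (H_i)_{i≥1} is a strongly central filtration of H if and only if the following three conditions hold: (G_i) is a strongly central filtration of G; (K_i) is a strongly central filtration of K; and for all i, j ≥ 1, every k ∈ K_j and every g ∈ G_i satisfy (φ(k)(g))·g⁻¹ ∈ G_{i+j}. -/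
/-- A strongly central filtration, encoded with shifted indices: `F i` stands for the
`(i+1)`-st term `G_{i+1}`, so that `F 0 = G`, the chain is descending, and
`⁅G_{i+1}, G_{j+1}⁆ ⊆ G_{(i+1)+(j+1)}` reads `⁅F i, F j⁆ ≤ F (i + j + 1)`. -/
def IsStronglyCentral {G : Type*} [Group G] (F : ℕ → Subgroup G) : Prop :=
  F 0 = ⊤ ∧ (∀ i, F (i + 1) ≤ F i) ∧ ∀ i j, ⁅F i, F j⁆ ≤ F (i + j + 1)

/-- The filtration `H_i = {(g, k) | g ∈ G_i, k ∈ K_i}` of the semidirect product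
`G ⋊[φ] K`; each term is a subgroup thanks to the stability hypothesis `hstab`. -/
def sdFiltration {G K : Type*} [Group G] [Group K] (φ : K →* MulAut G)
    (Gf : ℕ → Subgroup G) (Kf : ℕ → Subgroup K)
    (hstab : ∀ i, ∀ k ∈ Kf i, ∀ g ∈ Gf i, φ k g ∈ Gf i) (i : ℕ) :
    Subgroup (G ⋊[φ] K) where
  carrier := {x | x.left ∈ Gf i ∧ x.right ∈ Kf i}
  one_mem' := ⟨(Gf i).one_mem, (Kf i).one_mem⟩
  mul_mem' := by
    rintro a b ⟨hag, hak⟩ ⟨hbg, hbk⟩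
    refine ⟨?_, ?_⟩
    · rw [SemidirectProduct.mul_left]
      exact (Gf i).mul_mem hag (hstab i a.right hak b.left hbg)
    · rw [SemidirectProduct.mul_right]
      exact (Kf i).mul_mem hak hbk
  inv_mem' := by
    rintro a ⟨hag, hak⟩
    refine ⟨?_, ?_⟩
    · rw [SemidirectProduct.inv_left]
      exact hstab i a.right⁻¹ ((Kf i).inv_mem hak) a.left⁻¹ ((Gf i).inv_mem hag)
    · rw [SemidirectProduct.inv_right]
      exact (Kf i).inv_mem hak

open scoped commutatorElement

/-- The filtration `(H_i)` of `H = G ⋊[φ] K` is strongly central if and only if `(G_i)`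
and `(K_i)` are strongly central and `φ(k)(g)·g⁻¹ ∈ G_{i+j}` for every `k ∈ K_j`,
`g ∈ G_i` (shifted indexing as in `IsStronglyCentral`). -/
theorem sdFiltration_stronglyCentral_iff {G K : Type*} [Group G] [Group K]
    (φ : K →* MulAut G) (Gf : ℕ → Subgroup G) (Kf : ℕ → Subgroup K)
    (hG0 : Gf 0 = ⊤) (hK0 : Kf 0 = ⊤)
    (hstab : ∀ i, ∀ k ∈ Kf i, ∀ g ∈ Gf i, φ k g ∈ Gf i) :
    IsStronglyCentral (sdFiltration φ Gf Kf hstab) ↔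
      (IsStronglyCentral Gf ∧ IsStronglyCentral Kf ∧
        ∀ i j, ∀ k ∈ Kf j, ∀ g ∈ Gf i, φ k g * g⁻¹ ∈ Gf (i + j + 1)) := by
  have mem : ∀ (i : ℕ) (x : G ⋊[φ] K), x ∈ sdFiltration φ Gf Kf hstab i ↔
      x.left ∈ Gf i ∧ x.right ∈ Kf i := fun _ _ => Iff.rfl
  constructor
  · rintro ⟨-, hd, hc⟩
    refine ⟨⟨hG0, ?_, ?_⟩, ⟨hK0, ?_, ?_⟩, ?_⟩
    · intro i g hg
      have := hd i ((mem (i + 1) (SemidirectProduct.inl g)).2 ⟨by simpa using hg, by simp⟩)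
      simpa using ((mem _ _).1 this).1
    · intro i j
      rw [Subgroup.commutator_le]
      intro a ha b hb
      have := hc i j (Subgroup.commutator_mem_commutator
        ((mem i (SemidirectProduct.inl a)).2 ⟨by simpa using ha, by simp⟩)
        ((mem j (SemidirectProduct.inl b)).2 ⟨by simpa using hb, by simp⟩))
      rw [← map_commutatorElement] at this
      exact ((mem _ _).1 this).1
    · intro i g hg
      have := hd i ((mem (i + 1) (SemidirectProduct.inr g)).2 ⟨by simp, by simpa using hg⟩)
      simpa using ((mem _ _).1 this).2
    · intro i j
      rw [Subgroup.commutator_le]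
      intro a ha b hb
      have := hc i j (Subgroup.commutator_mem_commutator
        ((mem i (SemidirectProduct.inr a)).2 ⟨by simp, by simpa using ha⟩)
        ((mem j (SemidirectProduct.inr b)).2 ⟨by simp, by simpa using hb⟩))
      rw [← map_commutatorElement] at this
      exact ((mem _ _).1 this).2
    · intro i j k hk g hg
      have := hc j i (Subgroup.commutator_mem_commutator
        ((mem j (SemidirectProduct.inr k)).2 ⟨by simp, by simpa using hk⟩)
        ((mem i (SemidirectProduct.inl g)).2 ⟨by simpa using hg, by simp⟩))
      have h := ((mem _ _).1 this).1
      rw [add_comm j i] at h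
      simpa [commutatorElement_def] using h
  · rintro ⟨⟨-, hGd, hGc⟩, ⟨-, hKd, hKc⟩, hact⟩
    refine ⟨?_, ?_, ?_⟩
    · rw [eq_top_iff]
      intro x _
      rw [mem, hG0, hK0]
      exact ⟨trivial, trivial⟩
    · intro i x hx
      exact ⟨hGd i hx.1, hKd i hx.2⟩
    · intro i j
      rw [Subgroup.commutator_le]
      rintro ⟨a, k⟩ ⟨ha, hk⟩ ⟨b, l⟩ ⟨hb, hl⟩
      simp only at ha hk hb hl
      have hkl : ⁅k, l⁆ ∈ Kf (i + j + 1) := hKc i j (Subgroup.commutator_mem_commutator hk hl)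
      refine (mem _ _).2 ⟨?_, by simpa [commutatorElement_def] using hkl⟩
      have hN : (Gf (i + j + 1)).Normal := by
        constructor
        intro n hn g
        have h1 : ⁅g, n⁆ ∈ Gf (i + j + 1) := by
          have := hGc 0 (i + j + 1) (Subgroup.commutator_mem_commutator
            (by rw [hG0]; trivial : g ∈ Gf 0) hn)
          rw [zero_add] at this
          exact hGd _ this
        have := (Gf (i + j + 1)).mul_mem h1 hn
        simpa [commutatorElement_def] using this
      have hconj : k * l * k⁻¹ ∈ Kf j := by
        have h1 : ⁅k, l⁆ ∈ Kf j := by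
          have := hKc 0 j (Subgroup.commutator_mem_commutator
            (by rw [hK0]; trivial : k ∈ Kf 0) hl)
          rw [zero_add] at this
          exact hKd _ this
        have := (Kf j).mul_mem h1 hl
        simpa [commutatorElement_def] using this
      have e1 : (QuotientGroup.mk (φ k b) : G ⧸ Gf (i + j + 1)) = QuotientGroup.mk b := by
        have := hact j i k hk b hb
        rw [add_comm j i, ← QuotientGroup.eq_one_iff, QuotientGroup.mk_mul,
          QuotientGroup.mk_inv, mul_inv_eq_one] at this
        exact this
      have e2 : (QuotientGroup.mk (φ (k * l * k⁻¹) a⁻¹) : G ⧸ Gf (i + j + 1))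
          = QuotientGroup.mk a⁻¹ := by
        have := hact i j _ hconj a⁻¹ ((Gf i).inv_mem ha)
        rw [← QuotientGroup.eq_one_iff, QuotientGroup.mk_mul,
          QuotientGroup.mk_inv _ a⁻¹, mul_inv_eq_one] at this
        exact this
      have e3 : (QuotientGroup.mk (φ ⁅k, l⁆ b⁻¹) : G ⧸ Gf (i + j + 1))
          = QuotientGroup.mk b⁻¹ := by
        have := hact 0 _ _ hkl b⁻¹ (by rw [hG0]; trivial)
        rw [zero_add] at this
        have := hGd _ this
        rw [← QuotientGroup.eq_one_iff, QuotientGroup.mk_mul,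
          QuotientGroup.mk_inv, mul_inv_eq_one] at this
        exact this
      have e4 := hGc i j (Subgroup.commutator_mem_commutator ha hb)
      have key : (⁅(⟨a, k⟩ : G ⋊[φ] K), (⟨b, l⟩ : G ⋊[φ] K)⁆).left
          = a * φ k b * φ (k * l * k⁻¹) a⁻¹ * φ ⁅k, l⁆ b⁻¹ := by
        simp [commutatorElement_def, mul_assoc]
      rw [key, ← QuotientGroup.eq_one_iff, QuotientGroup.mk_mul, QuotientGroup.mk_mul,
        QuotientGroup.mk_mul, e1, e2, e3, ← QuotientGroup.mk_mul, ← QuotientGroup.mk_mul,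
        ← QuotientGroup.mk_mul, QuotientGroup.eq_one_iff]
      exact e4
end

section
/- Let p be a prime and G a group with a strongly central filtration (G_i)_{i≥1} which is p-restricted, meaning that g^p ∈ G_{p·i} for every i ≥ 1 and every g ∈ G_i. Let j ≥ 1 and let σ be an automorphism of G with σ(G_i) = G_i for all i ≥ 1 and σ(g)·g⁻¹ ∈ G_{i+j} for all i ≥ 1 and all g ∈ G_i. Then the p-th power σ^p satisfies σ^p(g)·g⁻¹ ∈ G_{i+p·j} for all i ≥ 1 and all g ∈ G_i. -/
open scoped commutatorElement

/-- discrete derivative -/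
def seqD {G : Type*} [Group G] (f : ℕ → G) : ℕ → G := fun n => f (n + 1) * (f n)⁻¹

/-- truncated polynomial sequences -/
def IsP {G : Type*} [Group G] (H : ℕ → Subgroup G) : ℕ → ℕ → (ℕ → G) → Prop
  | 0, _, _ => True
  | m + 1, d, f => (∀ n, f n ∈ H d) ∧ IsP H m (d + 1) (seqD f)

theorem isP_anti {G : Type*} [Group G] (H : ℕ → Subgroup G) (hH : Antitone H) (m : ℕ) :
    ∀ (d e : ℕ) (f : ℕ → G), d ≤ e → IsP H m e f → IsP H m d f := by
  induction m with
  | zero => intros; trivial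
  | succ m ih =>
    intro d e f hde hf
    exact ⟨fun n => hH hde (hf.1 n), ih _ _ _ (by omega) hf.2⟩

theorem isP_down {G : Type*} [Group G] (H : ℕ → Subgroup G) (m : ℕ) :
    ∀ (d : ℕ) (f : ℕ → G), IsP H (m + 1) d f → IsP H m d f := by
  induction m with
  | zero => intros; trivial
  | succ m ih =>
    intro d f hf
    exact ⟨hf.1, ih _ _ hf.2⟩

theorem isP_group {G : Type*} [Group G] (H : ℕ → Subgroup G) (hH : Antitone H)
    (hc : ∀ a b, ∀ x ∈ H a, ∀ y ∈ H b, ⁅x, y⁆ ∈ H (a + b)) (m : ℕ) :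
    (∀ d f g, IsP H m d f → IsP H m d g → IsP H m d (f * g)) ∧
    (∀ d f, IsP H m d f → IsP H m d f⁻¹) ∧
    (∀ d e f g, IsP H m d f → IsP H m e g → IsP H m (d + e) ⁅f, g⁆) := by
  induction m with
  | zero => exact ⟨fun _ _ _ _ _ => trivial, fun _ _ _ => trivial, fun _ _ _ _ _ _ => trivial⟩
  | succ m ih =>
    obtain ⟨hmul, hinv, hcom⟩ := ih
    have anti := isP_anti H hH m
    refine ⟨?_, ?_, ?_⟩
    · intro d f g hf hg
      refine ⟨fun n => (H d).mul_mem (hf.1 n) (hg.1 n), ?_⟩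
      have e : seqD (f * g) = seqD f * ⁅f, seqD g⁆ * seqD g := by
        funext n
        simp only [seqD, commutatorElement_def, Pi.mul_apply, Pi.inv_apply]
        group
      rw [e]
      refine hmul _ _ _ (hmul _ _ _ hf.2 ?_) hg.2
      exact anti _ _ _ (by omega) (hcom _ _ _ _ (isP_down H m _ _ hf) hg.2)
    · intro d f hf
      refine ⟨fun n => (H d).inv_mem (hf.1 n), ?_⟩
      have e : seqD f⁻¹ = ⁅f⁻¹, (seqD f)⁻¹⁆ * (seqD f)⁻¹ := by
        funext n
        simp only [seqD, commutatorElement_def, Pi.mul_apply, Pi.inv_apply]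
        group
      rw [e]
      have h2 := hinv _ _ hf.2
      refine hmul _ _ _ ?_ h2
      exact anti _ _ _ (by omega) (hcom _ _ _ _ (hinv _ _ (isP_down H m _ _ hf)) h2)
    · intro d e f g hf hg
      refine ⟨fun n => hc _ _ _ (hf.1 n) _ (hg.1 n), ?_⟩
      have hf0 := isP_down H m _ _ hf
      have hg0 := isP_down H m _ _ hg
      have hu := hf.2
      have hv := hg.2
      have hcc := hcom _ _ _ _ hf0 hg0
      have key : seqD ⁅f, g⁆ = ⁅seqD f, ⁅f, seqD g⁆ * ⁅seqD g, ⁅f, g⁆⁆⁆ *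
          (⁅f, seqD g⁆ * ⁅seqD g, ⁅f, g⁆⁆) * ⁅seqD f, ⁅f, g⁆⁆ *
          ⁅⁅f, g⁆, ⁅seqD f, seqD g * g⁆⁆ * ⁅seqD f, seqD g * g⁆ := by
        funext n
        simp only [seqD, commutatorElement_def, Pi.mul_apply, Pi.inv_apply]
        group
      rw [key]
      have hw : IsP H m (d + e + 1) (⁅f, seqD g⁆ * ⁅seqD g, ⁅f, g⁆⁆) :=
        hmul _ _ _ (anti _ _ _ (by omega) (hcom _ _ _ _ hf0 hv))
          (anti _ _ _ (by omega) (hcom _ _ _ _ hv hcc))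
      have hy : IsP H m (d + e + 1) ⁅seqD f, seqD g * g⁆ :=
        anti _ _ _ (by omega) (hcom _ _ _ _ hu
          (hmul e _ _ (anti _ _ _ (by omega) hv) hg0))
      refine hmul _ _ _ (hmul _ _ _ (hmul _ _ _ (hmul _ _ _ ?_ hw) ?_) ?_) hy
      · exact anti _ _ _ (by omega) (hcom _ _ _ _ hu hw)
      · exact anti _ _ _ (by omega) (hcom _ _ _ _ hu hcc)
      · exact anti _ _ _ (by omega) (hcom _ _ _ _ hcc hy)

theorem isP_one {G : Type*} [Group G] (H : ℕ → Subgroup G) (m : ℕ) :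
    ∀ d, IsP H m d (fun _ => (1 : G)) := by
  induction m with
  | zero => intros; trivial
  | succ m ih =>
    intro d
    refine ⟨fun n => (H d).one_mem, ?_⟩
    have : seqD (fun _ => (1 : G)) = fun _ => 1 := by funext n; simp [seqD]
    rw [this]; exact ih _

theorem isP_choose {G : Type*} [Group G] (H : ℕ → Subgroup G) (hH : Antitone H) (a : G) (m : ℕ) :
    ∀ k d, a ∈ H (k + d) → IsP H m d (fun n => a ^ (n.choose k)) := by
  induction m with
  | zero => intros; trivial
  | succ m ih =>
    intro k d ha
    refine ⟨fun n => (H d).pow_mem (hH (by omega) ha) _, ?_⟩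
    cases k with
    | zero =>
      have : seqD (fun n => a ^ (n.choose 0)) = fun _ => 1 := by funext n; simp [seqD]
      rw [this]; exact isP_one H m _
    | succ k =>
      have : seqD (fun n => a ^ (n.choose (k + 1))) = fun n => a ^ (n.choose k) := by
        funext n
        simp [seqD, Nat.choose_succ_succ, pow_add]
      rw [this]
      exact ih _ _ (by rwa [show k + (d + 1) = k + 1 + d by omega])

theorem isP_first {G : Type*} [Group G] (H : ℕ → Subgroup G) (k : ℕ) :
    ∀ m d f, k < m → IsP H m d f → (∀ n, n < k → f n = 1) → f k ∈ H (d + k) := by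
  induction k with
  | zero =>
    intro m d f hm hf _
    obtain ⟨m, rfl⟩ : ∃ m', m = m' + 1 := ⟨m - 1, by omega⟩
    exact hf.1 0
  | succ k ih =>
    intro m d f hm hf h
    obtain ⟨m, rfl⟩ : ∃ m', m = m' + 1 := ⟨m - 1, by omega⟩
    have := ih m (d + 1) (seqD f) (by omega) hf.2 (fun n hn => by
      simp [seqD, h n (by omega), h (n + 1) (by omega)])
    rw [show d + (k + 1) = d + 1 + k by omega]
    simpa [seqD, h k (by omega)] using this

theorem isP_final {G : Type*} [Group G] (H : ℕ → Subgroup G) (hH : Antitone H)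
    (hc : ∀ a b, ∀ x ∈ H a, ∀ y ∈ H b, ⁅x, y⁆ ∈ H (a + b)) (p : ℕ) (hp : p.Prime)
    (hr : ∀ k, 1 ≤ k → ∀ x ∈ H k, x ^ p ∈ H p) (l : ℕ) :
    ∀ k f, 1 ≤ k → k + l = p → IsP H (p + 1) 0 f → (∀ n, n < k → f n = 1) → f p ∈ H p := by
  induction l with
  | zero =>
    intro k f _ hk hf h
    obtain rfl : k = p := by omega
    simpa using isP_first H k _ _ f (by omega) hf h
  | succ l ih =>
    intro k f hk1 hk hf h
    have ha : f k ∈ H k := by simpa using isP_first H k _ _ f (by omega) hf h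
    obtain ⟨hmul, hinv, -⟩ := isP_group H hH hc (p + 1)
    have hg := hmul _ _ _ hf (hinv _ _ (isP_choose H hH (f k) (p + 1) k 0 (by simpa using ha)))
    have h1 := ih (k + 1) _ (by omega) (by omega) hg (by
      intro n hn
      rcases Nat.lt_succ_iff_lt_or_eq.1 hn with h' | rfl
      · simp [h n h', Nat.choose_eq_zero_of_lt h']
      · simp)
    have h2 : f k ^ (p.choose k) ∈ H p := by
      obtain ⟨c, hc'⟩ := hp.dvd_choose_self (k := k) (by omega) (by omega)
      rw [hc', pow_mul]
      exact (H p).pow_mem (hr k hk1 _ ha) _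
    have := (H p).mul_mem h1 h2
    simpa using this


/-- Let `(G_i)_{i≥1}` be a `p`-restricted strongly central filtration on `G` (`p` prime),
and `σ` an automorphism preserving the filtration with `σ(g)·g⁻¹ ∈ G_{i+j}` for all
`i ≥ 1`, `g ∈ G_i`.  Then `σ^p(g)·g⁻¹ ∈ G_{i+pj}` for all `i ≥ 1`, `g ∈ G_i`. -/
theorem p_restricted_andreadakis_power {G : Type*} [Group G] (p : ℕ) (hp : p.Prime)
    (Gf : ℕ → Subgroup G) (hG1 : Gf 1 = ⊤)
    (hdesc : ∀ i, 1 ≤ i → Gf (i + 1) ≤ Gf i)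
    (hsc : ∀ i j, 1 ≤ i → 1 ≤ j → ⁅Gf i, Gf j⁆ ≤ Gf (i + j))
    (hrestr : ∀ i, 1 ≤ i → ∀ g ∈ Gf i, g ^ p ∈ Gf (p * i))
    (j : ℕ) (hj : 1 ≤ j) (σ : MulAut G)
    (hfix : ∀ i, 1 ≤ i → Subgroup.map σ.toMonoidHom (Gf i) = Gf i)
    (hσ : ∀ i, 1 ≤ i → ∀ g ∈ Gf i, σ g * g⁻¹ ∈ Gf (i + j)) :
    ∀ i, 1 ≤ i → ∀ g ∈ Gf i, (σ ^ p) g * g⁻¹ ∈ Gf (i + p * j) := by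

  intro i hi g hg
  have step : ∀ k, Gf (i + (k + 1) * j) ≤ Gf (i + k * j) := by
    have anti : ∀ t s, 1 ≤ s → Gf (s + t) ≤ Gf s := by
      intro t
      induction t with
      | zero => intro s _; exact le_rfl
      | succ t ih => intro s hs; exact (hdesc (s + t) (by omega)).trans (ih s hs)
    intro k
    have := anti j (i + k * j) (by omega)
    rwa [show i + k * j + j = i + (k + 1) * j by ring] at this
  have anti : ∀ s t, 1 ≤ s → s ≤ t → Gf t ≤ Gf s := by
    intro s t hs hst
    induction t, hst using Nat.le_induction with
    | base => exact le_rfl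
    | succ t hst ih => exact (hdesc t (by omega)).trans ih
  set H : ℕ → Subgroup G := fun k => Gf (i + k * j) with hHdef
  have hH : Antitone H := antitone_nat_of_succ_le step
  have hc : ∀ a b, ∀ x ∈ H a, ∀ y ∈ H b, ⁅x, y⁆ ∈ H (a + b) := by
    intro a b x hx y hy
    have h1 := hsc (i + a * j) (i + b * j) (by omega) (by omega)
      (Subgroup.commutator_mem_commutator hx hy)
    exact anti (i + (a + b) * j) _ (by omega) (by rw [add_mul]; omega) h1
  have hr : ∀ k, 1 ≤ k → ∀ x ∈ H k, x ^ p ∈ H p := by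
    intro k hk x hx
    refine anti (i + p * j) _ (by omega) ?_ (hrestr (i + k * j) (by omega) x hx)
    have h1 : 1 * i ≤ p * i := Nat.mul_le_mul_right _ hp.one_lt.le
    have h2 : p * (1 * j) ≤ p * (k * j) := Nat.mul_le_mul_left _ (Nat.mul_le_mul_right _ hk)
    rw [mul_add]
    simp only [one_mul] at h1 h2
    omega
  have hpres : ∀ n s, 1 ≤ s → ∀ x ∈ Gf s, (σ ^ n) x ∈ Gf s := by
    intro n
    induction n with
    | zero => intro s _ x hx; simpa using hx
    | succ n ih =>
      intro s hs x hx
      rw [pow_succ, MulAut.mul_apply]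
      refine ih s hs _ ?_
      rw [← hfix s hs]
      exact ⟨x, hx, rfl⟩
  have horb : ∀ m d x, x ∈ H d → IsP H m d (fun n => (σ ^ n) x) := by
    intro m
    induction m with
    | zero => intros; trivial
    | succ m ih =>
      intro d x hx
      refine ⟨fun n => hpres n _ (by omega) x hx, ?_⟩
      have e : seqD (fun n => (σ ^ n) x) = fun n => (σ ^ n) (σ x * x⁻¹) := by
        funext n
        simp [seqD, pow_succ]
      rw [e]
      refine ih _ _ ?_
      have := hσ (i + d * j) (by omega) x hx
      rwa [show i + d * j + j = i + (d + 1) * j by ring] at this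
  have hg0 : g ∈ H 0 := by simpa [hHdef] using hg
  have hconst := isP_choose H hH g⁻¹ (p + 1) 0 0 (by simpa using hg0)
  have hprod := (isP_group H hH hc (p + 1)).1 _ _ _ (horb (p + 1) 0 g hg0) hconst
  have := isP_final H hH hc p hp hr (p - 1) 1 _ le_rfl
    (by have := hp.one_lt; omega) hprod (by
      intro n hn
      obtain rfl : n = 0 := by omega
      simp)
  simpa using this
end

section
/- Let G be a finitely generated nilpotent group and φ : G → G a group homomorphism. Then φ is bijective (an automorphism of G) if and only if the induced endomorphism of the abelianization G/⁅G,G⁆ is bijective. -/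
open scoped commutatorElement

theorem aux_hopf {Q : Type*} [Group Q] (hc : ∀ a b : Q, a * b = b * a) [Group.FG Q]
    (f : Q →* Q) (hf : Function.Surjective f) : Function.Injective f := by
  let : CommGroup Q := { ‹Group Q› with mul_comm := hc }
  have : AddGroup.FG (Additive Q) := inferInstance
  have : Module.Finite ℤ (Additive Q) := Module.Finite.iff_addGroup_fg.mpr this
  exact OrzechProperty.injective_of_surjective_endomorphism
    (MonoidHom.toAdditive f).toIntLinearMap hf

theorem aux_comm_mem {G : Type*} [Group G] (H N Z : Subgroup G) [N.Normal] [Z.Normal]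
    (hZ : ∀ z ∈ Z, ∀ g : G, ⁅z, g⁆ ∈ N) (h : H ⊔ Z = ⊤) : commutator G ≤ H ⊔ N := by
  rw [commutator_def, Subgroup.commutator_le]
  intro x _ y _
  have hq : ∀ z ∈ Z, ∀ g : G, (z : G ⧸ N) * g = g * z := by
    intro z hz g
    have := (QuotientGroup.eq_one_iff (N := N) _).mpr (hZ z hz g)
    rw [← QuotientGroup.mk_mul, ← QuotientGroup.mk_mul]
    have h2 : ((⁅z, g⁆ * (g * z) : G) : G ⧸ N) = ((g * z : G) : G ⧸ N) := by
      rw [QuotientGroup.mk_mul, this, one_mul]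
    rw [← h2]; congr 1; simp [commutatorElement_def, mul_assoc]
  obtain ⟨a, ha, z, hz, rfl⟩ := Subgroup.mem_sup_of_normal_right.mp (h ▸ Subgroup.mem_top x)
  obtain ⟨b, hb, w, hw, rfl⟩ := Subgroup.mem_sup_of_normal_right.mp (h ▸ Subgroup.mem_top y)
  have key : ((⁅a * z, b * w⁆ : G) : G ⧸ N) = ((⁅a, b⁆ : G) : G ⧸ N) := by
    have h1 : ∀ u : G ⧸ N, ⁅(z : G ⧸ N), u⁆ = 1 := by
      intro u
      obtain ⟨u, rfl⟩ := QuotientGroup.mk_surjective u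
      exact commutatorElement_eq_one_iff_mul_comm.mpr (hq z hz u)
    have h2 : ∀ u : G ⧸ N, u * (w : G ⧸ N) * u⁻¹ = w := by
      intro u
      obtain ⟨u, rfl⟩ := QuotientGroup.mk_surjective u
      rw [← hq w hw u, mul_inv_cancel_right]
    have h1' : ∀ u : G ⧸ N, (z : G ⧸ N) * u * (z : G ⧸ N)⁻¹ = u := by
      intro u
      obtain ⟨u, rfl⟩ := QuotientGroup.mk_surjective u
      rw [hq z hz u, mul_inv_cancel_right]
    simp only [commutatorElement_def, QuotientGroup.mk_mul, QuotientGroup.mk_inv]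
    generalize (z : G ⧸ N) = z at *
    generalize (w : G ⧸ N) = w at *
    generalize (a : G ⧸ N) = a at *
    generalize (b : G ⧸ N) = b at *
    calc a * z * (b * w) * (a * z)⁻¹ * (b * w)⁻¹
        = a * (z * (b * w) * z⁻¹) * a⁻¹ * (b * w)⁻¹ := by group
      _ = a * b * a⁻¹ * (a * w * a⁻¹) * (b * w)⁻¹ := by rw [h1']; group
      _ = a * b * a⁻¹ * b⁻¹ := by rw [h2]; group
  have h3 : (⁅a, b⁆)⁻¹ * ⁅a * z, b * w⁆ ∈ N := QuotientGroup.eq.mp key.symm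
  have h4 : ⁅a, b⁆ ∈ H := by
    rw [commutatorElement_def]
    exact H.mul_mem (H.mul_mem (H.mul_mem ha hb) (H.inv_mem ha)) (H.inv_mem hb)
  have := (H ⊔ N).mul_mem (Subgroup.mem_sup_left h4) (Subgroup.mem_sup_right h3)
  rwa [mul_inv_cancel_left] at this

theorem aux_gen {G : Type*} [Group G] [Group.IsNilpotent G] (H : Subgroup G)
    (h : H ⊔ commutator G = ⊤) : H = ⊤ := by
  have main : ∀ i, H ⊔ Subgroup.upperCentralSeries G i = ⊤ → H = ⊤ := by
    intro i
    induction i with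
    | zero => intro h; simpa using h
    | succ i ih =>
      intro h'
      apply ih
      rw [eq_top_iff, ← h]
      refine sup_le le_sup_left (aux_comm_mem H _ _ ?_ h')
      intro z hz g
      exact (Subgroup.mem_upperCentralSeries_succ_iff.mp hz) g
  obtain ⟨n, hn⟩ := Group.IsNilpotent.nilpotent G
  exact main n (by rw [hn]; simp)

abbrev lcs (G : Type*) [Group G] (n : ℕ) : Subgroup G := (⊤ : Subgroup G).lowerCentralSeries n

theorem aux_fg {G : Type*} [Group G] [Group.FG G] (n : ℕ) :
    ∃ A : Set G, A.Finite ∧ A ⊆ lcs G n ∧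
      lcs G n ≤ Subgroup.closure A ⊔ lcs G (n+1) := by
  obtain ⟨S, hS⟩ := Group.fg_def.mp ‹Group.FG G›
  induction n with
  | zero => exact ⟨S, S.finite_toSet, by simp, by rw [hS]; simp⟩
  | succ n ih =>
    obtain ⟨A, hA, hAn, hle⟩ := ih
    have hdesc : ∀ m, ∀ x ∈ lcs G m, ∀ g, ⁅x, g⁆ ∈ lcs G (m+1) := fun m x hx g => 
      Subgroup.commutator_mem_commutator hx (Subgroup.mem_top g)
    have hB : Set.image2 (fun a s : G => ⁅a, s⁆) A S ⊆ lcs G (n+1) := by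
      rintro _ ⟨a, ha, s, hs, rfl⟩
      exact hdesc n a (hAn ha) s
    refine ⟨_, hA.image2 _ S.finite_toSet, hB, ?_⟩
    set B := Set.image2 (fun a s : G => ⁅a, s⁆) A S
    set K := Subgroup.closure B ⊔ lcs G (n+1+1) with hK
    have hK1 : K ≤ lcs G (n+1) := sup_le ((Subgroup.closure_le _).mpr hB)
      (Subgroup.lowerCentralSeries_antitone _ (Nat.le_succ _))
    have hKn : K.Normal := by
      constructor
      intro k hk g
      have h1 : ⁅k, g⁆ ∈ K := Subgroup.mem_sup_right (hdesc _ k (hK1 hk) g)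
      have h2 : ⁅g, k⁆ ∈ K := by rw [← commutatorElement_inv]; exact K.inv_mem h1
      have := K.mul_mem h2 hk
      simpa [commutatorElement_def] using this
    -- centre mod K
    have hmem : ∀ x g : G, ⁅x, g⁆ ∈ K ↔ (g : G ⧸ K) * x = x * g := by
      intro x g
      rw [← QuotientGroup.eq_one_iff, ← QuotientGroup.mk'_apply, map_commutatorElement,
        commutatorElement_eq_one_iff_mul_comm]
      exact eq_comm
    have hcen : lcs G n ≤ (Subgroup.center (G ⧸ K)).comap (QuotientGroup.mk' K) := by
      refine hle.trans (sup_le ((Subgroup.closure_le _).mpr ?_) ?_)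
      · intro a ha
        have : (⊤ : Subgroup G) ≤ (Subgroup.centralizer {(a : G ⧸ K)}).comap (QuotientGroup.mk' K) := by
          rw [← hS, Subgroup.closure_le]
          intro s hs
          have : ⁅a, s⁆ ∈ K := Subgroup.mem_sup_left (Subgroup.subset_closure ⟨a, ha, s, hs, rfl⟩)
          simp only [Subgroup.coe_comap, Set.mem_preimage, SetLike.mem_coe,
            Subgroup.mem_centralizer_singleton_iff]
          first | exact (hmem a s).mp this | exact ((hmem a s).mp this).symm
        simp only [Subgroup.coe_comap, Set.mem_preimage, SetLike.mem_coe,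
            Subgroup.mem_center_iff]
        intro g
        obtain ⟨g, rfl⟩ := QuotientGroup.mk_surjective g
        have := this (Subgroup.mem_top g)
        simp only [Subgroup.mem_comap, 
            Subgroup.mem_centralizer_singleton_iff] at this
        first | exact this | exact this.symm
      · intro x hx
        simp only [Subgroup.mem_comap, Subgroup.mem_center_iff]
        intro g
        obtain ⟨g, rfl⟩ := QuotientGroup.mk_surjective g
        exact (hmem x g).mp (Subgroup.mem_sup_right (hdesc _ x hx g))
    have : ⁅lcs G n, (⊤ : Subgroup G)⁆ ≤ K := by
      rw [Subgroup.commutator_le]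
      intro x hx g _
      rw [hmem]
      exact Subgroup.mem_center_iff.mp (hcen hx) g
    exact this

theorem aux_inj {G : Type*} [Group G] [Group.FG G] (φ : G →* G) (hφ : Function.Surjective φ)
    (n : ℕ) : ∀ g, φ g ∈ lcs G n → g ∈ lcs G n := by
  have hmap : ∀ m, (lcs G m).map φ = lcs G m := by
    intro m
    rw [Subgroup.map_lowerCentralSeries, Subgroup.map_top_of_surjective φ hφ]
  induction n with
  | zero => intro g _; simp
  | succ n ih =>
    intro g hg
    have hanti : lcs G (n+1) ≤ lcs G n := Subgroup.lowerCentralSeries_antitone _ (Nat.le_succ _)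
    have hgn : g ∈ lcs G n := ih g (hanti hg)
    let N : Subgroup (lcs G n) := (lcs G (n+1)).subgroupOf (lcs G n)
    let ψ : lcs G n →* lcs G n := (φ.comp (lcs G n).subtype).codRestrict _
      (fun x => (hmap n).le ⟨x, x.2, rfl⟩)
    have hψ : Function.Surjective ψ := by
      rintro ⟨y, hy⟩
      have hy' := hy
      rw [← hmap n] at hy'
      obtain ⟨x, hx, hxy⟩ := hy'
      exact ⟨⟨x, hx⟩, Subtype.ext hxy⟩
    have hN : N ≤ N.comap ψ := by
      intro x hx
      change φ x ∈ lcs G (n+1)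
      rw [← hmap (n+1)]
      exact ⟨x, hx, rfl⟩
    have hfg : Group.FG (lcs G n ⧸ N) := by
      obtain ⟨A, hA, hAn, hle⟩ := aux_fg (G := G) n
      have hA' : (Subtype.val ⁻¹' A : Set (lcs G n)).Finite :=
        hA.preimage Subtype.val_injective.injOn
      rw [Group.fg_iff]
      refine ⟨QuotientGroup.mk' N '' (Subtype.val ⁻¹' A), ?_, hA'.image _⟩
      rw [← MonoidHom.map_closure, eq_top_iff]
      rintro q -
      obtain ⟨⟨x, hx⟩, rfl⟩ := QuotientGroup.mk_surjective q
      obtain ⟨a, ha, z, hz, haz⟩ := Subgroup.mem_sup_of_normal_right.mp (hle hx)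
      have hcl : Subgroup.closure A = (Subgroup.closure (Subtype.val ⁻¹' A : Set (lcs G n))).map
          (lcs G n).subtype := by
        rw [MonoidHom.map_closure]
        congr 1
        ext t
        constructor
        · intro ht; exact ⟨⟨t, hAn ht⟩, ht, rfl⟩
        · rintro ⟨t, ht, rfl⟩; exact ht
      rw [hcl] at ha
      obtain ⟨a, ha, rfl⟩ := ha
      refine ⟨a, ha, ?_⟩
      apply QuotientGroup.eq.mpr
      change (a : G)⁻¹ * x ∈ lcs G (n+1)
      rw [← haz]
      simpa using hz
    have hc : ∀ a b : lcs G n ⧸ N, a * b = b * a := by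
      intro a b
      obtain ⟨a, rfl⟩ := QuotientGroup.mk_surjective a
      obtain ⟨b, rfl⟩ := QuotientGroup.mk_surjective b
      apply QuotientGroup.eq.mpr
      change ((a : G) * b)⁻¹ * (b * a) ∈ lcs G (n+1)
      have := Subgroup.commutator_mem_commutator ((lcs G n).inv_mem b.2) (Subgroup.mem_top (a⁻¹ : G))
      simpa [commutatorElement_def, mul_assoc] using this
    have hinj := aux_hopf hc (QuotientGroup.map N N ψ hN) (by
      intro q
      obtain ⟨q, rfl⟩ := QuotientGroup.mk_surjective q
      obtain ⟨x, rfl⟩ := hψ q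
      exact ⟨x, rfl⟩)
    have h1 : ((⟨g, hgn⟩ : lcs G n) : lcs G n ⧸ N) = 1 := by
      apply hinj
      rw [map_one, QuotientGroup.map_mk]
      exact (QuotientGroup.eq_one_iff _).mpr hg
    have h2 : (⟨g, hgn⟩ : lcs G n) ∈ N := (QuotientGroup.eq_one_iff _).mp h1
    exact h2

/-- A homomorphism of a finitely generated nilpotent group to itself is bijective if and
only if the induced endomorphism of the abelianization is bijective. -/
theorem nilpotent_aut_iff_ab {G : Type*} [Group G] [Group.FG G] [Group.IsNilpotent G]
    (φ : G →* G) :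
    Function.Bijective φ ↔ Function.Bijective (Abelianization.map φ) := by
  constructor
  · intro h
    exact (MulEquiv.abelianizationCongr (MulEquiv.ofBijective φ h)).bijective
  · intro h
    have hs : Function.Surjective φ := by
      rw [← MonoidHom.range_eq_top]
      apply aux_gen
      rw [eq_top_iff]
      rintro x -
      obtain ⟨y, hy⟩ := h.2 (Abelianization.of x)
      obtain ⟨y, rfl⟩ := QuotientGroup.mk_surjective y
      have h1 : (φ y)⁻¹ * x ∈ commutator G := QuotientGroup.eq.mp hy
      have := (φ.range ⊔ commutator G).mul_mem (Subgroup.mem_sup_left ⟨y, rfl⟩)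
        (Subgroup.mem_sup_right h1)
      rwa [mul_inv_cancel_left] at this
    refine ⟨?_, hs⟩
    obtain ⟨n, hn⟩ := Subgroup.nilpotent_iff_lowerCentralSeries.mp ‹Group.IsNilpotent G›
    rw [injective_iff_map_eq_one]
    intro g hg
    have := aux_inj φ hs n g (by rw [hg]; exact one_mem _)
    rw [lcs, hn] at this
    simpa using this
end
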